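/- Bounds on the deterministic approximations with regular observables (Lemma 4.3). Fix κ > 0, let k ∈ [4] and let w_1, …, w_{k+1} ∈ C∖R be spectral parameters with Re w_j ∈ B_κ, and set η := min_j |Im w_j|. Then for bounded deterministic matrices A_1, …, A_k such that each A_i is (w_i, w_{i+1})-regular: (i) ‖M(w_1, A_1, …, A_k, w_{k+1})‖ ≲ η^{−⌊k/2⌋} if η ≤ 1, and ≲ η^{−(k+1)} if η > 1; (ii) |⟨M(w_1, A_1, …, A_{k−1}, w_k)·A_k⟩| ≲ max(η^{−(⌊k/2⌋−1)}, 1) if η ≤ 1, and ≲ η^{−k} if η > 1. -/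

import Mathlib

open MeasureTheory Matrix Filter Topology
open scoped ComplexOrder

noncomputable section

/-- Index type for `2N × 2N` block matrices. -/
abbrev Idx (N : ℕ) := Fin N ⊕ Fin N

/-- Square `2N × 2N` complex matrices. -/
abbrev Mat2 (N : ℕ) := Matrix (Idx N) (Idx N) ℂ

/-- Normalised trace `⟨A⟩ = (dim)⁻¹ Tr A`. -/
def ntr {n : Type*} [Fintype n] (A : Matrix n n ℂ) : ℂ :=
  (Fintype.card n : ℂ)⁻¹ * A.trace

/-- The block matrix `E₋ = [[1,0],[0,-1]]`. -/
def Em (N : ℕ) : Mat2 N :=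
  Matrix.fromBlocks 1 0 0 (-1)

/-- The self-energy operator `S[T] = ⟨T E₊⟩E₊ − ⟨T E₋⟩E₋`. -/
def Sop (N : ℕ) (T : Mat2 N) : Mat2 N :=
  ntr T • (1 : Mat2 N) - ntr (T * Em N) • Em N

/-- Imaginary part of a matrix, `Im A = (A − A*)/(2i)`. -/
def matIm {n : Type*} (A : Matrix n n ℂ) : Matrix n n ℂ :=
  (2 * Complex.I)⁻¹ • (A - Aᴴ)

/-- Hermitisation `[[0, Y],[Y*, 0]]`. -/
def herm {N : ℕ} (Y : Matrix (Fin N) (Fin N) ℂ) : Mat2 N :=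
  Matrix.fromBlocks 0 Y Yᴴ 0

/-- Resolvent `(H − w)⁻¹`. -/
def resv {n : Type*} [Fintype n] [DecidableEq n]
    (H : Matrix n n ℂ) (w : ℂ) : Matrix n n ℂ :=
  (H - w • 1)⁻¹

/-- The `ℓ² → ℓ²` operator norm of a matrix. -/
def opNorm {m n : Type*} [Fintype m] [Fintype n] [DecidableEq n]
    (A : Matrix m n ℂ) : ℝ :=
  ‖LinearMap.toContinuousLinearMap (Matrix.toEuclideanLin A)‖

/-- Euclidean norm of a vector. -/
def vnorm {n : Type*} [Fintype n] (x : n → ℂ) : ℝ :=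
  Real.sqrt (∑ a, ‖x a‖ ^ 2)

/-- The law of a normalised i.i.d. matrix entry: centred, unit variance,
vanishing second moment, and all moments finite. -/
structure IsIIDLaw (μ : Measure ℂ) : Prop where
  prob : IsProbabilityMeasure μ
  moments : ∀ p : ℕ, Integrable (fun z : ℂ => ‖z‖ ^ p) μ
  mean_zero : ∫ z, z ∂μ = 0
  unit_variance : ∫ z, ‖z‖ ^ 2 ∂μ = 1
  second_moment_zero : ∫ z, z ^ 2 ∂μ = 0

/-- `X` has independent entries, each distributed as `N^{-1/2}·χ` where `χ ∼ μ`. -/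
def HasIIDEntries (N : ℕ) {Ω : Type*} [MeasureSpace Ω]
    (μ : Measure ℂ) (X : Ω → Matrix (Fin N) (Fin N) ℂ) : Prop :=
  Measure.map (fun ω => fun p : Fin N × Fin N => X ω p.1 p.2) volume
    = Measure.pi fun _ : Fin N × Fin N =>
        Measure.map (fun z : ℂ => ((((N : ℝ) ^ (-(1/2 : ℝ))) : ℝ) : ℂ) * z) μ

/-- Stochastic domination `X ≺ Y` for `N`-indexed families of random variables,
uniformly in a parameter `u : U N`. -/
def StochDom (Ω : ℕ → Type*) [∀ N, MeasureSpace (Ω N)]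
    (U : ℕ → Type*) (X Y : (N : ℕ) → U N → Ω N → ℝ) : Prop :=
  ∀ ε : ℝ, 0 < ε → ∀ D : ℝ, 0 < D → ∃ N₀ : ℕ, ∀ N : ℕ, N₀ ≤ N → ∀ u : U N,
    volume {ω : Ω N | (N : ℝ) ^ ε * Y N u ω < X N u ω}
      ≤ ENNReal.ofReal ((N : ℝ) ^ (-D))

/-- `M` solves the Matrix Dyson Equation `−M(w)⁻¹ = w − Λ̂ + S[M(w)]`
with `Im M(w)·Im w > 0`. -/
def IsMDESolution (N : ℕ) (Λ : Matrix (Fin N) (Fin N) ℂ)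
    (M : ℂ → Mat2 N) : Prop :=
  ∀ w : ℂ, w.im ≠ 0 →
    M w * (w • (1 : Mat2 N) - herm Λ + Sop N (M w)) = -1 ∧
    (w.im • matIm (M w)).PosDef

/-- The scalar self-consistent equation
`m(w) = ∫ μ_Λ̂(de)/(e − (w + m(w))) = ⟨(Λ̂ − (w+m(w)))⁻¹⟩`, `Im m·Im w > 0`. -/
def IsScalarDyson (N : ℕ) (Λ : Matrix (Fin N) (Fin N) ℂ) (m : ℂ → ℂ) : Prop :=
  ∀ w : ℂ, w.im ≠ 0 →
    m w = ntr ((herm Λ - (w + m w) • (1 : Mat2 N))⁻¹) ∧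
    0 < (m w).im * w.im
/-- Real sign function. -/
def rsgn (x : ℝ) : ℝ := if 0 < x then 1 else if x < 0 then -1 else 0

/-- `E_σ` for a sign `σ = ±1`. -/
def EOf (N : ℕ) (σ : ℝ) : Mat2 N :=
  if 0 < σ then 1 else Em N

/-- The cutoff `1_δ^σ(w,w') = φ_δ(Re w − σ Re w')·φ_δ(Im w)·φ_δ(Im w')`. -/
def cutoff (φ : ℝ → ℝ) (σ : ℝ) (w w' : ℂ) : ℝ :=
  φ (w.re - σ * w'.re) * φ w.im * φ w'.im

/-- A smooth symmetric bump function adapted to scale `δ`. -/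
structure IsBump (δ : ℝ) (φ : ℝ → ℝ) : Prop where
  smooth : ContDiff ℝ (⊤ : ℕ∞) φ
  symmetric : ∀ x, φ (-x) = φ x
  nonneg : ∀ x, 0 ≤ φ x
  le_one : ∀ x, φ x ≤ 1
  eq_one : ∀ x : ℝ, |x| ≤ δ / 2 → φ x = 1
  eq_zero : ∀ x : ℝ, δ ≤ |x| → φ x = 0

/-- One singular-component term of the regularisation (for `τ = ±1`). -/
def regTerm (N : ℕ) (M : ℂ → Mat2 N) (φ : ℝ → ℝ)
    (w w' : ℂ) (A : Mat2 N) (τ : ℝ) : Mat2 N :=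
  ((cutoff φ (τ * (-rsgn (w.im * w'.im))) w w' : ℝ) : ℂ) •
    ((ntr (M w * A * M ((w'.re : ℂ) + ((τ * w'.im : ℝ) : ℂ) * Complex.I) *
          EOf N (τ * (-rsgn (w.im * w'.im)))) /
      ntr (M w * EOf N (τ * (-rsgn (w.im * w'.im))) *
          M ((w'.re : ℂ) + ((τ * w'.im : ℝ) : ℂ) * Complex.I) *
          EOf N (τ * (-rsgn (w.im * w'.im))))) •
      EOf N (τ * (-rsgn (w.im * w'.im))))

/-- The `(w,w')`-regularisation `Å^{w,w'}` of `A`. -/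
def regularize (N : ℕ) (M : ℂ → Mat2 N) (φ : ℝ → ℝ)
    (w w' : ℂ) (A : Mat2 N) : Mat2 N :=
  A - regTerm N M φ w w' A 1 - regTerm N M φ w w' A (-1)

/-- `A` is `(w,w')`-regular. -/
def IsRegularObs (N : ℕ) (M : ℂ → Mat2 N) (φ : ℝ → ℝ)
    (w w' : ℂ) (A : Mat2 N) : Prop :=
  A = regularize N M φ w w' A
/-- Defining relation (recursive Dyson equation) for the deterministic
two-resolvent approximation `M(w₁,A,w₂) = B₁₂⁻¹[M(w₁) A M(w₂)]`. -/
def IsChain2 (N : ℕ) (M : ℂ → Mat2 N)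
    (M2 : ℂ → Mat2 N → ℂ → Mat2 N) : Prop :=
  ∀ w₁ w₂ : ℂ, w₁.im ≠ 0 → w₂.im ≠ 0 → ∀ A : Mat2 N,
    M2 w₁ A w₂ - M w₁ * Sop N (M2 w₁ A w₂) * M w₂ = M w₁ * A * M w₂

/-- Defining relation for the three-resolvent approximation `M(w₁,A₁,w₂,A₂,w₃)`. -/
def IsChain3 (N : ℕ) (M : ℂ → Mat2 N)
    (M2 : ℂ → Mat2 N → ℂ → Mat2 N)
    (M3 : ℂ → Mat2 N → ℂ → Mat2 N → ℂ → Mat2 N) : Prop :=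
  ∀ w₁ w₂ w₃ : ℂ, w₁.im ≠ 0 → w₂.im ≠ 0 → w₃.im ≠ 0 → ∀ A₁ A₂ : Mat2 N,
    M3 w₁ A₁ w₂ A₂ w₃ - M w₁ * Sop N (M3 w₁ A₁ w₂ A₂ w₃) * M w₃ =
      M w₁ * A₁ * M2 w₂ A₂ w₃
      + ntr (M2 w₁ A₁ w₂) • (M w₁ * M2 w₂ A₂ w₃)
      - ntr (M2 w₁ A₁ w₂ * Em N) • (M w₁ * Em N * M2 w₂ A₂ w₃)

/-- Defining relation for the four-resolvent approximation. -/
def IsChain4 (N : ℕ) (M : ℂ → Mat2 N)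
    (M2 : ℂ → Mat2 N → ℂ → Mat2 N)
    (M3 : ℂ → Mat2 N → ℂ → Mat2 N → ℂ → Mat2 N)
    (M4 : ℂ → Mat2 N → ℂ → Mat2 N → ℂ → Mat2 N → ℂ → Mat2 N) : Prop :=
  ∀ w₁ w₂ w₃ w₄ : ℂ, w₁.im ≠ 0 → w₂.im ≠ 0 → w₃.im ≠ 0 → w₄.im ≠ 0 →
    ∀ A₁ A₂ A₃ : Mat2 N,
    M4 w₁ A₁ w₂ A₂ w₃ A₃ w₄ - M w₁ * Sop N (M4 w₁ A₁ w₂ A₂ w₃ A₃ w₄) * M w₄ =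
      M w₁ * A₁ * M3 w₂ A₂ w₃ A₃ w₄
      + ntr (M2 w₁ A₁ w₂) • (M w₁ * M3 w₂ A₂ w₃ A₃ w₄)
      - ntr (M2 w₁ A₁ w₂ * Em N) • (M w₁ * Em N * M3 w₂ A₂ w₃ A₃ w₄)
      + ntr (M3 w₁ A₁ w₂ A₂ w₃) • (M w₁ * M2 w₃ A₃ w₄)
      - ntr (M3 w₁ A₁ w₂ A₂ w₃ * Em N) • (M w₁ * Em N * M2 w₃ A₃ w₄)

/-- Defining relation for the five-resolvent approximation. -/
def IsChain5 (N : ℕ) (M : ℂ → Mat2 N)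
    (M2 : ℂ → Mat2 N → ℂ → Mat2 N)
    (M3 : ℂ → Mat2 N → ℂ → Mat2 N → ℂ → Mat2 N)
    (M4 : ℂ → Mat2 N → ℂ → Mat2 N → ℂ → Mat2 N → ℂ → Mat2 N)
    (M5 : ℂ → Mat2 N → ℂ → Mat2 N → ℂ → Mat2 N → ℂ → Mat2 N → ℂ → Mat2 N) : Prop :=
  ∀ w₁ w₂ w₃ w₄ w₅ : ℂ, w₁.im ≠ 0 → w₂.im ≠ 0 → w₃.im ≠ 0 → w₄.im ≠ 0 → w₅.im ≠ 0 →
    ∀ A₁ A₂ A₃ A₄ : Mat2 N,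
    M5 w₁ A₁ w₂ A₂ w₃ A₃ w₄ A₄ w₅
        - M w₁ * Sop N (M5 w₁ A₁ w₂ A₂ w₃ A₃ w₄ A₄ w₅) * M w₅ =
      M w₁ * A₁ * M4 w₂ A₂ w₃ A₃ w₄ A₄ w₅
      + ntr (M2 w₁ A₁ w₂) • (M w₁ * M4 w₂ A₂ w₃ A₃ w₄ A₄ w₅)
      - ntr (M2 w₁ A₁ w₂ * Em N) • (M w₁ * Em N * M4 w₂ A₂ w₃ A₃ w₄ A₄ w₅)
      + ntr (M3 w₁ A₁ w₂ A₂ w₃) • (M w₁ * M3 w₃ A₃ w₄ A₄ w₅)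
      - ntr (M3 w₁ A₁ w₂ A₂ w₃ * Em N) • (M w₁ * Em N * M3 w₃ A₃ w₄ A₄ w₅)
      + ntr (M4 w₁ A₁ w₂ A₂ w₃ A₃ w₄) • (M w₁ * M2 w₄ A₄ w₅)
      - ntr (M4 w₁ A₁ w₂ A₂ w₃ A₃ w₄ * Em N) • (M w₁ * Em N * M2 w₄ A₄ w₅)
section ChainBounds

open scoped Matrix.Norms.L2Operator

section NormalisedTrace

variable {n : Type*} [Fintype n]

theorem ntr_add (A B : Matrix n n ℂ) : ntr (A + B) = ntr A + ntr B := by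
  simp [ntr, mul_add]

theorem ntr_sub (A B : Matrix n n ℂ) : ntr (A - B) = ntr A - ntr B := by
  simp [ntr, mul_sub]

theorem ntr_neg (A : Matrix n n ℂ) : ntr (-A) = -ntr A := by
  simp [ntr]

theorem ntr_smul (c : ℂ) (A : Matrix n n ℂ) : ntr (c • A) = c * ntr A := by
  simp [ntr]; ring

theorem ntr_mul_comm (A B : Matrix n n ℂ) : ntr (A * B) = ntr (B * A) := by
  simp [ntr, Matrix.trace_mul_comm A B]

theorem ntr_conjTranspose (A : Matrix n n ℂ) : ntr Aᴴ = star (ntr A) := by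
  simp [ntr, Matrix.trace_conjTranspose]

theorem ntr_one [DecidableEq n] [Nonempty n] : ntr (1 : Matrix n n ℂ) = 1 := by
  simp [ntr]

theorem norm_apply_le_norm [DecidableEq n] (A : Matrix n n ℂ) (i j : n) : ‖A i j‖ ≤ ‖A‖ := by
  have h := Matrix.l2_opNorm_mulVec A (EuclideanSpace.single j (1 : ℂ))
  have h2 := PiLp.norm_apply_le ((EuclideanSpace.equiv n ℂ).symm
    (A.mulVec (EuclideanSpace.single j (1 : ℂ)).ofLp)) i
  simp at h h2
  exact h2.trans h

theorem norm_ntr_le [DecidableEq n] (A : Matrix n n ℂ) : ‖ntr A‖ ≤ ‖A‖ := by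
  rcases isEmpty_or_nonempty n with h | h
  · simp [ntr]
  · have hc : (0 : ℝ) < Fintype.card n := by exact_mod_cast Fintype.card_pos
    have h1 : ‖A.trace‖ ≤ Fintype.card n * ‖A‖ := by
      unfold Matrix.trace
      refine (norm_sum_le _ _).trans ?_
      refine (Finset.sum_le_sum fun i _ => norm_apply_le_norm A i i).trans ?_
      simp
    rw [ntr, norm_mul, norm_inv, Complex.norm_natCast, inv_mul_le_iff₀ hc]
    exact h1

/-- The normalised squared Hilbert–Schmidt norm `⟨A A*⟩`. -/
def hsq (A : Matrix n n ℂ) : ℝ := (ntr (A * Aᴴ)).re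

theorem hsq_eq_sum (A : Matrix n n ℂ) :
    hsq A = (Fintype.card n : ℝ)⁻¹ * ∑ j, ∑ i, ‖A i j‖ ^ 2 := by
  have h : (A * Aᴴ).trace = ((∑ j, ∑ i, ‖A i j‖ ^ 2 : ℝ) : ℂ) := by
    rw [Finset.sum_comm]
    simp only [Matrix.trace, Matrix.diag_apply, Matrix.mul_apply, Matrix.conjTranspose_apply,
      Complex.ofReal_sum]
    refine Finset.sum_congr rfl fun i _ => Finset.sum_congr rfl fun j _ => ?_
    simp [Complex.mul_conj, Complex.normSq_eq_norm_sq]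
  rw [hsq, ntr, h, ← Complex.ofReal_natCast, ← Complex.ofReal_inv, ← Complex.ofReal_mul,
    Complex.ofReal_re]

theorem hsq_nonneg (A : Matrix n n ℂ) : 0 ≤ hsq A := by
  rw [hsq_eq_sum]; positivity

theorem hsq_mul_le [DecidableEq n] (A B : Matrix n n ℂ) : hsq (A * B) ≤ ‖A‖ ^ 2 * hsq B := by
  rw [hsq_eq_sum, hsq_eq_sum, mul_left_comm, Finset.mul_sum _ _ (‖A‖ ^ 2)]
  refine mul_le_mul_of_nonneg_left (Finset.sum_le_sum fun j _ => ?_)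
    (by positivity : (0 : ℝ) ≤ (Fintype.card n : ℝ)⁻¹)
  have h := Matrix.l2_opNorm_mulVec A (WithLp.toLp 2 fun i => B i j)
  have h2 := pow_le_pow_left₀ (norm_nonneg _) h 2
  rw [mul_pow, EuclideanSpace.norm_sq_eq, EuclideanSpace.norm_sq_eq] at h2
  simpa [Matrix.mul_apply, Matrix.mulVec, dotProduct] using h2

theorem hsq_one [DecidableEq n] [Nonempty n] : hsq (1 : Matrix n n ℂ) = 1 := by
  simp [hsq, ntr_one]

theorem hsq_sub (A B : Matrix n n ℂ) :
    hsq (A - B) = hsq A + hsq B - 2 * (ntr (A * Bᴴ)).re := by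
  have h : ntr (B * Aᴴ) = star (ntr (A * Bᴴ)) := by
    rw [← ntr_conjTranspose]; simp
  simp only [hsq, Matrix.conjTranspose_sub, sub_mul, mul_sub, ntr_sub, h, Complex.sub_re]
  simp; ring

theorem hsq_smul (c : ℂ) (A : Matrix n n ℂ) : hsq (c • A) = ‖c‖ ^ 2 * hsq A := by
  simp only [hsq_eq_sum, Matrix.smul_apply, smul_eq_mul, norm_mul, mul_pow, ← Finset.mul_sum]
  ring

theorem norm_ntr_sq_le [DecidableEq n] [Nonempty n] (A : Matrix n n ℂ) :
    ‖ntr A‖ ^ 2 ≤ hsq A := by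
  have h := hsq_nonneg (A - ntr A • (1 : Matrix n n ℂ))
  rw [hsq_sub, hsq_smul, hsq_one] at h
  simp [ntr_smul] at h
  have h2 : (starRingEnd ℂ (ntr A) * ntr A).re = ‖ntr A‖ ^ 2 := by
    rw [← Complex.normSq_eq_conj_mul_self, Complex.ofReal_re, Complex.normSq_eq_norm_sq]
  simp at h2
  linarith

end NormalisedTrace

section Signs

theorem EOf_one (N : ℕ) : EOf N 1 = 1 := by simp [EOf]

theorem EOf_neg_one (N : ℕ) : EOf N (-1) = Em N := by norm_num [EOf]

theorem Em_mul_Em (N : ℕ) : Em N * Em N = 1 := by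
  simp [Em, Matrix.fromBlocks_multiply]

theorem Em_conjTranspose (N : ℕ) : (Em N)ᴴ = Em N := by
  simp [Em, Matrix.fromBlocks_conjTranspose]

theorem ntr_Em (N : ℕ) : ntr (Em N) = 0 := by
  simp [ntr, Em, Matrix.trace, Fintype.sum_sum_type]

theorem Em_mul_herm {N : ℕ} (Y : Matrix (Fin N) (Fin N) ℂ) :
    Em N * herm Y = -(herm Y * Em N) := by
  simp [Em, herm, Matrix.fromBlocks_multiply, Matrix.fromBlocks_neg]

theorem herm_conjTranspose {N : ℕ} (Y : Matrix (Fin N) (Fin N) ℂ) : (herm Y)ᴴ = herm Y := by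
  simp [herm, Matrix.fromBlocks_conjTranspose]

theorem norm_Em_le (N : ℕ) : ‖Em N‖ ≤ 1 := by
  have h := Matrix.l2_opNorm_conjTranspose_mul_self (Em N)
  rw [Em_conjTranspose, Em_mul_Em] at h
  have h1 : ‖(1 : Mat2 N)‖ ≤ 1 := by
    have := Matrix.l2_opNorm_diagonal (𝕜 := ℂ) (fun _ : Idx N => (1 : ℂ))
    rw [Matrix.diagonal_one] at this
    rw [this]
    exact (pi_norm_le_iff_of_nonneg zero_le_one).2 (by simp)
  nlinarith [norm_nonneg (Em N)]

theorem norm_one_le (N : ℕ) : ‖(1 : Mat2 N)‖ ≤ 1 := by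
  have h := Matrix.l2_opNorm_mul (Em N) (Em N)
  rw [Em_mul_Em] at h
  nlinarith [norm_nonneg (Em N), norm_Em_le N]

theorem norm_EOf_le (N : ℕ) (σ : ℝ) : ‖EOf N σ‖ ≤ 1 := by
  unfold EOf
  split_ifs
  · exact norm_one_le N
  · exact norm_Em_le N

/-- `σ` is a sign. -/
def IsSgn (σ : ℝ) : Prop := σ = 1 ∨ σ = -1

theorem IsSgn.mul {σ τ : ℝ} (hσ : IsSgn σ) (hτ : IsSgn τ) : IsSgn (σ * τ) := by
  rcases hσ with rfl | rfl <;> rcases hτ with rfl | rfl <;> norm_num [IsSgn]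

theorem IsSgn.neg {σ : ℝ} (hσ : IsSgn σ) : IsSgn (-σ) := by
  rcases hσ with rfl | rfl <;> norm_num [IsSgn]

theorem IsSgn.mul_self {σ : ℝ} (hσ : IsSgn σ) : σ * σ = 1 := by
  rcases hσ with rfl | rfl <;> norm_num

theorem IsSgn.abs {σ : ℝ} (hσ : IsSgn σ) : |σ| = 1 := by
  rcases hσ with rfl | rfl <;> norm_num

theorem IsSgn.norm {σ : ℝ} (hσ : IsSgn σ) : ‖(σ : ℂ)‖ = 1 := by
  rw [Complex.norm_real, Real.norm_eq_abs, hσ.abs]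

theorem EOf_mul_EOf (N : ℕ) {σ τ : ℝ} (hσ : IsSgn σ) (hτ : IsSgn τ) :
    EOf N σ * EOf N τ = EOf N (σ * τ) := by
  rcases hσ with rfl | rfl <;> rcases hτ with rfl | rfl <;>
    norm_num [EOf, Em_mul_Em]

theorem EOf_mul_self (N : ℕ) {σ : ℝ} (hσ : IsSgn σ) : EOf N σ * EOf N σ = 1 := by
  rw [EOf_mul_EOf N hσ hσ, hσ.mul_self, EOf_one]

theorem IsSgn.rsgn {x : ℝ} (hx : x ≠ 0) : IsSgn (rsgn x) := by
  unfold _root_.rsgn IsSgn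
  rcases lt_or_gt_of_ne hx with h | h
  · right; simp [h, h.le.not_gt]
  · left; simp [h]

theorem rsgn_mul (x y : ℝ) : rsgn (x * y) = rsgn x * rsgn y := by
  rcases lt_trichotomy x 0 with hx | rfl | hx <;> rcases lt_trichotomy y 0 with hy | rfl | hy <;>
    simp [rsgn, mul_pos_of_neg_of_neg, mul_neg_of_neg_of_pos, mul_neg_of_pos_of_neg, *,
      not_lt_of_gt]

theorem rsgn_mul_self_eq_abs (x : ℝ) : rsgn x * x = |x| := by
  rcases lt_trichotomy x 0 with hx | rfl | hx
  · simp [rsgn, hx, hx.le.not_gt, abs_of_neg hx]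
  · simp
  · simp [rsgn, hx, abs_of_pos hx]

theorem rsgn_neg (x : ℝ) : rsgn (-x) = -rsgn x := by
  rcases lt_trichotomy x 0 with hx | rfl | hx <;> simp [rsgn, *, not_lt_of_gt]

end Signs

section Resolvent

variable {n : Type*} [Fintype n] [DecidableEq n] {H : Matrix n n ℂ}

theorem isUnit_sub_smul_one (hH : Hᴴ = H) {u : ℂ} (hu : u.im ≠ 0) :
    IsUnit (H - u • (1 : Matrix n n ℂ)) := by
  by_contra h
  have hs : u ∈ spectrum ℂ H := by
    rw [spectrum.mem_iff, Algebra.algebraMap_eq_smul_one, ← IsUnit.neg_iff, neg_sub]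
    exact h
  have hsa : IsSelfAdjoint H := hH
  have h2 := hsa.mem_spectrum_eq_re hs
  exact hu (by rw [h2]; simp)

theorem sub_smul_one_mul_resv (hH : Hᴴ = H) {u : ℂ} (hu : u.im ≠ 0) :
    (H - u • (1 : Matrix n n ℂ)) * resv H u = 1 :=
  Matrix.mul_nonsing_inv _ ((Matrix.isUnit_iff_isUnit_det _).1 (isUnit_sub_smul_one hH hu))

theorem resv_mul_sub_smul_one (hH : Hᴴ = H) {u : ℂ} (hu : u.im ≠ 0) :
    resv H u * (H - u • (1 : Matrix n n ℂ)) = 1 :=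
  Matrix.nonsing_inv_mul _ ((Matrix.isUnit_iff_isUnit_det _).1 (isUnit_sub_smul_one hH hu))

theorem resv_conjTranspose (hH : Hᴴ = H) (u : ℂ) :
    (resv H u)ᴴ = resv H (starRingEnd ℂ u) := by
  rw [resv, Matrix.conjTranspose_nonsing_inv, resv]
  simp [hH]

theorem commute_resv (hH : Hᴴ = H) {u : ℂ} (hu : u.im ≠ 0) : Commute (resv H u) H := by
  have h1 := sub_smul_one_mul_resv hH hu
  have h2 := resv_mul_sub_smul_one hH hu
  rw [sub_mul, smul_one_mul] at h1
  rw [mul_sub, mul_smul_one] at h2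
  have : resv H u * H - H * resv H u = 0 := by
    have h3 := h2.trans h1.symm
    rw [sub_left_inj] at h3
    rw [h3, sub_self]
  exact sub_eq_zero.1 this

theorem resv_mul_resv (hH : Hᴴ = H) {u v : ℂ} (hu : u.im ≠ 0) (hv : v.im ≠ 0) :
    (u - v) • (resv H u * resv H v) = resv H u - resv H v := by
  have h1 := resv_mul_sub_smul_one hH hu
  have h2 := sub_smul_one_mul_resv hH hv
  have h3 : resv H u * ((H - v • (1 : Matrix n n ℂ)) - (H - u • (1 : Matrix n n ℂ))) * resv H v
      = resv H u - resv H v := by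
    rw [mul_sub, sub_mul, mul_assoc, h2, h1, mul_one, one_mul]
  rw [← h3]
  have h4 : (H - v • (1 : Matrix n n ℂ)) - (H - u • (1 : Matrix n n ℂ)) = (u - v) • 1 := by
    rw [sub_smul]; abel
  rw [h4, mul_smul_comm, mul_one, smul_mul_assoc]

theorem resv_mul_conjTranspose (hH : Hᴴ = H) {u : ℂ} (hu : u.im ≠ 0) :
    ((2 * u.im : ℝ) * Complex.I) • (resv H u * (resv H u)ᴴ) = resv H u - (resv H u)ᴴ := by
  rw [resv_conjTranspose hH, ← resv_mul_resv hH hu (by simpa using hu), Complex.sub_conj]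

theorem norm_resv_le (hH : Hᴴ = H) {u : ℂ} (hu : u.im ≠ 0) : ‖resv H u‖ ≤ |u.im|⁻¹ := by
  have h := congrArg norm (resv_mul_conjTranspose hH hu)
  have h2 := Matrix.l2_opNorm_conjTranspose_mul_self (resv H u)ᴴ
  rw [Matrix.conjTranspose_conjTranspose, Matrix.l2_opNorm_conjTranspose] at h2
  rw [norm_smul, h2] at h
  have h3 := norm_sub_le (resv H u) (resv H u)ᴴ
  rw [← h, Matrix.l2_opNorm_conjTranspose] at h3
  have hp := abs_pos.2 hu
  simp at h3
  rcases (norm_nonneg (resv H u)).eq_or_lt with h0 | h0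
  · rw [← h0]; positivity
  · rw [le_inv_comm₀ h0 hp, ← one_div, le_div_iff₀ h0]
    have : (2 * ‖resv H u‖) * (|u.im| * ‖resv H u‖) ≤ (2 * ‖resv H u‖) * 1 := by linarith
    exact le_of_mul_le_mul_left this (by positivity)

theorem im_mul_hsq_resv (hH : Hᴴ = H) {u : ℂ} (hu : u.im ≠ 0) :
    u.im * hsq (resv H u) = (ntr (resv H u)).im := by
  have h := congrArg ntr (resv_mul_conjTranspose hH hu)
  rw [ntr_smul, ntr_sub, ntr_conjTranspose] at h
  have h2 := congrArg Complex.im h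
  simp at h2
  unfold hsq
  linarith

theorem one_le_hsq_resv_mul [Nonempty n] (hH : Hᴴ = H) {u v : ℂ} (hu : u.im ≠ 0)
    (hv : v.im ≠ 0) {K : ℝ} (hKu : ‖H - u • (1 : Matrix n n ℂ)‖ ≤ K)
    (hKv : ‖H - v • (1 : Matrix n n ℂ)‖ ≤ K) :
    1 ≤ K ^ 4 * hsq (resv H u * resv H v) := by
  have hK : 0 ≤ K := (norm_nonneg _).trans hKu
  have h : (H - v • (1 : Matrix n n ℂ)) * (H - u • (1 : Matrix n n ℂ)) *
      (resv H u * resv H v) = 1 := by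
    rw [mul_assoc, ← mul_assoc _ (resv H u), sub_smul_one_mul_resv hH hu, one_mul,
      sub_smul_one_mul_resv hH hv]
  have h1 := hsq_mul_le ((H - v • (1 : Matrix n n ℂ)) * (H - u • (1 : Matrix n n ℂ)))
    (resv H u * resv H v)
  rw [h, hsq_one] at h1
  refine h1.trans (mul_le_mul_of_nonneg_right ?_ (hsq_nonneg _))
  calc ‖(H - v • (1 : Matrix n n ℂ)) * (H - u • (1 : Matrix n n ℂ))‖ ^ 2
      ≤ (K * K) ^ 2 := by
        refine pow_le_pow_left₀ (norm_nonneg _) ((norm_mul_le _ _).trans ?_) 2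
        exact mul_le_mul hKv hKu (norm_nonneg _) hK
    _ = K ^ 4 := by ring

theorem norm_sub_smul_one_le [Nonempty n] {u : ℂ} {a b : ℝ} (ha : ‖H‖ ≤ a) (hb : ‖u‖ ≤ b) :
    ‖H - u • (1 : Matrix n n ℂ)‖ ≤ a + b := by
  refine (norm_sub_le _ _).trans (add_le_add ha ?_)
  rw [norm_smul]
  have : ‖(1 : Matrix n n ℂ)‖ = 1 := CStarRing.norm_one
  rw [this, mul_one]
  exact hb

/-- The scalar stability factor `1 - ⟨R(u) R(v)⟩`. -/
def stab (H : Matrix n n ℂ) (u v : ℂ) : ℂ := 1 - ntr (resv H u * resv H v)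

theorem re_stab (hH : Hᴴ = H) {u v : ℂ} (hu : u.im ≠ 0) (hv : v.im ≠ 0) :
    2 * (stab H u v).re = (1 - hsq (resv H u)) + (1 - hsq (resv H v)) +
      ‖u - starRingEnd ℂ v‖ ^ 2 * hsq (resv H u * resv H (starRingEnd ℂ v)) := by
  have hv' : (starRingEnd ℂ v).im ≠ 0 := by simpa using hv
  rw [← hsq_smul, resv_mul_resv hH hu hv', hsq_sub, resv_conjTranspose hH, Complex.conj_conj]
  have : hsq (resv H (starRingEnd ℂ v)) = hsq (resv H v) := by
    rw [← resv_conjTranspose hH]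
    unfold hsq
    rw [Matrix.conjTranspose_conjTranspose, ntr_mul_comm]
  rw [this, stab, Complex.sub_re, Complex.one_re]
  ring

/-- `u = w + m` where `m` solves the scalar Dyson equation at `w`. -/
structure IsSol (H : Matrix n n ℂ) (w u : ℂ) : Prop where
  eq : u = w + ntr (resv H u)
  pos : 0 < (ntr (resv H u)).im * w.im

namespace IsSol

variable {w u w' u' : ℂ}

theorem im_ne (h : IsSol H w u) : w.im ≠ 0 := fun h0 => by
  have := h.pos; simp [h0] at this

theorem im_eq (h : IsSol H w u) : u.im = w.im + (ntr (resv H u)).im := by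
  conv_lhs => rw [h.eq]
  simp

theorem im_mul_pos (h : IsSol H w u) : 0 < w.im * u.im := by
  rw [h.im_eq]
  nlinarith [h.pos, mul_self_nonneg w.im]

theorem u_im_ne (h : IsSol H w u) : u.im ≠ 0 := fun h0 => by
  have := h.im_mul_pos; simp [h0] at this

theorem abs_im_eq (h : IsSol H w u) : |u.im| = |w.im| + |(ntr (resv H u)).im| := by
  have hp := h.pos
  rw [h.im_eq]
  rcases pos_and_pos_or_neg_and_neg_of_mul_pos hp with ⟨h1, h2⟩ | ⟨h1, h2⟩
  · rw [abs_of_pos h1, abs_of_pos h2, abs_of_pos (by linarith)]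
  · rw [abs_of_neg h1, abs_of_neg h2, abs_of_neg (by linarith)]; ring

theorem abs_im_le (h : IsSol H w u) : |w.im| ≤ |u.im| := by
  rw [h.abs_im_eq]; linarith [abs_nonneg (ntr (resv H u)).im]

theorem one_sub_hsq (hH : Hᴴ = H) (h : IsSol H w u) :
    1 - hsq (resv H u) = |w.im| / |u.im| := by
  have h1 := im_mul_hsq_resv hH h.u_im_ne
  have h2 : |u.im| * hsq (resv H u) = |(ntr (resv H u)).im| := by
    rw [← h1, abs_mul, abs_of_nonneg (hsq_nonneg _)]
  have h3 := abs_pos.2 h.u_im_ne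
  rw [eq_div_iff h3.ne', sub_mul, one_mul, mul_comm (hsq _), h2, h.abs_im_eq]
  ring

theorem hsq_lt_one (hH : Hᴴ = H) (h : IsSol H w u) : hsq (resv H u) < 1 := by
  have := h.one_sub_hsq hH
  have h2 : 0 < |w.im| / |u.im| := div_pos (abs_pos.2 h.im_ne) (abs_pos.2 h.u_im_ne)
  linarith

theorem norm_m_le [Nonempty n] (hH : Hᴴ = H) (h : IsSol H w u) : ‖ntr (resv H u)‖ ≤ 1 := by
  have h1 := norm_ntr_sq_le (resv H u)
  have h2 := h.hsq_lt_one hH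
  nlinarith [norm_nonneg (ntr (resv H u))]

theorem norm_u_le [Nonempty n] (hH : Hᴴ = H) (h : IsSol H w u) : ‖u‖ ≤ ‖w‖ + 1 := by
  rw [h.eq]
  exact (norm_add_le _ _).trans (by linarith [h.norm_m_le hH])

theorem stab_mul (hH : Hᴴ = H) (h : IsSol H w u) (h' : IsSol H w' u') :
    stab H u u' * (u - u') = w - w' := by
  have h1 := congrArg ntr (resv_mul_resv hH h.u_im_ne h'.u_im_ne)
  rw [ntr_smul, ntr_sub] at h1
  rw [stab, sub_mul, one_mul, mul_comm, h1]
  have e1 := h.eq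
  have e2 := h'.eq
  linear_combination e1 - e2

theorem re_stab_ge (hH : Hᴴ = H) (h : IsSol H w u) (h' : IsSol H w' u') :
    |w.im| / |u.im| ≤ 2 * (stab H u u').re ∧ |w'.im| / |u'.im| ≤ 2 * (stab H u u').re := by
  rw [re_stab hH h.u_im_ne h'.u_im_ne, h.one_sub_hsq hH, h'.one_sub_hsq hH]
  have h1 := hsq_nonneg (resv H u * resv H (starRingEnd ℂ u'))
  have h2 : 0 ≤ |w.im| / |u.im| := by positivity
  have h3 : 0 ≤ |w'.im| / |u'.im| := by positivity
  have h4 : 0 ≤ ‖u - starRingEnd ℂ u'‖ ^ 2 * hsq (resv H u * resv H (starRingEnd ℂ u')) := by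
    positivity
  constructor <;> linarith

theorem re_stab_ge_sq [Nonempty n] (hH : Hᴴ = H) (h : IsSol H w u) (h' : IsSol H w' u')
    {K : ℝ} (hKu : ‖H‖ + ‖u‖ ≤ K) (hKu' : ‖H‖ + ‖u'‖ ≤ K) :
    ‖u - starRingEnd ℂ u'‖ ^ 2 ≤ 2 * K ^ 4 * (stab H u u').re := by
  have hv' : (starRingEnd ℂ u').im ≠ 0 := by simpa using h'.u_im_ne
  have h1 := one_le_hsq_resv_mul hH h.u_im_ne hv'
    ((norm_sub_smul_one_le le_rfl le_rfl).trans hKu)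
    ((norm_sub_smul_one_le le_rfl (by simp)).trans hKu')
  have h2 := re_stab hH h.u_im_ne h'.u_im_ne
  have e1 := h.hsq_lt_one hH
  have e2 := h'.hsq_lt_one hH
  have hK4 : 0 ≤ K ^ 4 := by positivity
  have h3 : ‖u - starRingEnd ℂ u'‖ ^ 2 * 1 ≤ ‖u - starRingEnd ℂ u'‖ ^ 2 *
      (K ^ 4 * hsq (resv H u * resv H (starRingEnd ℂ u'))) :=
    mul_le_mul_of_nonneg_left h1 (by positivity)
  calc _ ≤ _ := (mul_one _).ge.trans h3
    _ = K ^ 4 * (‖u - starRingEnd ℂ u'‖ ^ 2 *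
      hsq (resv H u * resv H (starRingEnd ℂ u'))) := by ring
    _ ≤ K ^ 4 * (2 * (stab H u u').re) := by
      refine mul_le_mul_of_nonneg_left ?_ hK4
      linarith
    _ = _ := by ring

end IsSol

end Resolvent

section Chiral

variable {N : ℕ} (Y : Matrix (Fin N) (Fin N) ℂ)

theorem Em_mul_resv_mul_Em {u : ℂ} (hu : u.im ≠ 0) :
    Em N * resv (herm Y) u * Em N = -resv (herm Y) (-u) := by
  have hH := herm_conjTranspose Y
  have h1 := resv_mul_sub_smul_one hH hu
  have h2 := sub_smul_one_mul_resv hH (u := -u) (by simpa using hu)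
  have h3 : Em N * resv (herm Y) u * Em N * (herm Y - (-u) • (1 : Mat2 N)) = -1 := by
    have e : Em N * (herm Y - (-u) • (1 : Mat2 N)) = -((herm Y - u • (1 : Mat2 N)) * Em N) := by
      rw [mul_sub, sub_mul, Em_mul_herm]
      simp
      abel
    rw [mul_assoc, e, mul_neg, mul_assoc, ← mul_assoc _ _ (Em N), h1, one_mul, Em_mul_Em]
  calc Em N * resv (herm Y) u * Em N
      = Em N * resv (herm Y) u * Em N * ((herm Y - (-u) • (1 : Mat2 N)) *
          resv (herm Y) (-u)) := by rw [h2, mul_one]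
    _ = _ := by rw [← mul_assoc, h3, neg_one_mul]

theorem EOf_mul_resv_mul_EOf {σ : ℝ} (hσ : IsSgn σ) {u : ℂ} (hu : u.im ≠ 0) :
    EOf N σ * resv (herm Y) u * EOf N σ = (σ : ℂ) • resv (herm Y) (σ * u) := by
  rcases hσ with rfl | rfl
  · simp [EOf_one]
  · rw [EOf_neg_one, Em_mul_resv_mul_Em Y hu]; simp

theorem ntr_herm_mul_Em {Z : Mat2 N} (hZ : Commute Z (herm Y)) :
    ntr (herm Y * Z * Em N) = 0 := by
  have h : ntr (herm Y * Z * Em N) = -ntr (herm Y * Z * Em N) := by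
    calc ntr (herm Y * Z * Em N) = ntr (Z * Em N * herm Y) := by
          rw [mul_assoc, ntr_mul_comm]
      _ = -ntr (herm Y * Z * Em N) := by
          rw [mul_assoc, Em_mul_herm, mul_neg, ← mul_assoc, hZ.eq, ntr_neg]
  exact self_eq_neg.1 h

theorem ntr_resv_mul_Em {Z : Mat2 N} (hZ : Commute Z (herm Y)) (h0 : ntr (Z * Em N) = 0)
    {u : ℂ} (hu : u.im ≠ 0) : ntr (resv (herm Y) u * Z * Em N) = 0 := by
  have hH := herm_conjTranspose Y
  have h1 := congrArg (fun T => ntr (T * Z * Em N)) (sub_smul_one_mul_resv hH hu)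
  have hc : Commute (resv (herm Y) u * Z) (herm Y) := (commute_resv hH hu).mul_left hZ
  have h2 := ntr_herm_mul_Em Y hc
  simp only [sub_mul, smul_mul_assoc, one_mul, ntr_sub, ntr_smul, h0] at h1
  rw [← mul_assoc] at h2
  rw [h2, zero_sub, neg_eq_zero] at h1
  rcases mul_eq_zero.1 h1 with h | h
  · exact absurd (by simp [h]) hu
  · exact h

theorem ntr_resv_resv_Em {u v : ℂ} (hu : u.im ≠ 0) (hv : v.im ≠ 0) :
    ntr (resv (herm Y) u * resv (herm Y) v * Em N) = 0 := by
  refine ntr_resv_mul_Em Y (commute_resv (herm_conjTranspose Y) hv) ?_ hu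
  have := ntr_resv_mul_Em Y (Commute.one_left _) (by simpa using ntr_Em N) hv
  simpa using this

theorem ntr_resv_resv_resv_Em {u v z : ℂ} (hu : u.im ≠ 0) (hv : v.im ≠ 0) (hz : z.im ≠ 0) :
    ntr (resv (herm Y) u * resv (herm Y) v * resv (herm Y) z * Em N) = 0 := by
  have hH := herm_conjTranspose Y
  rw [mul_assoc (resv (herm Y) u)]
  exact ntr_resv_mul_Em Y ((commute_resv hH hv).mul_left (commute_resv hH hz))
    (ntr_resv_resv_Em Y hv hz) hu

theorem IsSol.neg_left {w u : ℂ} (h : IsSol (herm Y) w u) : IsSol (herm Y) (-w) (-u) := by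
  have e : ntr (resv (herm Y) (-u)) = -ntr (resv (herm Y) u) := by
    have h1 := congrArg ntr (Em_mul_resv_mul_Em Y h.u_im_ne)
    rw [ntr_mul_comm, ← mul_assoc, Em_mul_Em, one_mul, ntr_neg] at h1
    rw [h1, neg_neg]
  refine ⟨?_, ?_⟩
  · rw [e]
    linear_combination -h.eq
  · rw [e]; simpa using h.pos

theorem IsSol.sgn_mul {w u : ℂ} (h : IsSol (herm Y) w u) {σ : ℝ} (hσ : IsSgn σ) :
    IsSol (herm Y) (σ * w) (σ * u) := by
  rcases hσ with rfl | rfl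
  · simpa using h
  · simpa using h.neg_left Y

theorem norm_herm_le : ‖herm Y‖ ≤ ‖Y‖ := by
  have h : ∀ x : EuclideanSpace ℂ (Idx N), ‖toEuclideanCLM (n := Idx N) (𝕜 := ℂ) (herm Y) x‖ ≤
      ‖Y‖ * ‖x‖ := fun x => by
    have h1 := pow_le_pow_left₀ (norm_nonneg _)
      (Matrix.l2_opNorm_mulVec Y (WithLp.toLp 2 fun i => x (Sum.inr i))) 2
    have h2 := pow_le_pow_left₀ (norm_nonneg _)
      (Matrix.l2_opNorm_mulVec Yᴴ (WithLp.toLp 2 fun i => x (Sum.inl i))) 2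
    rw [Matrix.l2_opNorm_conjTranspose] at h2
    rw [mul_pow, EuclideanSpace.norm_sq_eq, EuclideanSpace.norm_sq_eq] at h1 h2
    refine le_of_sq_le_sq ?_ (by positivity)
    rw [mul_pow, EuclideanSpace.norm_sq_eq, EuclideanSpace.norm_sq_eq, Fintype.sum_sum_type,
      Fintype.sum_sum_type, mul_add]
    simp [herm, Matrix.mulVec, dotProduct, Fintype.sum_sum_type] at h1 h2 ⊢
    linarith
  rw [Matrix.cstar_norm_def]
  exact ContinuousLinearMap.opNorm_le_bound _ (norm_nonneg _) h

end Chiral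

section Bulk

variable {n : Type*} [Fintype n] [DecidableEq n] {H : Matrix n n ℂ} {w u w' u' : ℂ}

theorem IsSol.conj (hH : Hᴴ = H) (h : IsSol H w u) :
    IsSol H (starRingEnd ℂ w) (starRingEnd ℂ u) := by
  have e : ntr (resv H (starRingEnd ℂ u)) = starRingEnd ℂ (ntr (resv H u)) := by
    rw [← resv_conjTranspose hH, ntr_conjTranspose]; rfl
  refine ⟨?_, ?_⟩
  · rw [e, ← map_add, ← h.eq]
  · rw [e]; simpa using h.pos

/-- The real energy `e` has solutions approaching it from above whose imaginary part stays
above `c`. -/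
def IsBulk (H : Matrix n n ℂ) (c e : ℝ) : Prop :=
  ∀ ε₀ : ℝ, 0 < ε₀ → ∃ ε : ℝ, 0 < ε ∧ ε < ε₀ ∧ ∃ u : ℂ,
    IsSol H ((e : ℂ) + (ε : ℂ) * Complex.I) u ∧ c ≤ (ntr (resv H u)).im

/-- Bound on bulk energies. -/
def bulkRadius (L c : ℝ) : ℝ := (L / c + 1) / c + 1

/-- Lower bound on `|Im u|` above bulk energies. -/
def bulkIm (L c : ℝ) : ℝ := min 1 (c ^ 3 / (c ^ 2 + 2 * (L + bulkRadius L c + 2) ^ 4))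

theorem bulkRadius_pos {L c : ℝ} (hL : 0 ≤ L) (hc : 0 < c) : 0 < bulkRadius L c := by
  unfold bulkRadius; positivity

theorem bulkIm_pos {L c : ℝ} (hL : 0 ≤ L) (hc : 0 < c) : 0 < bulkIm L c := by
  have := bulkRadius_pos hL hc
  unfold bulkIm; positivity

theorem IsBulk.abs_le [Nonempty n] (hH : Hᴴ = H) {L c e : ℝ} (hL : ‖H‖ ≤ L) (hc : 0 < c)
    (he : IsBulk H c e) : |e| ≤ bulkRadius L c := by
  obtain ⟨ε, hε, -, u, hu, hm⟩ := he 1 one_pos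
  have hL0 := (norm_nonneg H).trans hL
  have h1 : c ≤ ‖ntr (resv H u)‖ := (hm.trans (le_abs_self _)).trans (Complex.abs_im_le_norm _)
  have h2 : c ≤ |u.im| := by
    rw [hu.abs_im_eq]
    linarith [le_abs_self (ntr (resv H u)).im, abs_nonneg ((e : ℂ) + (ε : ℂ) * Complex.I).im]
  have h3 : ‖resv H u‖ ≤ c⁻¹ := (norm_resv_le hH hu.u_im_ne).trans (by gcongr)
  have h4 := congrArg ntr (sub_smul_one_mul_resv hH hu.u_im_ne)
  rw [sub_mul, smul_one_mul, ntr_sub, ntr_smul, ntr_one] at h4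
  have h5 : u * ntr (resv H u) = ntr (H * resv H u) - 1 := by linear_combination -h4
  have h6 : ‖u‖ * c ≤ L / c + 1 := by
    calc ‖u‖ * c ≤ ‖u‖ * ‖ntr (resv H u)‖ := by gcongr
      _ = ‖ntr (H * resv H u) - 1‖ := by rw [← norm_mul, h5]
      _ ≤ ‖ntr (H * resv H u)‖ + 1 := by simpa using norm_sub_le (ntr (H * resv H u)) 1
      _ ≤ L / c + 1 := by
        gcongr
        refine (norm_ntr_le _).trans ((norm_mul_le _ _).trans ?_)
        rw [div_eq_mul_inv]
        gcongr
  have h7 : ‖u‖ ≤ (L / c + 1) / c := by rwa [le_div_iff₀ hc]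
  have h8 := hu.norm_m_le hH
  have h9 : |e| ≤ ‖(e : ℂ) + (ε : ℂ) * Complex.I‖ := by
    simpa using Complex.abs_re_le_norm ((e : ℂ) + (ε : ℂ) * Complex.I)
  have h10 : (e : ℂ) + (ε : ℂ) * Complex.I = u - ntr (resv H u) := by
    linear_combination -hu.eq
  rw [h10] at h9
  have := norm_sub_le u (ntr (resv H u))
  unfold bulkRadius
  linarith

theorem IsBulk.im_ge_of_pos [Nonempty n] (hH : Hᴴ = H) {L c : ℝ} (hL : ‖H‖ ≤ L) (hc : 0 < c)
    (he : IsBulk H c w.re) (h : IsSol H w u) (hw : 0 < w.im) : bulkIm L c ≤ u.im := by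
  have hu : 0 < u.im := (pos_iff_pos_of_mul_pos h.im_mul_pos).1 hw
  have hle : w.im ≤ u.im := by
    have := h.abs_im_le
    rwa [abs_of_pos hw, abs_of_pos hu] at this
  rcases le_or_gt 1 w.im with h1 | h1
  · exact (min_le_left _ _).trans (h1.trans hle)
  refine (min_le_right _ _).trans ?_
  have hR := he.abs_le hH hL hc
  have hL0 := (norm_nonneg H).trans hL
  have hR0 := bulkRadius_pos hL0 hc
  obtain ⟨ε, hε, hεw, u₀, hu₀, hm⟩ := he w.im hw
  set w₀ : ℂ := (w.re : ℂ) + (ε : ℂ) * Complex.I with hw₀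
  have hre : w₀.re = w.re := by simp [hw₀]
  have him : w₀.im = ε := by simp [hw₀]
  set R := bulkRadius L c
  have n1 : ‖w‖ ≤ R + 1 := (Complex.norm_le_abs_re_add_abs_im w).trans (by
    rw [abs_of_pos hw]; linarith)
  have n2 : ‖w₀‖ ≤ R + 1 := (Complex.norm_le_abs_re_add_abs_im w₀).trans (by
    rw [hre, him, abs_of_pos hε]; linarith)
  have n3 := h.norm_u_le hH
  have n4 := hu₀.norm_u_le hH
  have n5 := h.re_stab_ge_sq hH hu₀ (K := L + R + 2) (by linarith) (by linarith)
  have i0 : c ≤ u₀.im := by rw [hu₀.im_eq, him]; linarith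
  have n6 : c ≤ ‖u - starRingEnd ℂ u₀‖ := by
    have := Complex.abs_im_le_norm (u - starRingEnd ℂ u₀)
    simp at this
    rw [abs_of_pos (by linarith)] at this
    linarith
  have n7 : c ^ 2 ≤ 2 * (L + R + 2) ^ 4 * ‖stab H u u₀‖ := by
    refine (pow_le_pow_left₀ hc.le n6 2).trans (n5.trans ?_)
    gcongr
    exact Complex.re_le_norm _
  have n8 : ‖stab H u u₀‖ * ‖u - u₀‖ ≤ w.im := by
    rw [← norm_mul, h.stab_mul hH hu₀]
    refine (Complex.norm_le_abs_re_add_abs_im _).trans ?_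
    simp [hre, him]
    rw [abs_of_pos (by linarith)]
    linarith
  have n9 : u₀.im - u.im ≤ ‖u - u₀‖ := by
    have := Complex.abs_im_le_norm (u - u₀)
    have h2 := neg_abs_le (u - u₀).im
    simp at this h2
    linarith
  have n10 : c ^ 2 * ‖u - u₀‖ ≤ 2 * (L + R + 2) ^ 4 * u.im := by
    calc c ^ 2 * ‖u - u₀‖ ≤ 2 * (L + R + 2) ^ 4 * ‖stab H u u₀‖ * ‖u - u₀‖ := by gcongr
      _ = 2 * (L + R + 2) ^ 4 * (‖stab H u u₀‖ * ‖u - u₀‖) := by ring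
      _ ≤ 2 * (L + R + 2) ^ 4 * u.im := by
        gcongr
        exact n8.trans hle
  rw [div_le_iff₀ (by positivity)]
  have : c ^ 2 * (c - u.im) ≤ c ^ 2 * ‖u - u₀‖ := by
    gcongr; linarith
  nlinarith

theorem IsBulk.im_ge [Nonempty n] (hH : Hᴴ = H) {L c : ℝ} (hL : ‖H‖ ≤ L) (hc : 0 < c)
    (he : IsBulk H c w.re) (h : IsSol H w u) : bulkIm L c ≤ |u.im| := by
  rcases lt_or_gt_of_ne h.im_ne with hw | hw
  · have h2 := IsBulk.im_ge_of_pos hH hL hc (w := starRingEnd ℂ w) (by simpa using he)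
      (h.conj hH) (by simpa using hw)
    simp at h2
    exact h2.trans (neg_le_abs _)
  · exact (IsBulk.im_ge_of_pos hH hL hc he h hw).trans (le_abs_self _)

/-- A solution with uniform control of the real energy and of the imaginary part. -/
structure IsGood (H : Matrix n n ℂ) (a K : ℝ) (w u : ℂ) : Prop where
  sol : IsSol H w u
  im_ge : a ≤ |u.im|
  re_le : ‖H‖ + |w.re| + 2 ≤ K

namespace IsGood

variable {a K : ℝ}

theorem norm_add_le_of_lt [Nonempty n] (hH : Hᴴ = H) (h : IsGood H a K w u) (hw : |w.im| < 1) :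
    ‖H‖ + ‖u‖ ≤ K := by
  have h1 := h.sol.norm_u_le hH
  have h2 := Complex.norm_le_abs_re_add_abs_im w
  linarith [h.re_le]

theorem half_le [Nonempty n] (hH : Hᴴ = H) (h : IsGood H a K w u) (hw : 1 ≤ |w.im|) :
    1 / 2 ≤ |w.im| / |u.im| := by
  rw [le_div_iff₀ (abs_pos.2 h.sol.u_im_ne), h.sol.abs_im_eq]
  have := (Complex.abs_im_le_norm _).trans (h.sol.norm_m_le hH)
  linarith

theorem quarter_le [Nonempty n] (hH : Hᴴ = H) (h : IsGood H a K w u) (h' : IsGood H a K w' u')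
    (hw : 1 ≤ |w.im| ∨ 1 ≤ |w'.im|) : 1 / 4 ≤ ‖stab H u u'‖ := by
  have h1 := h.sol.re_stab_ge hH h'.sol
  have h2 := Complex.re_le_norm (stab H u u')
  rcases hw with hw | hw
  · have := h.half_le hH hw
    linarith [h1.1]
  · have := h'.half_le hH hw
    linarith [h1.2]

theorem one_le_K (h : IsGood H a K w u) : 1 ≤ K := by
  linarith [h.re_le, norm_nonneg H, abs_nonneg w.re]

theorem stab_ge [Nonempty n] (hH : Hᴴ = H) (ha : 0 < a) (ha1 : a ≤ 1) (h : IsGood H a K w u)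
    (h' : IsGood H a K w' u') (hs : 0 < w.im * w'.im) :
    a ^ 2 / (4 * K ^ 4) ≤ ‖stab H u u'‖ := by
  have hK := h.one_le_K
  have hK4 : 1 ≤ K ^ 4 := one_le_pow₀ hK
  by_cases hw : 1 ≤ |w.im| ∨ 1 ≤ |w'.im|
  · refine le_trans ?_ (h.quarter_le hH h' hw)
    rw [div_le_iff₀ (by positivity)]
    nlinarith
  · push Not at hw
    have h1 := h.sol.re_stab_ge_sq hH h'.sol (h.norm_add_le_of_lt hH hw.1)
      (h'.norm_add_le_of_lt hH hw.2)
    have h2 := Complex.abs_im_le_norm (u - starRingEnd ℂ u')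
    have h3 : a ≤ |(u - starRingEnd ℂ u').im| := by
      have hp := h.sol.im_mul_pos
      have hp' := h'.sol.im_mul_pos
      have e1 := h.im_ge
      simp only [Complex.sub_im, Complex.conj_im, sub_neg_eq_add]
      have hpp : 0 < u.im * u'.im := by
        have : 0 < (w.im * w'.im) * (u.im * u'.im) := by nlinarith [mul_pos hp hp']
        exact (pos_iff_pos_of_mul_pos this).1 hs
      rcases pos_and_pos_or_neg_and_neg_of_mul_pos hpp with ⟨q1, q2⟩ | ⟨q1, q2⟩
      · rw [abs_of_pos q1] at e1
        rw [abs_of_pos (by linarith)]; linarith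
      · rw [abs_of_neg q1] at e1
        rw [abs_of_neg (by linarith)]; linarith
    have h4 := pow_le_pow_left₀ ha.le (h3.trans h2) 2
    have h5 := Complex.re_le_norm (stab H u u')
    rw [div_le_iff₀ (by positivity)]
    nlinarith [norm_nonneg (stab H u u')]

theorem norm_sub_ge (h : IsGood H a K w u) (h' : IsGood H a K w' u')
    (hs : w.im * w'.im < 0) : a + a ≤ ‖u - u'‖ := by
  refine le_trans ?_ (Complex.abs_im_le_norm _)
  have hp := h.sol.im_mul_pos
  have hp' := h'.sol.im_mul_pos
  have e1 := h.im_ge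
  have e2 := h'.im_ge
  rw [Complex.sub_im]
  have hpp : 0 < u.im * -u'.im := by
    have : 0 < (w.im * -w'.im) * (u.im * -u'.im) := by nlinarith [mul_pos hp hp']
    exact (pos_iff_pos_of_mul_pos this).1 (by linarith)
  rcases pos_and_pos_or_neg_and_neg_of_mul_pos hpp with ⟨q1, q2⟩ | ⟨q1, q2⟩
  · rw [abs_of_pos q1] at e1
    rw [abs_of_neg (by linarith)] at e2
    rw [abs_of_pos (by linarith)]; linarith
  · rw [abs_of_neg q1] at e1
    rw [abs_of_pos (by linarith)] at e2
    rw [abs_of_neg (by linarith)]; linarith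

theorem stab_ge_min [Nonempty n] (hH : Hᴴ = H) (ha1 : a ≤ 1) (ha : 0 < a) (h : IsGood H a K w u)
    (h' : IsGood H a K w' u') :
    a ^ 2 / (4 * K ^ 4) * min 1 ‖w - w'‖ ≤ ‖stab H u u'‖ := by
  have hK := h.one_le_K
  have hK4 : 1 ≤ K ^ 4 := one_le_pow₀ hK
  have hKK : K ≤ K ^ 4 := le_self_pow₀ hK (by norm_num)
  have hm0 : 0 ≤ min 1 ‖w - w'‖ := le_min zero_le_one (norm_nonneg _)
  by_cases hw : 1 ≤ |w.im| ∨ 1 ≤ |w'.im|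
  · refine le_trans ?_ (h.quarter_le hH h' hw)
    have h1 : a ^ 2 / (4 * K ^ 4) ≤ 1 / 4 := by
      rw [div_le_iff₀ (by positivity)]
      nlinarith
    calc a ^ 2 / (4 * K ^ 4) * min 1 ‖w - w'‖ ≤ 1 / 4 * 1 := by
          gcongr
          exact min_le_left _ _
      _ = 1 / 4 := by ring
  · push Not at hw
    have h1 := h.norm_add_le_of_lt hH hw.1
    have h2 := h'.norm_add_le_of_lt hH hw.2
    have h3 := congrArg norm (h.sol.stab_mul hH h'.sol)
    rw [norm_mul] at h3
    have h4 : ‖u - u'‖ ≤ 2 * K := by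
      have := norm_sub_le u u'
      linarith [norm_nonneg H]
    have h5 : min 1 ‖w - w'‖ ≤ ‖stab H u u'‖ * (2 * K) := by
      refine (min_le_right _ _).trans ?_
      rw [← h3]
      gcongr
    have h6 : a ^ 2 / (4 * K ^ 4) * (2 * K) ≤ 1 := by
      rw [div_mul_eq_mul_div, div_le_iff₀ (by positivity)]
      have : a ^ 2 ≤ 1 := pow_le_one₀ ha.le ha1
      nlinarith
    calc _ ≤ a ^ 2 / (4 * K ^ 4) * (‖stab H u u'‖ * (2 * K)) := by gcongr
      _ = a ^ 2 / (4 * K ^ 4) * (2 * K) * ‖stab H u u'‖ := by ring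
      _ ≤ 1 * ‖stab H u u'‖ := by gcongr
      _ = _ := one_mul _

theorem stab_le (hH : Hᴴ = H) (h : IsGood H a K w u)
    (h' : IsGood H a K w' u') (hs : w.im * w'.im < 0) :
    (a + a) * ‖stab H u u'‖ ≤ ‖w - w'‖ := by
  rw [← h.sol.stab_mul hH h'.sol, norm_mul, mul_comm]
  gcongr
  exact h.norm_sub_ge h' hs

theorem norm_resv_le (hH : Hᴴ = H) (ha : 0 < a) (h : IsGood H a K w u) :
    ‖resv H u‖ ≤ a⁻¹ :=
  (_root_.norm_resv_le hH h.sol.u_im_ne).trans (by gcongr; exact h.im_ge)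

theorem norm_resv_sub_le [Nonempty n] (hH : Hᴴ = H) (ha : 0 < a) (ha1 : a ≤ 1) (h : IsGood H a K w u)
    (h' : IsGood H a K w' u') (hs : 0 < w.im * w'.im) :
    ‖resv H u - resv H u'‖ ≤ 4 * K ^ 4 / a ^ 4 * ‖w - w'‖ := by
  have hK := h.one_le_K
  have h1 := h.stab_ge hH ha ha1 h' hs
  have h2 := congrArg norm (h.sol.stab_mul hH h'.sol)
  rw [norm_mul] at h2
  rw [← resv_mul_resv hH h.sol.u_im_ne h'.sol.u_im_ne, norm_smul]
  have h3 : ‖resv H u * resv H u'‖ ≤ a⁻¹ * a⁻¹ := by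
    refine (norm_mul_le _ _).trans ?_
    have := h.norm_resv_le hH ha
    have := h'.norm_resv_le hH ha
    gcongr
  have h4 : a ^ 2 / (4 * K ^ 4) * ‖u - u'‖ ≤ ‖w - w'‖ := by
    rw [← h2]; gcongr
  rw [div_mul_eq_mul_div, div_le_iff₀ (by positivity)] at h4
  calc ‖u - u'‖ * ‖resv H u * resv H u'‖ ≤ ‖u - u'‖ * (a⁻¹ * a⁻¹) := by gcongr
    _ = (a ^ 2 * ‖u - u'‖) / a ^ 4 := by field_simp
    _ ≤ (‖w - w'‖ * (4 * K ^ 4)) / a ^ 4 := by gcongr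
    _ = _ := by ring

end IsGood

end Bulk

section Dyson

variable {N : ℕ} {Λ : Matrix (Fin N) (Fin N) ℂ} {M : ℂ → Mat2 N} {a K : ℝ} {w u : ℂ}

theorem IsGood.sgn_mul (h : IsGood (herm Λ) a K w u) {σ : ℝ} (hσ : IsSgn σ) :
    IsGood (herm Λ) a K (σ * w) (σ * u) := by
  refine ⟨h.sol.sgn_mul Λ hσ, ?_, ?_⟩
  · simpa [abs_mul, hσ.abs] using h.im_ge
  · simpa [abs_mul, hσ.abs] using h.re_le

theorem IsMDESolution.ntr_mul_Em (hM : IsMDESolution N Λ M) (hw : w.im ≠ 0) :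
    ntr (M w * Em N) = 0 := by
  have h1 := (hM w hw).1
  set b := ntr (M w * Em N) with hb
  set m := ntr (M w) with hm
  have hS : Sop N (M w) = m • (1 : Mat2 N) - b • Em N := rfl
  rw [hS] at h1
  have h2 : M w * (herm Λ - (w + m) • (1 : Mat2 N) + b • Em N) = 1 := by
    have : herm Λ - (w + m) • (1 : Mat2 N) + b • Em N =
        -(w • (1 : Mat2 N) - herm Λ + (m • (1 : Mat2 N) - b • Em N)) := by
      rw [add_smul]; abel
    rw [this, mul_neg, h1, neg_neg]
  have h3 := mul_eq_one_comm.1 h2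
  have t1 := congrArg (fun T => ntr (T * Em N)) h2
  have t2 := congrArg (fun T => ntr (Em N * T)) h3
  have e1 : ntr (Em N * M w) = b := by rw [ntr_mul_comm]
  have e2 : ntr (M w * (Em N * Em N)) = m := by rw [Em_mul_Em, mul_one]
  simp only [mul_add, mul_sub, add_mul, sub_mul, mul_smul_comm, smul_mul_assoc, mul_one, one_mul,
    ntr_add, ntr_sub, ntr_smul, ntr_Em, mul_assoc] at t1 t2
  rw [e2, ← hb] at t1
  rw [← mul_assoc (Em N) (Em N), Em_mul_Em, one_mul, e1, ← hm] at t2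
  have e3 : ntr (Em N * (herm Λ * M w)) = -ntr (M w * (herm Λ * Em N)) := by
    rw [← mul_assoc, Em_mul_herm, neg_mul, ntr_neg, ntr_mul_comm]
  rw [e3] at t2
  have e4 : w * b = 0 := by linear_combination (-1 / 2 : ℂ) * t1 - (1 / 2 : ℂ) * t2
  rcases mul_eq_zero.1 e4 with h | h
  · exact absurd (by simp [h]) hw
  · exact h

theorem IsMDESolution.eq_resv (hM : IsMDESolution N Λ M) (hw : w.im ≠ 0) :
    M w = resv (herm Λ) (w + ntr (M w)) := by
  have h1 := (hM w hw).1
  have h0 := hM.ntr_mul_Em hw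
  have hS : Sop N (M w) = ntr (M w) • (1 : Mat2 N) := by simp [Sop, h0]
  rw [hS] at h1
  refine (Matrix.inv_eq_left_inv ?_).symm
  have : herm Λ - (w + ntr (M w)) • (1 : Mat2 N) =
      -(w • (1 : Mat2 N) - herm Λ + (ntr (M w) • (1 : Mat2 N))) := by
    rw [add_smul]; abel
  rw [this, mul_neg, h1, neg_neg]

theorem IsMDESolution.isSol (hN : N ≠ 0) (hM : IsMDESolution N Λ M) (hw : w.im ≠ 0) :
    IsSol (herm Λ) w (w + ntr (M w)) := by
  have : Nonempty (Fin N) := ⟨⟨0, Nat.pos_of_ne_zero hN⟩⟩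
  have he := hM.eq_resv hw
  refine ⟨by rw [← he], ?_⟩
  rw [← he]
  have h1 := ((hM w hw).2).trace_pos
  have h2 : (w.im • matIm (M w)).trace =
      ((Fintype.card (Idx N) : ℝ) * ((ntr (M w)).im * w.im) : ℝ) := by
    have hc : (Fintype.card (Idx N) : ℂ) ≠ 0 := by exact_mod_cast Fintype.card_ne_zero
    have ht : (M w).trace = Fintype.card (Idx N) * ntr (M w) := by
      rw [ntr, mul_inv_cancel_left₀ hc]
    rw [matIm, Matrix.trace_smul, Matrix.trace_smul, Matrix.trace_sub,
      Matrix.trace_conjTranspose, ht, star_mul', star_natCast, ← mul_sub]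
    have h3 : ntr (M w) - star (ntr (M w)) = (2 * (ntr (M w)).im : ℝ) * Complex.I :=
      Complex.sub_conj _
    rw [h3, Complex.real_smul, smul_eq_mul]
    push_cast
    field_simp
  rw [h2] at h1
  have h4 : (0 : ℝ) < (Fintype.card (Idx N) : ℝ) * ((ntr (M w)).im * w.im) := by
    exact_mod_cast h1
  exact pos_of_mul_pos_right h4 (Nat.cast_nonneg _)

end Dyson

/-- The sign `s = -sgn (Im w · Im w')` of the potentially unstable direction. -/
def sg (w w' : ℂ) : ℝ := -rsgn (w.im * w'.im)

/-- The distance `|w - s w'|` governing the instability in the direction `E_s`. -/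
def sep (w w' : ℂ) : ℝ := ‖w - sg w w' * w'‖

section Sep

variable {w w' z : ℂ}

theorem sg_eq (w w' : ℂ) : sg w w' = -(rsgn w.im * rsgn w'.im) := by rw [sg, rsgn_mul]

theorem isSgn_sg (hw : w.im ≠ 0) (hw' : w'.im ≠ 0) : IsSgn (sg w w') :=
  (IsSgn.rsgn (mul_ne_zero hw hw')).neg

theorem sg_comm (w w' : ℂ) : sg w w' = sg w' w := by rw [sg, sg, mul_comm]

theorem sg_conj_right (w w' : ℂ) : sg w (starRingEnd ℂ w') = -sg w w' := by
  rw [sg_eq, sg_eq, Complex.conj_im, rsgn_neg]; ring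

theorem sg_mul_sg (hz : z.im ≠ 0) (w w' : ℂ) : sg w z * sg w' z = -sg w w' := by
  have := (IsSgn.rsgn hz).mul_self
  rw [sg_eq, sg_eq, sg_eq]
  linear_combination (rsgn w.im * rsgn w'.im) * this

theorem sep_comm (hw : w.im ≠ 0) (hw' : w'.im ≠ 0) : sep w w' = sep w' w := by
  unfold sep
  rw [sg_comm w' w]
  rcases isSgn_sg hw hw' with h | h <;> rw [h]
  · simp [norm_sub_rev]
  · simp [add_comm]

theorem im_mul_sg (w w' : ℂ) : w.im * (sg w w' * w'.im) = -(|w.im| * |w'.im|) := by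
  have h1 := rsgn_mul_self_eq_abs w.im
  have h2 := rsgn_mul_self_eq_abs w'.im
  rw [sg_eq, ← h1, ← h2]; ring

theorem im_sub_sg (w w' : ℂ) (hw : w.im ≠ 0) :
    w.im - sg w w' * w'.im = rsgn w.im * (|w.im| + |w'.im|) := by
  have h1 := rsgn_mul_self_eq_abs w.im
  have h2 := rsgn_mul_self_eq_abs w'.im
  rw [sg_eq, ← h1, ← h2]
  linear_combination -w.im * (IsSgn.rsgn hw).mul_self

theorem abs_im_add_le_sep (hw : w.im ≠ 0) : |w.im| + |w'.im| ≤ sep w w' := by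
  have h := Complex.abs_im_le_norm (w - sg w w' * w')
  have e : (w - sg w w' * w').im = w.im - sg w w' * w'.im := by simp
  rw [e, im_sub_sg w w' hw, abs_mul, (IsSgn.rsgn hw).abs, one_mul,
    abs_of_nonneg (by positivity)] at h
  exact h

theorem abs_re_le_sep (w w' : ℂ) : |w.re - sg w w' * w'.re| ≤ sep w w' := by
  have h := Complex.abs_re_le_norm (w - sg w w' * w')
  simp only [Complex.sub_re, Complex.re_ofReal_mul] at h
  exact h

theorem sep_pos (hw : w.im ≠ 0) : 0 < sep w w' := by
  have := abs_im_add_le_sep (w' := w') hw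
  have h2 := abs_pos.2 hw
  have := abs_nonneg w'.im
  linarith

theorem norm_sub_conj_le (hw : w.im ≠ 0) :
    ‖w - sg w w' * starRingEnd ℂ w'‖ ≤ 2 * sep w w' := by
  have h1 := Complex.norm_le_abs_re_add_abs_im (w - sg w w' * starRingEnd ℂ w')
  have h2 := abs_re_le_sep w w'
  have h3 := abs_im_add_le_sep (w' := w') hw
  have h4 : |w.im + sg w w' * w'.im| ≤ |w.im| + |w'.im| := by
    refine (abs_add_le _ _).trans ?_
    rw [abs_mul]
    have : |sg w w'| ≤ 1 := by
      unfold sg rsgn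
      split_ifs <;> simp
    nlinarith [abs_nonneg w'.im]
  simp at h1
  linarith

/-- Approximate composition of the reflections `w ↦ s w`. -/
theorem sep_conj_le {x y z : ℂ} (hx : x.im ≠ 0) (hy : y.im ≠ 0) (hz : z.im ≠ 0) :
    sep x (starRingEnd ℂ y) ≤ sep x z + 2 * sep y z := by
  have hs : IsSgn (sg x z) := isSgn_sg hx hz
  have hs2 : IsSgn (sg y z) := isSgn_sg hy hz
  have h1 := norm_sub_conj_le (w := z) (w' := y) hz
  rw [sep_comm hz hy, sg_comm z y] at h1
  have e : sg x (starRingEnd ℂ y) = sg x z * sg y z := by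
    rw [sg_conj_right, sg_mul_sg hz]
  unfold sep at h1 ⊢
  rw [e]
  have : x - ((sg x z * sg y z : ℝ) : ℂ) * starRingEnd ℂ y =
      (x - sg x z * z) + sg x z * (z - sg y z * starRingEnd ℂ y) := by
    push_cast; ring
  rw [this]
  refine (norm_add_le _ _).trans ?_
  rw [norm_mul, hs.norm, one_mul]
  linarith

end Sep

/-- The factor `1 - σ ⟨M(w) E_σ M(w') E_σ⟩` by which the two-body stability operator acts on the
`E_σ` component. -/
def stabFactor {N : ℕ} (M : ℂ → Mat2 N) (σ : ℝ) (w w' : ℂ) : ℂ :=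
  1 - σ * ntr (M w * EOf N σ * M w' * EOf N σ)

/-- Uniform stability properties of `M` on a set `G` of spectral parameters. -/
structure ChainStab {N : ℕ} (M : ℂ → Mat2 N) (G : Set ℂ) (K : ℝ) : Prop where
  one_le : 1 ≤ K
  im_ne : ∀ w ∈ G, w.im ≠ 0
  conj_mem : ∀ w ∈ G, starRingEnd ℂ w ∈ G
  norm_le : ∀ w ∈ G, ‖M w‖ ≤ K
  norm_le_inv : ∀ w ∈ G, ‖M w‖ ≤ |w.im|⁻¹
  decouple : ∀ w ∈ G, ∀ w' ∈ G, ntr (M w * M w' * Em N) = 0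
  triple : ∀ w ∈ G, ∀ w' ∈ G, ∀ w'' ∈ G,
    ntr (M w * EOf N (sg w w') * M w' * EOf N (sg w' w'') * M w'' * EOf N (sg w w'')) = 0
  stable : ∀ w ∈ G, ∀ w' ∈ G, 1 ≤ K * ‖stabFactor M (-sg w w') w w'‖
  unstable : ∀ w ∈ G, ∀ w' ∈ G, min 1 (sep w w') ≤ K * ‖stabFactor M (sg w w') w w'‖
  unstable_le : ∀ w ∈ G, ∀ w' ∈ G, ‖stabFactor M (sg w w') w w'‖ ≤ K * sep w w'
  reflect : ∀ w ∈ G, ∀ w' ∈ G,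
    ‖EOf N (sg w w') * M w' * EOf N (sg w w') - (sg w w' : ℂ) • M (starRingEnd ℂ w)‖
      ≤ K * sep w w'
  mul_conj : ∀ w ∈ G, ∃ k : ℂ, ‖k‖ ≤ K ∧
    M w * M (starRingEnd ℂ w) = k • (M w - M (starRingEnd ℂ w))

theorem chainStab_of_isGood {N : ℕ} (hN : N ≠ 0) {Λ : Matrix (Fin N) (Fin N) ℂ}
    {M : ℂ → Mat2 N} {G : Set ℂ} {a K₀ : ℝ} (ha : 0 < a) (ha1 : a ≤ 1) (hK₀ : 0 < K₀)
    (hG : ∀ w ∈ G, starRingEnd ℂ w ∈ G) {U : ℂ → ℂ}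
    (hM : ∀ w ∈ G, M w = resv (herm Λ) (U w))
    (hU : ∀ w ∈ G, IsGood (herm Λ) a K₀ w (U w)) :
    ChainStab M G (1 + a⁻¹ + 4 * K₀ ^ 4 / a ^ 2 + 8 * K₀ ^ 4 / a ^ 4) := by
  have : Nonempty (Fin N) := ⟨⟨0, Nat.pos_of_ne_zero hN⟩⟩
  have hH := herm_conjTranspose Λ
  set K := 1 + a⁻¹ + 4 * K₀ ^ 4 / a ^ 2 + 8 * K₀ ^ 4 / a ^ 4 with hK
  have p1 : 0 < a⁻¹ := by positivity
  have p2 : 0 < 4 * K₀ ^ 4 / a ^ 2 := by positivity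
  have p3 : 0 < 8 * K₀ ^ 4 / a ^ 4 := by positivity
  have k1 : 1 ≤ K := by linarith
  have k2 : a⁻¹ ≤ K := by linarith
  have k3 : 4 * K₀ ^ 4 / a ^ 2 ≤ K := by linarith
  have k4 : 8 * K₀ ^ 4 / a ^ 4 ≤ K := by linarith
  have im_ne : ∀ w ∈ G, w.im ≠ 0 := fun w hw => (hU w hw).sol.im_ne
  have uim : ∀ w ∈ G, (U w).im ≠ 0 := fun w hw => (hU w hw).sol.u_im_ne
  have suim : ∀ w ∈ G, ∀ σ : ℝ, IsSgn σ → ((σ : ℂ) * U w).im ≠ 0 := fun w hw σ hσ =>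
    ((hU w hw).sgn_mul hσ).sol.u_im_ne
  have fac : ∀ w ∈ G, ∀ w' ∈ G, ∀ σ : ℝ, IsSgn σ →
      stabFactor M σ w w' = stab (herm Λ) (U w) (σ * U w') := by
    intro w hw w' hw' σ hσ
    rw [stabFactor, stab, hM w hw, hM w' hw']
    have h1 := EOf_mul_resv_mul_EOf Λ hσ (uim w' hw')
    rw [mul_assoc (resv _ _), mul_assoc (resv _ _), h1, mul_smul_comm, ntr_smul, ← mul_assoc,
      ← Complex.ofReal_mul, hσ.mul_self, Complex.ofReal_one, one_mul]
  have imneg : ∀ w ∈ G, ∀ w' ∈ G, w.im * ((sg w w' : ℂ) * w').im < 0 := by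
    intro w hw w' hw'
    have h1 := im_mul_sg w w'
    have h2 := abs_pos.2 (im_ne w hw)
    have h3 := abs_pos.2 (im_ne w' hw')
    simp only [Complex.im_ofReal_mul]
    rw [h1]
    nlinarith
  refine ⟨k1, im_ne, hG, ?_, ?_, ?_, ?_, ?_, ?_, ?_, ?_, ?_⟩
  · intro w hw
    rw [hM w hw]
    exact ((hU w hw).norm_resv_le hH ha).trans k2
  · intro w hw
    rw [hM w hw]
    refine (norm_resv_le hH (uim w hw)).trans ?_
    have := abs_pos.2 (im_ne w hw)
    exact inv_anti₀ this (hU w hw).sol.abs_im_le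
  · intro w hw w' hw'
    rw [hM w hw, hM w' hw']
    exact ntr_resv_resv_Em Λ (uim w hw) (uim w' hw')
  · intro w hw w' hw' w'' hw''
    rw [hM w hw, hM w' hw', hM w'' hw'']
    have s1 := isSgn_sg (im_ne w hw) (im_ne w' hw')
    have s2 := isSgn_sg (im_ne w' hw') (im_ne w'' hw'')
    have s3 := isSgn_sg (im_ne w hw) (im_ne w'' hw'')
    have e1 : EOf N (sg w w') * resv (herm Λ) (U w') =
        (sg w w' : ℂ) • (resv (herm Λ) (sg w w' * U w') * EOf N (sg w w')) := by
      rw [← smul_mul_assoc, ← EOf_mul_resv_mul_EOf Λ s1 (uim w' hw'), mul_assoc, mul_assoc,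
        EOf_mul_self N s1, mul_one]
    have e2 : EOf N (sg w w' * sg w' w'') * resv (herm Λ) (U w'') =
        ((sg w w' * sg w' w'' : ℝ) : ℂ) • (resv (herm Λ) ((sg w w' * sg w' w'' : ℝ) * U w'') *
          EOf N (sg w w' * sg w' w'')) := by
      rw [← smul_mul_assoc, ← EOf_mul_resv_mul_EOf Λ (s1.mul s2) (uim w'' hw''), mul_assoc,
        mul_assoc, EOf_mul_self N (s1.mul s2), mul_one]
    have e3 : sg w w' * sg w' w'' * sg w w'' = -1 := by
      have h1 := sg_mul_sg (im_ne w' hw') w w''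
      rw [sg_comm w'' w'] at h1
      have := s3.mul_self
      rw [h1]; linarith
    have e4 : resv (herm Λ) (U w) * EOf N (sg w w') * resv (herm Λ) (U w') *
          EOf N (sg w' w'') * resv (herm Λ) (U w'') * EOf N (sg w w'') =
        ((sg w w' : ℂ) * ((sg w w' * sg w' w'' : ℝ) : ℂ)) • (resv (herm Λ) (U w) *
          resv (herm Λ) (sg w w' * U w') *
          resv (herm Λ) ((sg w w' * sg w' w'' : ℝ) * U w'') * Em N) := by
      rw [mul_assoc (resv _ _) (EOf N _), e1]
      simp only [mul_assoc, mul_smul_comm, smul_mul_assoc]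
      rw [← mul_assoc (EOf N (sg w w')) (EOf N (sg w' w'')), EOf_mul_EOf N s1 s2,
        ← mul_assoc (EOf N (sg w w' * sg w' w'')), e2]
      simp only [mul_assoc, mul_smul_comm, smul_mul_assoc]
      rw [EOf_mul_EOf N (s1.mul s2) s3, e3, EOf_neg_one, smul_smul]
    rw [e4, ntr_smul, ntr_resv_resv_resv_Em Λ (uim w hw) (suim w' hw' _ s1)
      (suim w'' hw'' _ (s1.mul s2)), mul_zero]
  · intro w hw w' hw'
    have hs := isSgn_sg (im_ne w hw) (im_ne w' hw')
    rw [fac w hw w' hw' _ hs.neg]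
    have h1 := (hU w hw).stab_ge hH ha ha1 ((hU w' hw').sgn_mul hs.neg) (by
      have := imneg w hw w' hw'
      simp only [Complex.im_ofReal_mul] at this ⊢
      linarith)
    rw [div_le_iff₀ (by positivity)] at h1
    rw [div_le_iff₀ (by positivity)] at k3
    have ha2 : 0 < a ^ 2 := by positivity
    have h2 : a ^ 2 * 1 ≤ a ^ 2 * (K * ‖stab (herm Λ) (U w) ((-sg w w' : ℝ) * U w')‖) := by
      calc a ^ 2 * 1 ≤ ‖stab (herm Λ) (U w) ((-sg w w' : ℝ) * U w')‖ * (4 * K₀ ^ 4) := by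
            simpa using h1
        _ ≤ ‖stab (herm Λ) (U w) ((-sg w w' : ℝ) * U w')‖ * (K * a ^ 2) := by gcongr
        _ = _ := by ring
    exact le_of_mul_le_mul_left h2 ha2
  · intro w hw w' hw'
    have hs := isSgn_sg (im_ne w hw) (im_ne w' hw')
    rw [fac w hw w' hw' _ hs]
    have h1 := (hU w hw).stab_ge_min hH ha1 ha ((hU w' hw').sgn_mul hs)
    change a ^ 2 / (4 * K₀ ^ 4) * min 1 (sep w w') ≤ _ at h1
    rw [div_mul_eq_mul_div, div_le_iff₀ (by positivity)] at h1
    rw [div_le_iff₀ (by positivity)] at k3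
    have ha2 : 0 < a ^ 2 := by positivity
    refine le_of_mul_le_mul_left (h1.trans ?_) ha2
    calc ‖stab (herm Λ) (U w) (sg w w' * U w')‖ * (4 * K₀ ^ 4)
        ≤ ‖stab (herm Λ) (U w) (sg w w' * U w')‖ * (K * a ^ 2) := by gcongr
      _ = _ := by ring
  · intro w hw w' hw'
    have hs := isSgn_sg (im_ne w hw) (im_ne w' hw')
    rw [fac w hw w' hw' _ hs]
    have h1 := (hU w hw).stab_le hH ((hU w' hw').sgn_mul hs) (imneg w hw w' hw')
    change _ ≤ sep w w' at h1
    have h2 : 0 ≤ sep w w' := norm_nonneg _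
    calc ‖stab (herm Λ) (U w) (sg w w' * U w')‖
        = a⁻¹ * (a * ‖stab (herm Λ) (U w) (sg w w' * U w')‖) := by field_simp
      _ ≤ a⁻¹ * sep w w' := by
        gcongr
        nlinarith [norm_nonneg (stab (herm Λ) (U w) (sg w w' * U w'))]
      _ ≤ K * sep w w' := by gcongr
  · intro w hw w' hw'
    have hs := isSgn_sg (im_ne w hw) (im_ne w' hw')
    have hcw := hG w hw
    rw [hM w' hw', hM _ hcw, EOf_mul_resv_mul_EOf Λ hs (uim w' hw'), ← smul_sub, norm_smul,
      hs.norm, one_mul]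
    have hpos : 0 < ((sg w w' : ℂ) * w').im * (starRingEnd ℂ w).im := by
      have := imneg w hw w' hw'
      rw [Complex.conj_im]; linarith
    have h1 := ((hU w' hw').sgn_mul hs).norm_resv_sub_le hH ha ha1 (hU _ hcw) hpos
    have h2 : ‖(sg w w' : ℂ) * w' - starRingEnd ℂ w‖ ≤ 2 * sep w w' := by
      have h3 := norm_sub_conj_le (w := w') (w' := w) (im_ne w' hw')
      rw [sep_comm (im_ne w' hw') (im_ne w hw), sg_comm w' w] at h3
      have e : (sg w w' : ℂ) * w' - starRingEnd ℂ w =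
          sg w w' * (w' - sg w w' * starRingEnd ℂ w) := by
        have := hs.mul_self
        have h4 : (sg w w' : ℂ) * sg w w' = 1 := by exact_mod_cast this
        linear_combination starRingEnd ℂ w * h4
      rw [e, norm_mul, hs.norm, one_mul]
      exact h3
    calc _ ≤ _ := h1
      _ ≤ 4 * K₀ ^ 4 / a ^ 4 * (2 * sep w w') := by gcongr
      _ = 8 * K₀ ^ 4 / a ^ 4 * sep w w' := by ring
      _ ≤ K * sep w w' := by
        gcongr
        exact norm_nonneg _
  · intro w hw
    have hcw := hG w hw
    have hne : w.im * (starRingEnd ℂ w).im < 0 := by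
      rw [Complex.conj_im]
      nlinarith [mul_self_pos.2 (im_ne w hw)]
    have h1 := (hU w hw).norm_sub_ge (hU _ hcw) hne
    refine ⟨(U w - U (starRingEnd ℂ w))⁻¹, ?_, ?_⟩
    · rw [norm_inv]
      refine le_trans ?_ k2
      gcongr
      linarith
    · have h2 : U w - U (starRingEnd ℂ w) ≠ 0 := fun h => by
        rw [h, norm_zero] at h1
        linarith
      rw [hM w hw, hM _ hcw, ← resv_mul_resv hH (uim w hw) (uim _ hcw), smul_smul,
        inv_mul_cancel₀ h2, one_smul]

/-- The coefficient `⟨X E_σ⟩`. -/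
def cf {N : ℕ} (X : Mat2 N) (σ : ℝ) : ℂ := ntr (X * EOf N σ)

/-- The weight `min(1, |w - s w'|)⁻¹`. -/
def iw (w w' : ℂ) : ℝ := (min 1 (sep w w'))⁻¹

theorem norm_mul_EOf_le {N : ℕ} (X : Mat2 N) (σ : ℝ) : ‖X * EOf N σ‖ ≤ ‖X‖ :=
  (norm_mul_le _ _).trans (mul_le_of_le_one_right (norm_nonneg _) (norm_EOf_le N σ))

theorem norm_cf_le {N : ℕ} (X : Mat2 N) (σ : ℝ) : ‖cf X σ‖ ≤ ‖X‖ :=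
  (norm_ntr_le _).trans (norm_mul_EOf_le X σ)

theorem cf_add {N : ℕ} (X Y : Mat2 N) (σ : ℝ) : cf (X + Y) σ = cf X σ + cf Y σ := by
  rw [cf, add_mul, ntr_add]; rfl

theorem cf_sub {N : ℕ} (X Y : Mat2 N) (σ : ℝ) : cf (X - Y) σ = cf X σ - cf Y σ := by
  rw [cf, sub_mul, ntr_sub]; rfl

theorem cf_smul {N : ℕ} (c : ℂ) (X : Mat2 N) (σ : ℝ) : cf (c • X) σ = c * cf X σ := by
  rw [cf, smul_mul_assoc, ntr_smul]; rfl

theorem sop_eq {N : ℕ} {s : ℝ} (hs : IsSgn s) (X : Mat2 N) :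
    Sop N X = (s * cf X s) • EOf N s - (s * cf X (-s)) • EOf N (-s) := by
  rcases hs with rfl | rfl
  · simp [Sop, cf, EOf_one, EOf_neg_one]
  · simp [Sop, cf, EOf_one, EOf_neg_one]
    abel

theorem norm_sop_le {N : ℕ} {s : ℝ} (hs : IsSgn s) (X : Mat2 N) :
    ‖Sop N X‖ ≤ ‖cf X s‖ + ‖cf X (-s)‖ := by
  rw [sop_eq hs]
  refine (norm_sub_le _ _).trans (add_le_add ?_ ?_)
  all_goals
    rw [norm_smul, norm_mul, hs.norm, one_mul]
    exact mul_le_of_le_one_right (norm_nonneg _) (norm_EOf_le N _)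

theorem norm_sop_le_two {N : ℕ} (X : Mat2 N) : ‖Sop N X‖ ≤ 2 * ‖X‖ := by
  refine (norm_sop_le (Or.inl rfl) X).trans ?_
  have h1 := norm_cf_le X 1
  have h2 := norm_cf_le X (-1)
  linarith

section Weight

variable {w w' : ℂ}

theorem iw_pos (hw : w.im ≠ 0) : 0 < iw w w' :=
  inv_pos.2 (lt_min one_pos (sep_pos hw))

theorem one_le_iw (hw : w.im ≠ 0) : 1 ≤ iw w w' :=
  (one_le_inv₀ (lt_min one_pos (sep_pos hw))).2 (min_le_left _ _)

theorem iw_comm (hw : w.im ≠ 0) (hw' : w'.im ≠ 0) : iw w w' = iw w' w := by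
  rw [iw, sep_comm hw hw', iw]

theorem iw_le {η : ℝ} (h0 : 0 < η) (h1 : η ≤ 1) (hw : η ≤ |w.im|) : iw w w' ≤ η⁻¹ := by
  have hne : w.im ≠ 0 := abs_pos.1 (h0.trans_le hw)
  refine inv_anti₀ h0 (le_min h1 ?_)
  have := abs_im_add_le_sep (w' := w') hne
  have := abs_nonneg w'.im
  linarith

theorem iw_mul_sep (hw : w.im ≠ 0) (h : sep w w' ≤ 1) : iw w w' * sep w w' = 1 := by
  rw [iw, min_eq_right h, inv_mul_cancel₀ (sep_pos hw).ne']

end Weight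

/-- Orthogonality relations satisfied by a `(w,w')`-regular observable. -/
structure Reg {N : ℕ} (M : ℂ → Mat2 N) (d : ℝ) (w w' : ℂ) (A : Mat2 N) : Prop where
  direct : sep w w' ≤ d → cf (M w * A * M w') (sg w w') = 0
  conj : sep w (starRingEnd ℂ w') ≤ d →
    cf (M w * A * M (starRingEnd ℂ w')) (sg w (starRingEnd ℂ w')) = 0

/-- Stability together with the thresholds used for the chain bounds. -/
structure ChainCtx {N : ℕ} (M : ℂ → Mat2 N) (G : Set ℂ) (B d : ℝ) : Prop
    extends ChainStab M G B where
  two_le : 2 ≤ B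
  d_le : d ≤ 1
  le_mul_d : 3 ≤ B * d

namespace ChainStab

variable {N : ℕ} {M : ℂ → Mat2 N} {G : Set ℂ} {K : ℝ} (h : ChainStab M G K)
include h

theorem decouple_EOf {w w' : ℂ} (hw : w ∈ G) (hw' : w' ∈ G) {σ : ℝ} (hσ : IsSgn σ) :
    cf (M w * EOf N (-σ) * M w') σ = 0 := by
  rcases hσ with rfl | rfl
  · rw [cf, EOf_one, EOf_neg_one, mul_one, ntr_mul_comm, ← mul_assoc, h.decouple w' hw' w hw]
  · rw [cf, neg_neg, EOf_one, EOf_neg_one, mul_one, h.decouple w hw w' hw']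

theorem cf_mul_stabFactor {w w' : ℂ} (hw : w ∈ G) (hw' : w' ∈ G) {X Y : Mat2 N}
    (hX : X - M w * Sop N X * M w' = Y) {σ : ℝ} (hσ : IsSgn σ) :
    cf X σ * stabFactor M σ w w' = cf Y σ := by
  rw [← hX, sop_eq hσ, cf_sub, mul_sub, sub_mul, cf_sub]
  simp only [mul_smul_comm, smul_mul_assoc, cf_smul]
  rw [h.decouple_EOf hw hw' hσ, stabFactor]
  change _ = _ - (_ * ntr (M w * EOf N σ * M w' * EOf N σ) - _)
  ring

theorem norm_cf_stable_le {w w' : ℂ} (hw : w ∈ G) (hw' : w' ∈ G) {X Y : Mat2 N}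
    (hX : X - M w * Sop N X * M w' = Y) : ‖cf X (-sg w w')‖ ≤ K * ‖Y‖ := by
  have hs := isSgn_sg (h.im_ne w hw) (h.im_ne w' hw')
  have h1 := h.cf_mul_stabFactor hw hw' hX hs.neg
  have h2 := h.stable w hw w' hw'
  have hK := h.one_le
  calc ‖cf X (-sg w w')‖ = ‖cf X (-sg w w')‖ * 1 := (mul_one _).symm
    _ ≤ ‖cf X (-sg w w')‖ * (K * ‖stabFactor M (-sg w w') w w'‖) := by gcongr
    _ = K * ‖cf Y (-sg w w')‖ := by rw [← h1, norm_mul]; ring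
    _ ≤ K * ‖Y‖ := by gcongr; exact norm_cf_le _ _

theorem norm_cf_unstable_le {w w' : ℂ} (hw : w ∈ G) (hw' : w' ∈ G) {X Y : Mat2 N}
    (hX : X - M w * Sop N X * M w' = Y) :
    ‖cf X (sg w w')‖ ≤ K * iw w w' * ‖cf Y (sg w w')‖ := by
  have hs := isSgn_sg (h.im_ne w hw) (h.im_ne w' hw')
  have h1 := h.cf_mul_stabFactor hw hw' hX hs
  have h2 := h.unstable w hw w' hw'
  have hK := h.one_le
  have hp : 0 < min 1 (sep w w') := lt_min one_pos (sep_pos (h.im_ne w hw))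
  have hi := iw_pos (w' := w') (h.im_ne w hw)
  calc ‖cf X (sg w w')‖ = iw w w' * (‖cf X (sg w w')‖ * min 1 (sep w w')) := by
        rw [iw]; field_simp
    _ ≤ iw w w' * (‖cf X (sg w w')‖ * (K * ‖stabFactor M (sg w w') w w'‖)) := by gcongr
    _ = K * iw w w' * ‖cf Y (sg w w')‖ := by rw [← h1, norm_mul]; ring

end ChainStab

namespace ChainCtx

variable {N : ℕ} {M : ℂ → Mat2 N} {G : Set ℂ} {B d : ℝ} (h : ChainCtx M G B d)
include h

theorem pos : 0 < B := by linarith [h.two_le]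

theorem two_mul_le {n m : ℕ} (hnm : n + 1 ≤ m) {x : ℝ} (hx : 0 ≤ x) :
    B ^ n * x + B ^ n * x ≤ B ^ m * x := by
  have h2 := h.two_le
  have h3 : B ^ (n + 1) ≤ B ^ m := pow_le_pow_right₀ (by linarith) hnm
  have h4 : 2 * B ^ n ≤ B ^ (n + 1) := by
    rw [pow_succ, mul_comm]
    have := h.pos
    gcongr
  nlinarith

theorem pow_mono {n m : ℕ} (hnm : n ≤ m) : B ^ n ≤ B ^ m :=
  pow_le_pow_right₀ h.one_le hnm

theorem add_le {x y z : ℝ} {n k m : ℕ} (hx : x ≤ B ^ n * z) (hy : y ≤ B ^ k * z)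
    (hnm : n + 1 ≤ m) (hkm : k + 1 ≤ m) (hz : 0 ≤ z) : x + y ≤ B ^ m * z := by
  have h1 := h.two_mul_le (n := max n k) (m := m) (by omega) hz
  have h2 : B ^ n * z ≤ B ^ (max n k) * z := by
    have := h.pow_mono (le_max_left n k); gcongr
  have h3 : B ^ k * z ≤ B ^ (max n k) * z := by
    have := h.pow_mono (le_max_right n k); gcongr
  linarith

theorem iw_le_of_le {w w' : ℂ} (hs : d / 3 ≤ sep w w') : iw w w' ≤ B := by
  have h1 := h.le_mul_d
  have h2 := h.two_le
  have h3 : B⁻¹ ≤ min 1 (sep w w') := by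
    refine le_min (inv_le_one_of_one_le₀ h.one_le) (le_trans ?_ hs)
    rw [inv_le_iff_one_le_mul₀ h.pos]
    linarith
  rw [iw]
  exact inv_le_of_inv_le₀ h.pos h3

theorem norm_cf_pair_le {w w' : ℂ} (hw : w ∈ G) (hw' : w' ∈ G) {A X : Mat2 N} (hA : ‖A‖ ≤ B)
    (hreg : Reg M d w w' A) (hX : X - M w * Sop N X * M w' = M w * A * M w') :
    ‖cf X (sg w w')‖ ≤ B ^ 5 ∧ ‖cf X (-sg w w')‖ ≤ B ^ 5 := by
  have hB := h.pos
  have hY : ‖M w * A * M w'‖ ≤ B ^ 3 := by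
    calc _ ≤ B * B * B := norm_mul_le_of_le (norm_mul_le_of_le (h.norm_le w hw) hA)
          (h.norm_le w' hw')
      _ = B ^ 3 := by ring
  constructor
  · refine (h.norm_cf_unstable_le hw hw' hX).trans ?_
    rcases le_total (sep w w') d with hs | hs
    · rw [hreg.direct hs, norm_zero, mul_zero]
      positivity
    · have hd : d / 3 ≤ sep w w' := by
        have := h.le_mul_d
        have : 0 < d := by nlinarith
        linarith
      have h1 := h.iw_le_of_le hd
      have h2 := (norm_cf_le (M w * A * M w') (sg w w')).trans hY
      calc _ ≤ B * B * B ^ 3 := by gcongr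
        _ = B ^ 5 := by ring
  · refine (h.norm_cf_stable_le hw hw' hX).trans ?_
    calc B * ‖M w * A * M w'‖ ≤ B * B ^ 3 := by gcongr
      _ = B ^ 4 := by ring
      _ ≤ B ^ 5 := h.pow_mono (by norm_num)

end ChainCtx

/-- `Â` is the dressed version of the `(a,b)`-regular observable `A`, so that the deterministic
approximation of the two-resolvent chain is `M(a) Â M(b)`. -/
structure Dressed {N : ℕ} (M : ℂ → Mat2 N) (B d : ℝ) (a b : ℂ) (Ah : Mat2 N) : Prop where
  norm_le : ‖Ah‖ ≤ B ^ 7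
  cf_le : ∀ σ : ℝ, IsSgn σ → ‖cf (M a * Ah * M b) σ‖ ≤ B ^ 5
  reg : Reg M d a b (Ah - Sop N (M a * Ah * M b))

/-- Bounds on the coefficients of a three-resolvent chain. -/
structure TripleBd {N : ℕ} (B : ℝ) (a b : ℂ) (X : Mat2 N) : Prop where
  unstable : ‖cf X (sg a b)‖ ≤ B ^ 18 * iw a b
  stable : ‖cf X (-sg a b)‖ ≤ B ^ 18

namespace ChainCtx

variable {N : ℕ} {M : ℂ → Mat2 N} {G : Set ℂ} {B d : ℝ} (h : ChainCtx M G B d)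
include h

theorem norm_chain_le {w w' : ℂ} (hw : w ∈ G) (hw' : w' ∈ G) {X Y : Mat2 N}
    (hX : X - M w * Sop N X * M w' = Y) : ‖X‖ ≤ ‖Y‖ + B ^ 2 * ‖Sop N X‖ := by
  rw [sub_eq_iff_eq_add] at hX
  have h1 : ‖M w * Sop N X * M w'‖ ≤ B * ‖Sop N X‖ * B :=
    norm_mul_le_of_le (norm_mul_le_of_le (h.norm_le w hw) le_rfl) (h.norm_le w' hw')
  calc ‖X‖ = ‖Y + M w * Sop N X * M w'‖ := by rw [← hX]
    _ ≤ ‖Y‖ + B * ‖Sop N X‖ * B := norm_add_le_of_le le_rfl h1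
    _ = _ := by ring

theorem dressed {w w' : ℂ} (hw : w ∈ G) (hw' : w' ∈ G) {A X : Mat2 N} (hA : ‖A‖ ≤ B)
    (hreg : Reg M d w w' A) (hX : X - M w * Sop N X * M w' = M w * A * M w') :
    Dressed M B d w w' (A + Sop N X) ∧ X = M w * (A + Sop N X) * M w' := by
  have e : X = M w * (A + Sop N X) * M w' := by
    rw [sub_eq_iff_eq_add] at hX
    rw [mul_add, add_mul, ← hX]
  have hs := isSgn_sg (h.im_ne w hw) (h.im_ne w' hw')
  have hc := h.norm_cf_pair_le hw hw' hA hreg hX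
  refine ⟨⟨?_, ?_, ?_⟩, e⟩
  · have h1 : ‖Sop N X‖ ≤ B ^ 6 * 1 := (norm_sop_le hs X).trans
      (h.add_le (n := 5) (k := 5) (by linarith [hc.1]) (by linarith [hc.2]) le_rfl le_rfl
        zero_le_one)
    have := h.add_le (n := 6) (k := 6) (m := 7) (x := ‖A‖) (z := 1)
      (by linarith [h.pow_mono (n := 1) (m := 6) (by norm_num), pow_one B]) h1 le_rfl le_rfl
      zero_le_one
    exact (norm_add_le _ _).trans (by linarith)
  · intro σ hσ
    rw [← e]
    rcases hs with h1 | h1 <;> rcases hσ with rfl | rfl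
    · simpa [h1] using hc.1
    · simpa [h1] using hc.2
    · simpa [h1] using hc.2
    · simpa [h1] using hc.1
  · rw [← e, add_sub_cancel_right]
    exact hreg

theorem norm_dressed_le {a b : ℂ} (ha : a ∈ G) (hb : b ∈ G) {Ah : Mat2 N}
    (P : Dressed M B d a b Ah) : ‖M a * Ah * M b‖ ≤ B ^ 9 :=
  (norm_mul_le_of_le (norm_mul_le_of_le (h.norm_le a ha) P.norm_le)
    (h.norm_le b hb)).trans_eq (by ring)

theorem norm_tri_le {a b c : ℂ} (ha : a ∈ G) (hb : b ∈ G) (hc : c ∈ G) {Ah : Mat2 N}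
    (P : Dressed M B d a b Ah) (hac : sep a c ≤ d / 3) (hbc : sep b c ≤ d / 3) :
    ‖ntr (M a * Ah * M b * EOf N (sg b c) * M c * EOf N (sg a c))‖
      ≤ B ^ 11 * (sep a c + sep b c) := by
  have hB := h.pos
  have na := h.im_ne a ha
  have nb := h.im_ne b hb
  have nc := h.im_ne c hc
  have s1 := isSgn_sg nb nc
  have s2 := isSgn_sg na nc
  have hcb := h.conj_mem b hb
  have ncb := h.im_ne _ hcb
  set X := M a * Ah * M b with hX
  set b' := starRingEnd ℂ b with hb'
  set σ := sg a b' with hσ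
  have hσs : IsSgn σ := isSgn_sg na ncb
  have eσ : sg b c * sg a c = σ := by
    rw [hσ, hb', sg_conj_right, sg_mul_sg nc, sg_comm b a]
  have hR := h.reflect b hb c hc
  set R := EOf N (sg b c) * M c * EOf N (sg b c) - (sg b c : ℂ) • M b' with hRdef
  have hsep1 : 0 ≤ sep a c := norm_nonneg _
  have hsep2 : 0 ≤ sep b c := norm_nonneg _
  have hsep : sep a b' ≤ sep a c + 2 * sep b c := sep_conj_le na nb nc
  have e1 : EOf N (sg b c) * M c * EOf N (sg a c) = ((sg b c : ℂ) • M b' + R) * EOf N σ := by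
    rw [hRdef, add_sub_cancel, ← eσ, ← EOf_mul_EOf N s1 s2, ← mul_assoc,
      mul_assoc (_ * M c) (EOf N (sg b c)), EOf_mul_self N s1, mul_one]
  obtain ⟨k, hk, hkeq⟩ := h.mul_conj b hb
  have e2 : X * M b' = k • (X - M a * Ah * M b') := by
    rw [hX, mul_assoc (M a * Ah), hkeq, mul_smul_comm, mul_sub]
  have e3 : cf (M a * Ah * M b') σ = cf X σ * (1 - stabFactor M σ a b') := by
    have h1 := P.reg.conj (by linarith)
    have h2 : M a * Ah * M b' = M a * (Ah - Sop N X) * M b' + M a * Sop N X * M b' := by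
      rw [mul_sub, sub_mul]; abel
    rw [h2, cf_add, h1, sop_eq hσs, mul_sub, sub_mul, cf_sub]
    simp only [mul_smul_comm, smul_mul_assoc, cf_smul]
    rw [h.decouple_EOf ha hcb hσs, stabFactor]
    change _ + (_ * ntr (M a * EOf N σ * M b' * EOf N σ) - _) = _
    ring
  have e4 : ntr (X * EOf N (sg b c) * M c * EOf N (sg a c)) =
      sg b c * (k * (cf X σ * stabFactor M σ a b')) + ntr (X * R * EOf N σ) := by
    have : X * EOf N (sg b c) * M c * EOf N (sg a c) =
        X * (EOf N (sg b c) * M c * EOf N (sg a c)) := by simp only [mul_assoc]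
    rw [this, e1, add_mul, mul_add, ntr_add, smul_mul_assoc, mul_smul_comm, ntr_smul,
      ← mul_assoc X, e2, ← mul_assoc X R]
    congr 2
    change cf _ _ = _
    rw [cf_smul, cf_sub, e3]
    ring
  have f1 : ‖(sg b c : ℂ) * (k * (cf X σ * stabFactor M σ a b'))‖ ≤
      B ^ 8 * (sep a c + sep b c) := by
    rw [norm_mul, s1.norm, one_mul]
    calc _ ≤ B * (B ^ 5 * (B * sep a b')) := norm_mul_le_of_le hk
          (norm_mul_le_of_le (P.cf_le σ hσs) (h.unstable_le a ha b' hcb))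
      _ = B ^ 7 * sep a b' := by ring
      _ ≤ B ^ 7 * (2 * (sep a c + sep b c)) := by gcongr; linarith
      _ = B ^ 7 * (sep a c + sep b c) + B ^ 7 * (sep a c + sep b c) := by ring
      _ ≤ _ := h.two_mul_le le_rfl (by positivity)
  have f2 : ‖ntr (X * R * EOf N σ)‖ ≤ B ^ 10 * (sep a c + sep b c) := by
    calc _ ≤ ‖X * R‖ := norm_cf_le _ _
      _ ≤ B ^ 9 * (B * sep b c) := norm_mul_le_of_le (h.norm_dressed_le ha hb P) hR
      _ = B ^ 10 * sep b c := by ring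
      _ ≤ _ := by gcongr; linarith
  rw [e4]
  exact (norm_add_le _ _).trans (h.add_le f1 f2 (by norm_num) (by norm_num) (by positivity))

theorem iw_mul_norm_tri_le {a b c : ℂ} (ha : a ∈ G) (hb : b ∈ G) (hc : c ∈ G) {Ah : Mat2 N}
    (P : Dressed M B d a b Ah) {L : ℝ} (hac : iw a c ≤ L) (hbc : iw b c ≤ L) :
    iw a c * (iw b c * ‖ntr (M a * Ah * M b * EOf N (sg b c) * M c * EOf N (sg a c))‖)
      ≤ B ^ 12 * L := by
  have hB := h.pos
  have na := h.im_ne a ha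
  have nb := h.im_ne b hb
  have i1 := iw_pos (w' := c) na
  have i2 := iw_pos (w' := c) nb
  have hL : 0 < L := i1.trans_le hac
  have hd := h.d_le
  have big : ‖ntr (M a * Ah * M b * EOf N (sg b c) * M c * EOf N (sg a c))‖ ≤ B ^ 10 := by
    calc _ ≤ ‖M a * Ah * M b * EOf N (sg b c) * M c‖ := norm_cf_le _ _
      _ ≤ B ^ 9 * B := norm_mul_le_of_le ((norm_mul_EOf_le _ _).trans
          (h.norm_dressed_le ha hb P)) (h.norm_le c hc)
      _ = B ^ 10 := by ring
  rcases le_total (d / 3) (sep a c) with h1 | h1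
  · calc _ ≤ B * (L * B ^ 10) := by
          have := h.iw_le_of_le h1
          gcongr
      _ = B ^ 11 * L := by ring
      _ ≤ B ^ 12 * L := by
        have := h.pow_mono (n := 11) (m := 12) (by norm_num)
        gcongr
  rcases le_total (d / 3) (sep b c) with h2 | h2
  · calc _ ≤ L * (B * B ^ 10) := by
          have := h.iw_le_of_le h2
          gcongr
      _ = B ^ 11 * L := by ring
      _ ≤ B ^ 12 * L := by
        have := h.pow_mono (n := 11) (m := 12) (by norm_num)
        gcongr
  have hd0 : 0 < d := by nlinarith [h.le_mul_d]
  have t1 := iw_mul_sep na (show sep a c ≤ 1 by linarith)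
  have t2 := iw_mul_sep nb (show sep b c ≤ 1 by linarith)
  calc _ ≤ iw a c * (iw b c * (B ^ 11 * (sep a c + sep b c))) := by
        have := h.norm_tri_le ha hb hc P h1 h2
        gcongr
    _ = B ^ 11 * (iw b c * (iw a c * sep a c) + iw a c * (iw b c * sep b c)) := by ring
    _ = B ^ 11 * iw b c + B ^ 11 * iw a c := by rw [t1, t2]; ring
    _ ≤ B ^ 11 * L + B ^ 11 * L := by gcongr
    _ ≤ _ := h.two_mul_le le_rfl hL.le

theorem norm_sop_triple_le {a b : ℂ} (ha : a ∈ G) (hb : b ∈ G) {X : Mat2 N}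
    (T : TripleBd B a b X) : ‖Sop N X‖ ≤ B ^ 19 * iw a b := by
  have hB := h.pos
  have h1 := one_le_iw (w' := b) (h.im_ne a ha)
  refine (norm_sop_le (isSgn_sg (h.im_ne a ha) (h.im_ne b hb)) X).trans
    (h.add_le T.unstable (T.stable.trans ?_) le_rfl le_rfl (by linarith))
  exact le_mul_of_one_le_right (by positivity) h1

theorem tripleBd {w₁ w₂ w₃ : ℂ} (hw₁ : w₁ ∈ G) (hw₂ : w₂ ∈ G) (hw₃ : w₃ ∈ G)
    {A₁ A₂ X : Mat2 N} (P₁ : Dressed M B d w₁ w₂ A₁) (P₂ : Dressed M B d w₂ w₃ A₂)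
    (hX : X - M w₁ * Sop N X * M w₃ = M w₁ * A₁ * M w₂ * A₂ * M w₃) :
    TripleBd B w₁ w₃ X := by
  have hB := h.pos
  have hY : ‖M w₁ * A₁ * M w₂ * A₂ * M w₃‖ ≤ B ^ 17 :=
    (norm_mul_le_of_le (norm_mul_le_of_le (h.norm_dressed_le hw₁ hw₂ P₁) P₂.norm_le)
      (h.norm_le w₃ hw₃)).trans_eq (by ring)
  have i1 := iw_pos (w' := w₃) (h.im_ne w₁ hw₁)
  constructor
  · refine (h.norm_cf_unstable_le hw₁ hw₃ hX).trans ?_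
    calc _ ≤ B * iw w₁ w₃ * B ^ 17 := by
          gcongr
          exact (norm_cf_le _ _).trans hY
      _ = _ := by ring
  · refine (h.norm_cf_stable_le hw₁ hw₃ hX).trans ?_
    calc _ ≤ B * B ^ 17 := by gcongr
      _ = _ := by ring

theorem norm_triple_le {w₁ w₂ w₃ : ℂ} (hw₁ : w₁ ∈ G) (hw₂ : w₂ ∈ G) (hw₃ : w₃ ∈ G)
    {A₁ A₂ X : Mat2 N} (P₁ : Dressed M B d w₁ w₂ A₁) (P₂ : Dressed M B d w₂ w₃ A₂)
    (hX : X - M w₁ * Sop N X * M w₃ = M w₁ * A₁ * M w₂ * A₂ * M w₃) :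
    ‖X‖ ≤ B ^ 22 * iw w₁ w₃ := by
  have hB := h.pos
  have hY : ‖M w₁ * A₁ * M w₂ * A₂ * M w₃‖ ≤ B ^ 17 :=
    (norm_mul_le_of_le (norm_mul_le_of_le (h.norm_dressed_le hw₁ hw₂ P₁) P₂.norm_le)
      (h.norm_le w₃ hw₃)).trans_eq (by ring)
  have i1 := one_le_iw (w' := w₃) (h.im_ne w₁ hw₁)
  have T := h.norm_sop_triple_le hw₁ hw₃ (h.tripleBd hw₁ hw₂ hw₃ P₁ P₂ hX)
  refine (h.norm_chain_le hw₁ hw₃ hX).trans (h.add_le (n := 17) (k := 21) ?_ ?_ (by norm_num)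
    (by norm_num) (by linarith))
  · exact hY.trans (le_mul_of_one_le_right (by positivity) i1)
  · calc _ ≤ B ^ 2 * (B ^ 19 * iw w₁ w₃) := by gcongr
      _ = _ := by ring

/-- A three-resolvent chain traced against a regular observable is bounded. -/
theorem norm_ntr_triple_mul_le {w₁ w₂ w₃ : ℂ} (hw₁ : w₁ ∈ G) (hw₂ : w₂ ∈ G) (hw₃ : w₃ ∈ G)
    {A₁ A₂ A₃ X : Mat2 N} (P₁ : Dressed M B d w₁ w₂ A₁) (P₂ : Dressed M B d w₂ w₃ A₂)
    (hA₃ : ‖A₃‖ ≤ B) (hreg : Reg M d w₃ w₁ A₃)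
    (hX : X - M w₁ * Sop N X * M w₃ = M w₁ * A₁ * M w₂ * A₂ * M w₃) :
    ‖ntr (X * A₃)‖ ≤ B ^ 24 := by
  have hB := h.pos
  have n1 := h.im_ne w₁ hw₁
  have n3 := h.im_ne w₃ hw₃
  have hs := isSgn_sg n1 n3
  have hY : ‖M w₁ * A₁ * M w₂ * A₂ * M w₃‖ ≤ B ^ 17 :=
    (norm_mul_le_of_le (norm_mul_le_of_le (h.norm_dressed_le hw₁ hw₂ P₁) P₂.norm_le)
      (h.norm_le w₃ hw₃)).trans_eq (by ring)
  have T := h.tripleBd hw₁ hw₂ hw₃ P₁ P₂ hX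
  have hE : ∀ σ : ℝ, ‖ntr (M w₁ * EOf N σ * M w₃ * A₃)‖ ≤ B ^ 3 := fun σ => by
    calc _ ≤ _ := norm_ntr_le _
      _ ≤ B * B * B := norm_mul_le_of_le (norm_mul_le_of_le ((norm_mul_EOf_le _ _).trans
          (h.norm_le w₁ hw₁)) (h.norm_le w₃ hw₃)) hA₃
      _ = _ := by ring
  have e : ntr (X * A₃) = ntr (M w₁ * A₁ * M w₂ * A₂ * M w₃ * A₃) +
      (sg w₁ w₃ * (cf X (sg w₁ w₃) * ntr (M w₁ * EOf N (sg w₁ w₃) * M w₃ * A₃)) -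
        sg w₁ w₃ * (cf X (-sg w₁ w₃) * ntr (M w₁ * EOf N (-sg w₁ w₃) * M w₃ * A₃))) := by
    have h1 : M w₁ * Sop N X * M w₃ * A₃ =
        (sg w₁ w₃ * cf X (sg w₁ w₃)) • (M w₁ * EOf N (sg w₁ w₃) * M w₃ * A₃) -
        (sg w₁ w₃ * cf X (-sg w₁ w₃)) • (M w₁ * EOf N (-sg w₁ w₃) * M w₃ * A₃) := by
      rw [sop_eq hs X]
      simp only [mul_sub, sub_mul, mul_smul_comm, smul_mul_assoc]
    have h2 := congrArg (fun Z => ntr (Z * A₃)) (sub_eq_iff_eq_add.1 hX)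
    simp only [add_mul, ntr_add, h1, ntr_sub, ntr_smul] at h2
    rw [h2]
    ring
  have f1 : ‖ntr (M w₁ * A₁ * M w₂ * A₂ * M w₃ * A₃)‖ ≤ B ^ 18 * 1 := by
    calc _ ≤ _ := norm_ntr_le _
      _ ≤ B ^ 17 * B := norm_mul_le_of_le hY hA₃
      _ = _ := by ring
  have f2 : ‖(sg w₁ w₃ : ℂ) *
      (cf X (sg w₁ w₃) * ntr (M w₁ * EOf N (sg w₁ w₃) * M w₃ * A₃))‖ ≤ B ^ 22 * 1 := by
    rw [norm_mul, hs.norm, one_mul, mul_one]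
    rcases le_total (sep w₁ w₃) d with h1 | h1
    · have h2 := hreg.direct (by rwa [sep_comm n3 n1])
      have h3 : ntr (M w₁ * EOf N (sg w₁ w₃) * M w₃ * A₃) = 0 := by
        rw [← h2, cf, sg_comm w₃ w₁, mul_assoc (_ * _), ntr_mul_comm, ← mul_assoc]
      rw [h3, mul_zero, norm_zero]
      positivity
    · have hd0 : 0 < d := by nlinarith [h.le_mul_d]
      have h2 := h.iw_le_of_le (show d / 3 ≤ sep w₁ w₃ by linarith)
      calc _ ≤ B ^ 18 * B * B ^ 3 := norm_mul_le_of_le (T.unstable.trans (by gcongr)) (hE _)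
        _ = _ := by ring
  have f3 : ‖(sg w₁ w₃ : ℂ) *
      (cf X (-sg w₁ w₃) * ntr (M w₁ * EOf N (-sg w₁ w₃) * M w₃ * A₃))‖ ≤ B ^ 21 * 1 := by
    rw [norm_mul, hs.norm, one_mul, mul_one]
    exact (norm_mul_le_of_le T.stable (hE _)).trans_eq (by ring)
  rw [e]
  have f4 := (norm_sub_le _ _).trans
    (h.add_le (m := 23) f2 f3 (by norm_num) (by norm_num) zero_le_one)
  have f5 := (norm_add_le _ _).trans
    (h.add_le (m := 24) f1 f4 (by norm_num) (by norm_num) zero_le_one)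
  linarith

end ChainCtx

namespace ChainCtx

variable {N : ℕ} {M : ℂ → Mat2 N} {G : Set ℂ} {B d : ℝ} (h : ChainCtx M G B d)
include h

theorem add_le_add_three {x y z u : ℝ} {n m : ℕ} (hx : x ≤ B ^ n * u) (hy : y ≤ B ^ n * u)
    (hz : z ≤ B ^ n * u) (hnm : n + 2 ≤ m) (hu : 0 ≤ u) : x + y + z ≤ B ^ m * u := by
  have hB := h.pos
  have h1 := h.add_le hx hy le_rfl le_rfl hu
  refine h.add_le h1 hz hnm (by omega) hu

theorem norm_ntr_cross_le {w : ℂ} (hw : w ∈ G) {a b : ℂ} (ha : a ∈ G) (hb : b ∈ G)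
    {Ah : Mat2 N} (P : Dressed M B d a b Ah) (σ τ : ℝ) :
    ‖ntr (M a * Ah * M b * EOf N σ * M w * EOf N τ)‖ ≤ B ^ 10 := by
  calc _ ≤ ‖M a * Ah * M b * EOf N σ * M w‖ := norm_cf_le _ _
    _ ≤ B ^ 9 * B := norm_mul_le_of_le ((norm_mul_EOf_le _ _).trans
        (h.norm_dressed_le ha hb P)) (h.norm_le w hw)
    _ = _ := by ring

theorem iw_mul_norm_add_le {x y : ℂ} {s t i L : ℝ} {c c' : ℂ} (hs : IsSgn s) (hi : 0 < i)
    (hL : i ≤ L) (hc : ‖c‖ ≤ B ^ 18 * t) (hc' : ‖c'‖ ≤ B ^ 18)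
    (hx : i * (t * ‖x‖) ≤ B ^ 12 * L) (hy : ‖y‖ ≤ B ^ 10) :
    i * ‖(s : ℂ) * (c * x) - s * (c' * y)‖ ≤ B ^ 31 * L := by
  have hB := h.pos
  have e1 : i * ‖(s : ℂ) * (c * x)‖ ≤ B ^ 30 * L := by
    rw [norm_mul, hs.norm, one_mul, norm_mul]
    calc i * (‖c‖ * ‖x‖) ≤ i * (B ^ 18 * t * ‖x‖) := by gcongr
      _ = B ^ 18 * (i * (t * ‖x‖)) := by ring
      _ ≤ B ^ 18 * (B ^ 12 * L) := by gcongr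
      _ = _ := by ring
  have e2 : i * ‖(s : ℂ) * (c' * y)‖ ≤ B ^ 28 * L := by
    rw [norm_mul, hs.norm, one_mul]
    calc i * ‖c' * y‖ ≤ L * (B ^ 18 * B ^ 10) := by
          have := norm_mul_le_of_le hc' hy
          have := hi.trans_le hL
          gcongr
      _ = _ := by ring
  calc _ ≤ i * (‖(s : ℂ) * (c * x)‖ + ‖(s : ℂ) * (c' * y)‖) := by
        gcongr
        exact norm_sub_le _ _
    _ = _ := mul_add _ _ _
    _ ≤ _ := h.add_le e1 e2 (by norm_num) (by norm_num) (hi.trans_le hL).le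

/-- Insertion of a three-resolvent chain to the right of a regular observable. -/
theorem iw_mul_norm_cf_right_le {a b c : ℂ} (ha : a ∈ G) (hb : b ∈ G) (hc : c ∈ G)
    {Ah X : Mat2 N} (P : Dressed M B d a b Ah) (T : TripleBd B b c X) {L : ℝ}
    (hac : iw a c ≤ L) (hbc : iw b c ≤ L) :
    iw a c * ‖cf (M a * Ah * M b * Sop N X * M c) (sg a c)‖ ≤ B ^ 31 * L := by
  have hs := isSgn_sg (h.im_ne b hb) (h.im_ne c hc)
  have e : cf (M a * Ah * M b * Sop N X * M c) (sg a c) =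
      sg b c * (cf X (sg b c) *
        ntr (M a * Ah * M b * EOf N (sg b c) * M c * EOf N (sg a c))) -
      sg b c * (cf X (-sg b c) *
        ntr (M a * Ah * M b * EOf N (-sg b c) * M c * EOf N (sg a c))) := by
    rw [sop_eq hs X]
    simp only [cf, mul_sub, sub_mul, mul_smul_comm, smul_mul_assoc, ntr_sub, ntr_smul]
    ring
  rw [e]
  exact h.iw_mul_norm_add_le hs (iw_pos (h.im_ne a ha)) hac T.unstable T.stable
    (h.iw_mul_norm_tri_le ha hb hc P hac hbc) (h.norm_ntr_cross_le hc ha hb P _ _)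

/-- Insertion of a three-resolvent chain to the left of a regular observable. -/
theorem iw_mul_norm_cf_left_le {a b c : ℂ} (ha : a ∈ G) (hb : b ∈ G) (hc : c ∈ G)
    {Ah X : Mat2 N} (P : Dressed M B d a b Ah) (T : TripleBd B c a X) {L : ℝ}
    (hcb : iw c b ≤ L) (hca : iw c a ≤ L) :
    iw c b * ‖cf (M c * Sop N X * M a * Ah * M b) (sg c b)‖ ≤ B ^ 31 * L := by
  have na := h.im_ne a ha
  have nb := h.im_ne b hb
  have nc := h.im_ne c hc
  have hs := isSgn_sg nc na
  have cyc : ∀ σ : ℝ, ntr (M c * EOf N σ * M a * Ah * M b * EOf N (sg c b)) =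
      ntr (M a * Ah * M b * EOf N (sg b c) * M c * EOf N σ) := fun σ => by
    have : M c * EOf N σ * M a * Ah * M b * EOf N (sg c b) =
        M c * EOf N σ * (M a * Ah * M b * EOf N (sg c b)) := by simp only [mul_assoc]
    rw [this, ntr_mul_comm, sg_comm c b, ← mul_assoc]
  have e : cf (M c * Sop N X * M a * Ah * M b) (sg c b) =
      sg c a * (cf X (sg c a) *
        ntr (M a * Ah * M b * EOf N (sg b c) * M c * EOf N (sg a c))) -
      sg c a * (cf X (-sg c a) *
        ntr (M a * Ah * M b * EOf N (sg b c) * M c * EOf N (-sg a c))) := by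
    rw [sop_eq hs X]
    simp only [cf, mul_sub, sub_mul, mul_smul_comm, smul_mul_assoc, ntr_sub, ntr_smul]
    rw [cyc, cyc, sg_comm a c]
    ring
  rw [e]
  refine h.iw_mul_norm_add_le hs (iw_pos nc) hcb T.unstable T.stable ?_
    (h.norm_ntr_cross_le hc ha hb P _ _)
  have h1 := h.iw_mul_norm_tri_le ha hb hc P (L := L) (by rwa [iw_comm na nc])
    (by rwa [iw_comm nb nc])
  rw [iw_comm nb nc, iw_comm na nc] at h1
  linarith

section Quadruple

variable {w₁ w₂ w₃ w₄ : ℂ} (hw₁ : w₁ ∈ G) (hw₂ : w₂ ∈ G) (hw₃ : w₃ ∈ G) (hw₄ : w₄ ∈ G)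
  {A₁ A₂ A₃ X₁₃ X₂₄ : Mat2 N} (P₁ : Dressed M B d w₁ w₂ A₁) (P₂ : Dressed M B d w₂ w₃ A₂)
  (P₃ : Dressed M B d w₃ w₄ A₃) (T₁₃ : TripleBd B w₁ w₃ X₁₃) (T₂₄ : TripleBd B w₂ w₄ X₂₄)
  {L : ℝ} (hL₁₃ : iw w₁ w₃ ≤ L) (hL₂₄ : iw w₂ w₄ ≤ L)
include hw₁ hw₂ hw₃ hw₄ P₁ P₂ P₃ T₁₃ T₂₄ hL₁₃ hL₂₄

theorem norm_quadruple_inner_le :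
    ‖A₁ * M w₂ * A₂ * M w₃ * A₃ + A₁ * M w₂ * Sop N X₂₄ + Sop N X₁₃ * M w₃ * A₃‖
      ≤ B ^ 29 * L := by
  have hB := h.pos
  have hL : 1 ≤ L := (one_le_iw (h.im_ne w₁ hw₁)).trans hL₁₃
  have n2 := h.norm_le w₂ hw₂
  have n3 := h.norm_le w₃ hw₃
  have t1 : ‖Sop N X₁₃‖ ≤ B ^ 19 * L :=
    (h.norm_sop_triple_le hw₁ hw₃ T₁₃).trans (by gcongr)
  have t2 : ‖Sop N X₂₄‖ ≤ B ^ 19 * L :=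
    (h.norm_sop_triple_le hw₂ hw₄ T₂₄).trans (by gcongr)
  refine (norm_add₃_le).trans
    (h.add_le_add_three (n := 27) ?_ ?_ ?_ le_rfl (by linarith))
  · calc _ ≤ B ^ 7 * B * B ^ 7 * B * B ^ 7 := norm_mul_le_of_le (norm_mul_le_of_le
          (norm_mul_le_of_le (norm_mul_le_of_le P₁.norm_le n2) P₂.norm_le) n3) P₃.norm_le
      _ = B ^ 23 * 1 := by ring
      _ ≤ B ^ 27 * L := by
        have := h.pow_mono (n := 23) (m := 27) (by norm_num)
        gcongr
  · calc _ ≤ B ^ 7 * B * (B ^ 19 * L) :=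
          norm_mul_le_of_le (norm_mul_le_of_le P₁.norm_le n2) t2
      _ = _ := by ring
  · calc _ ≤ (B ^ 19 * L) * B * B ^ 7 :=
          norm_mul_le_of_le (norm_mul_le_of_le t1 n3) P₃.norm_le
      _ = _ := by ring

theorem norm_quadruple_le (hL₁₄ : iw w₁ w₄ ≤ L) {X : Mat2 N}
    (hX : X - M w₁ * Sop N X * M w₄ = M w₁ * (A₁ * M w₂ * A₂ * M w₃ * A₃ +
      A₁ * M w₂ * Sop N X₂₄ + Sop N X₁₃ * M w₃ * A₃) * M w₄) :
    ‖Sop N X‖ ≤ B ^ 35 * L ∧ ‖X‖ ≤ B ^ 38 * L := by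
  have hB := h.pos
  have n1 := h.im_ne w₁ hw₁
  have hi := iw_pos (w' := w₄) n1
  have hL : 1 ≤ L := (one_le_iw (h.im_ne w₁ hw₁)).trans hL₁₃
  have hin := h.norm_quadruple_inner_le hw₁ hw₂ hw₃ hw₄ P₁ P₂ P₃ T₁₃ T₂₄ hL₁₃ hL₂₄
  set Q := A₁ * M w₂ * A₂ * M w₃ * A₃ + A₁ * M w₂ * Sop N X₂₄ + Sop N X₁₃ * M w₃ * A₃ with hQ
  have hY : ‖M w₁ * Q * M w₄‖ ≤ B ^ 31 * L :=
    (norm_mul_le_of_le (norm_mul_le_of_le (h.norm_le w₁ hw₁) hin) (h.norm_le w₄ hw₄)).trans_eq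
      (by ring)
  have c1 : ‖cf X (-sg w₁ w₄)‖ ≤ B ^ 34 * L := by
    refine (h.norm_cf_stable_le hw₁ hw₄ hX).trans ?_
    calc _ ≤ B * (B ^ 31 * L) := by gcongr
      _ = B ^ 32 * L := by ring
      _ ≤ _ := by
        have := h.pow_mono (n := 32) (m := 34) (by norm_num)
        gcongr
  have eQ : M w₁ * Q * M w₄ = M w₁ * A₁ * M w₂ * A₂ * M w₃ * A₃ * M w₄ +
      M w₁ * A₁ * M w₂ * Sop N X₂₄ * M w₄ + M w₁ * Sop N X₁₃ * M w₃ * A₃ * M w₄ := by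
    rw [hQ]
    simp only [mul_add, add_mul, mul_assoc]
  have m1 : iw w₁ w₄ * ‖cf (M w₁ * A₁ * M w₂ * A₂ * M w₃ * A₃ * M w₄) (sg w₁ w₄)‖
      ≤ B ^ 31 * L := by
    have : ‖M w₁ * A₁ * M w₂ * A₂ * M w₃ * A₃ * M w₄‖ ≤ B ^ 25 :=
      (norm_mul_le_of_le (norm_mul_le_of_le (norm_mul_le_of_le (norm_mul_le_of_le
        (h.norm_dressed_le hw₁ hw₂ P₁) P₂.norm_le) (h.norm_le w₃ hw₃)) P₃.norm_le)
        (h.norm_le w₄ hw₄)).trans_eq (by ring)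
    have h2 := ((norm_cf_le _ (sg w₁ w₄)).trans this).trans
      (h.pow_mono (n := 25) (m := 31) (by norm_num))
    calc _ ≤ L * B ^ 31 := by gcongr
      _ = _ := mul_comm _ _
  have m2 := h.iw_mul_norm_cf_right_le hw₁ hw₂ hw₄ P₁ T₂₄ hL₁₄ hL₂₄
  have m3 := h.iw_mul_norm_cf_left_le hw₃ hw₄ hw₁ P₃ T₁₃ hL₁₄ hL₁₃
  have c2 : ‖cf X (sg w₁ w₄)‖ ≤ B ^ 34 * L := by
    refine (h.norm_cf_unstable_le hw₁ hw₄ hX).trans ?_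
    rw [eQ, cf_add, cf_add]
    calc _ ≤ B * iw w₁ w₄ *
          (‖cf (M w₁ * A₁ * M w₂ * A₂ * M w₃ * A₃ * M w₄) (sg w₁ w₄)‖ +
          ‖cf (M w₁ * A₁ * M w₂ * Sop N X₂₄ * M w₄) (sg w₁ w₄)‖ +
          ‖cf (M w₁ * Sop N X₁₃ * M w₃ * A₃ * M w₄) (sg w₁ w₄)‖) := by
          gcongr
          exact norm_add₃_le
      _ = B * (iw w₁ w₄ * ‖cf (M w₁ * A₁ * M w₂ * A₂ * M w₃ * A₃ * M w₄) (sg w₁ w₄)‖ +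
          iw w₁ w₄ * ‖cf (M w₁ * A₁ * M w₂ * Sop N X₂₄ * M w₄) (sg w₁ w₄)‖ +
          iw w₁ w₄ * ‖cf (M w₁ * Sop N X₁₃ * M w₃ * A₃ * M w₄) (sg w₁ w₄)‖) := by ring
      _ ≤ B * (B ^ 33 * L) := by
        gcongr
        exact h.add_le_add_three m1 m2 m3 le_rfl (by linarith)
      _ = _ := by ring
  have hS : ‖Sop N X‖ ≤ B ^ 35 * L :=
    (norm_sop_le (isSgn_sg n1 (h.im_ne w₄ hw₄)) X).trans
      (h.add_le c2 c1 le_rfl le_rfl (by linarith))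
  refine ⟨hS, (h.norm_chain_le hw₁ hw₄ hX).trans
    (h.add_le (n := 31) (k := 37) hY ?_ (by norm_num) le_rfl (by linarith))⟩
  calc _ ≤ B ^ 2 * (B ^ 35 * L) := by gcongr
    _ = _ := by ring

end Quadruple

/-- Two three-resolvent chains sharing their middle spectral parameter: the product of the two
unstable components does not contribute to the unstable direction. -/
theorem norm_cf_two_triples_le {a b c : ℂ} (ha : a ∈ G) (hb : b ∈ G) (hc : c ∈ G)
    {X X' : Mat2 N} (T : TripleBd B a b X) (T' : TripleBd B b c X') {L : ℝ}
    (hL : iw a b ≤ L) (hL' : iw b c ≤ L) :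
    ‖cf (M a * Sop N X * M b * Sop N X' * M c) (sg a c)‖ ≤ B ^ 41 * L := by
  have hB := h.pos
  have hs := isSgn_sg (h.im_ne a ha) (h.im_ne b hb)
  have hs' := isSgn_sg (h.im_ne b hb) (h.im_ne c hc)
  have hL1 : 1 ≤ L := (one_le_iw (h.im_ne a ha)).trans hL
  have ht := h.triple a ha b hb c hc
  have hE : ∀ σ τ : ℝ, ‖ntr (M a * EOf N σ * M b * EOf N τ * M c * EOf N (sg a c))‖ ≤ B ^ 3 :=
    fun σ τ => by
      calc _ ≤ ‖M a * EOf N σ * M b * EOf N τ * M c‖ := norm_cf_le _ _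
        _ ≤ B * B * B := norm_mul_le_of_le ((norm_mul_EOf_le _ _).trans
            (norm_mul_le_of_le ((norm_mul_EOf_le _ _).trans (h.norm_le a ha))
              (h.norm_le b hb))) (h.norm_le c hc)
        _ = _ := by ring
  have e : cf (M a * Sop N X * M b * Sop N X' * M c) (sg a c) =
      (sg a b * sg b c) * (cf X (-sg a b) * (cf X' (-sg b c) *
        ntr (M a * EOf N (-sg a b) * M b * EOf N (-sg b c) * M c * EOf N (sg a c)))) +
      -(sg a b * sg b c) * (cf X (sg a b) * (cf X' (-sg b c) *
        ntr (M a * EOf N (sg a b) * M b * EOf N (-sg b c) * M c * EOf N (sg a c)))) +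
      -(sg a b * sg b c) * (cf X (-sg a b) * (cf X' (sg b c) *
        ntr (M a * EOf N (-sg a b) * M b * EOf N (sg b c) * M c * EOf N (sg a c)))) := by
    rw [sop_eq hs X, sop_eq hs' X']
    simp only [cf, mul_sub, sub_mul, mul_smul_comm, smul_mul_assoc, ntr_sub, ntr_smul]
    rw [ht]
    ring
  have u1 : ‖cf X (sg a b)‖ ≤ B ^ 18 * L := T.unstable.trans (by gcongr)
  have u2 : ‖cf X' (sg b c)‖ ≤ B ^ 18 * L := T'.unstable.trans (by gcongr)
  have sn : ‖(sg a b : ℂ) * sg b c‖ = 1 := by rw [norm_mul, hs.norm, hs'.norm, one_mul]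
  rw [e]
  refine norm_add₃_le.trans (h.add_le_add_three (n := 39) ?_ ?_ ?_ le_rfl (by linarith))
  · rw [norm_mul, sn, one_mul]
    calc _ ≤ B ^ 18 * (B ^ 18 * B ^ 3) :=
          norm_mul_le_of_le T.stable (norm_mul_le_of_le T'.stable (hE _ _))
      _ = B ^ 39 * 1 := by ring
      _ ≤ _ := by gcongr
  · rw [norm_mul, norm_neg, sn, one_mul]
    calc _ ≤ (B ^ 18 * L) * (B ^ 18 * B ^ 3) :=
          norm_mul_le_of_le u1 (norm_mul_le_of_le T'.stable (hE _ _))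
      _ = _ := by ring
  · rw [norm_mul, norm_neg, sn, one_mul]
    calc _ ≤ B ^ 18 * ((B ^ 18 * L) * B ^ 3) :=
          norm_mul_le_of_le T.stable (norm_mul_le_of_le u2 (hE _ _))
      _ = _ := by ring

theorem norm_quintuple_le {w₁ w₂ w₃ w₄ w₅ : ℂ} (hw₁ : w₁ ∈ G) (hw₂ : w₂ ∈ G) (hw₃ : w₃ ∈ G)
    (hw₄ : w₄ ∈ G) (hw₅ : w₅ ∈ G) {A₁ A₂ A₃ A₄ X₁₃ X₂₄ X₃₅ X₁₄ X₂₅ X : Mat2 N}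
    (P₁ : Dressed M B d w₁ w₂ A₁) (P₂ : Dressed M B d w₂ w₃ A₂) (P₃ : Dressed M B d w₃ w₄ A₃)
    (P₄ : Dressed M B d w₄ w₅ A₄) (T₁₃ : TripleBd B w₁ w₃ X₁₃) (T₂₄ : TripleBd B w₂ w₄ X₂₄)
    (T₃₅ : TripleBd B w₃ w₅ X₃₅) {L : ℝ} (hL₁₃ : iw w₁ w₃ ≤ L) (hL₂₄ : iw w₂ w₄ ≤ L)
    (hL₃₅ : iw w₃ w₅ ≤ L) (hL₁₅ : iw w₁ w₅ ≤ L)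
    (hX₁₄ : ‖Sop N X₁₄‖ ≤ B ^ 35 * L) (hX₂₅ : ‖Sop N X₂₅‖ ≤ B ^ 35 * L)
    (hX : X - M w₁ * Sop N X * M w₅ = M w₁ * (A₁ * M w₂ * ((A₂ * M w₃ * A₃ * M w₄ * A₄ +
      A₂ * M w₃ * Sop N X₃₅ + Sop N X₂₄ * M w₄ * A₄) + Sop N X₂₅) +
      Sop N X₁₃ * M w₃ * (A₃ * M w₄ * A₄ + Sop N X₃₅) + Sop N X₁₄ * M w₄ * A₄) * M w₅) :
    ‖X‖ ≤ B ^ 55 * L ^ 2 := by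
  have hB := h.pos
  have n1 := h.im_ne w₁ hw₁
  have hi := iw_pos (w' := w₅) n1
  have hL : 1 ≤ L := (one_le_iw (h.im_ne w₁ hw₁)).trans hL₁₃
  have m1 := h.norm_le w₁ hw₁
  have m2 := h.norm_le w₂ hw₂
  have m3 := h.norm_le w₃ hw₃
  have m4 := h.norm_le w₄ hw₄
  have m5 := h.norm_le w₅ hw₅
  have hin := h.norm_quadruple_inner_le hw₂ hw₃ hw₄ hw₅ P₂ P₃ P₄ T₂₄ T₃₅ hL₂₄ hL₃₅
  set Q := (A₂ * M w₃ * A₃ * M w₄ * A₄ +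
      A₂ * M w₃ * Sop N X₃₅ + Sop N X₂₄ * M w₄ * A₄) + Sop N X₂₅ with hQdef
  have hQ : ‖Q‖ ≤ B ^ 36 * L :=
    (norm_add_le _ _).trans (h.add_le hin hX₂₅ (by norm_num) le_rfl (by linarith))
  have t13 : ‖Sop N X₁₃‖ ≤ B ^ 19 * L :=
    (h.norm_sop_triple_le hw₁ hw₃ T₁₃).trans (by gcongr)
  have t35 : ‖Sop N X₃₅‖ ≤ B ^ 19 * L :=
    (h.norm_sop_triple_le hw₃ hw₅ T₃₅).trans (by gcongr)
  have a1 : ‖M w₁ * (A₁ * M w₂ * Q) * M w₅‖ ≤ B ^ 46 * L :=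
    (norm_mul_le_of_le (norm_mul_le_of_le m1 (norm_mul_le_of_le
      (norm_mul_le_of_le P₁.norm_le m2) hQ)) m5).trans_eq (by ring)
  have a2 : ‖M w₁ * (Sop N X₁₃ * M w₃ * (A₃ * M w₄ * A₄)) * M w₅‖ ≤ B ^ 37 * L :=
    (norm_mul_le_of_le (norm_mul_le_of_le m1 (norm_mul_le_of_le (norm_mul_le_of_le t13 m3)
      (norm_mul_le_of_le (norm_mul_le_of_le P₃.norm_le m4) P₄.norm_le))) m5).trans_eq (by ring)
  have a3 : ‖M w₁ * Sop N X₁₃ * M w₃ * Sop N X₃₅ * M w₅‖ ≤ B ^ 41 * L ^ 2 :=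
    (norm_mul_le_of_le (norm_mul_le_of_le (norm_mul_le_of_le (norm_mul_le_of_le m1 t13) m3)
      t35) m5).trans_eq (by ring)
  have a4 : ‖M w₁ * (Sop N X₁₄ * M w₄ * A₄) * M w₅‖ ≤ B ^ 45 * L :=
    (norm_mul_le_of_le (norm_mul_le_of_le m1 (norm_mul_le_of_le (norm_mul_le_of_le hX₁₄ m4)
      P₄.norm_le)) m5).trans_eq (by ring)
  have a3' := h.norm_cf_two_triples_le hw₁ hw₃ hw₅ T₁₃ T₃₅ hL₁₃ hL₃₅
  set Z := M w₁ * (A₁ * M w₂ * Q) * M w₅ +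
    M w₁ * (Sop N X₁₃ * M w₃ * (A₃ * M w₄ * A₄)) * M w₅ +
    M w₁ * (Sop N X₁₄ * M w₄ * A₄) * M w₅ with hZ
  have bZ : ‖Z‖ ≤ B ^ 48 * L := by
    refine norm_add₃_le.trans (h.add_le_add_three (n := 46) a1 (a2.trans ?_) (a4.trans ?_)
      le_rfl (by linarith))
    · have := h.pow_mono (n := 37) (m := 46) (by norm_num)
      gcongr
    · have := h.pow_mono (n := 45) (m := 46) (by norm_num)
      gcongr
  rw [show M w₁ * (A₁ * M w₂ * Q + Sop N X₁₃ * M w₃ * (A₃ * M w₄ * A₄ + Sop N X₃₅) +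
      Sop N X₁₄ * M w₄ * A₄) * M w₅ = Z + M w₁ * Sop N X₁₃ * M w₃ * Sop N X₃₅ * M w₅ by
    rw [hZ]
    simp only [mul_add, add_mul, mul_assoc]
    abel] at hX
  have hLL : L ≤ L ^ 2 := by nlinarith
  have bZ2 : ‖Z‖ ≤ B ^ 48 * L ^ 2 := bZ.trans (by gcongr)
  have bY : ‖Z + M w₁ * Sop N X₁₃ * M w₃ * Sop N X₃₅ * M w₅‖ ≤ B ^ 49 * L ^ 2 :=
    (norm_add_le _ _).trans (h.add_le bZ2 a3 (by norm_num) (by norm_num) (by positivity))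
  have cY : ‖cf (Z + M w₁ * Sop N X₁₃ * M w₃ * Sop N X₃₅ * M w₅) (sg w₁ w₅)‖ ≤ B ^ 49 * L := by
    rw [cf_add]
    exact (norm_add_le _ _).trans (h.add_le ((norm_cf_le _ _).trans bZ) a3' (by norm_num)
      (by norm_num) (by linarith))
  have c1 : ‖cf X (-sg w₁ w₅)‖ ≤ B ^ 50 * L ^ 2 := by
    refine (h.norm_cf_stable_le hw₁ hw₅ hX).trans ?_
    calc _ ≤ B * (B ^ 49 * L ^ 2) := by gcongr
      _ = _ := by ring
  have c2 : ‖cf X (sg w₁ w₅)‖ ≤ B ^ 50 * L ^ 2 := by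
    refine (h.norm_cf_unstable_le hw₁ hw₅ hX).trans ?_
    calc _ ≤ B * L * (B ^ 49 * L) := by gcongr
      _ = _ := by ring
  have hS : ‖Sop N X‖ ≤ B ^ 51 * L ^ 2 :=
    (norm_sop_le (isSgn_sg n1 (h.im_ne w₅ hw₅)) X).trans
      (h.add_le c2 c1 le_rfl le_rfl (by positivity))
  refine (h.norm_chain_le hw₁ hw₅ hX).trans
    (h.add_le (n := 49) (k := 53) bY ?_ (by norm_num) (by norm_num) (by positivity))
  calc _ ≤ B ^ 2 * (B ^ 51 * L ^ 2) := by gcongr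
    _ = _ := by ring

end ChainCtx

section Regular

theorem ChainStab.mono {N : ℕ} {M : ℂ → Mat2 N} {G : Set ℂ} {K K' : ℝ} (h : ChainStab M G K)
    (hK : K ≤ K') : ChainStab M G K' where
  one_le := h.one_le.trans hK
  im_ne := h.im_ne
  conj_mem := h.conj_mem
  norm_le w hw := (h.norm_le w hw).trans hK
  norm_le_inv := h.norm_le_inv
  decouple := h.decouple
  triple := h.triple
  stable w hw w' hw' := (h.stable w hw w' hw').trans (by gcongr)
  unstable w hw w' hw' := (h.unstable w hw w' hw').trans (by gcongr)
  unstable_le w hw w' hw' := (h.unstable_le w hw w' hw').trans (by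
    have : 0 ≤ sep w w' := norm_nonneg _
    gcongr)
  reflect w hw w' hw' := (h.reflect w hw w' hw').trans (by
    have : 0 ≤ sep w w' := norm_nonneg _
    gcongr)
  mul_conj w hw := by
    obtain ⟨k, hk, he⟩ := h.mul_conj w hw
    exact ⟨k, hk.trans hK, he⟩

theorem cutoff_eq_one {φ : ℝ → ℝ} {δ : ℝ} (hφ : IsBump δ φ) {w w' z : ℂ} (hw : w.im ≠ 0)
    (hre : w'.re = z.re) (him : |w'.im| = |z.im|) (hz : sep w z ≤ δ / 2) :
    cutoff φ (sg w z) w w' = 1 := by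
  have h1 := abs_re_le_sep w z
  have h2 := abs_im_add_le_sep (w' := z) hw
  have h3 := abs_nonneg w.im
  have h4 := abs_nonneg z.im
  rw [cutoff, hre, hφ.eq_one _ (by linarith), hφ.eq_one _ (by linarith),
    hφ.eq_one _ (by linarith)]
  norm_num

theorem eq_zero_of_EOf_combination {N : ℕ} (hN : N ≠ 0) {s : ℝ} (hs : IsSgn s) {x y : ℂ}
    (h : x • EOf N s + y • EOf N (-s) = 0) : x = 0 ∧ y = 0 := by
  have : Nonempty (Fin N) := ⟨⟨0, Nat.pos_of_ne_zero hN⟩⟩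
  have e1 : cf (x • EOf N s + y • EOf N (-s)) 1 = 0 := by rw [h]; simp [cf, ntr]
  have e2 : cf (x • EOf N s + y • EOf N (-s)) (-1) = 0 := by rw [h]; simp [cf, ntr]
  rw [cf_add, cf_smul, cf_smul] at e1 e2
  rcases hs with rfl | rfl <;>
    simpa [cf, EOf_one, EOf_neg_one, Em_mul_Em, ntr_one, ntr_Em, and_comm] using
      And.intro e1 e2

theorem ChainStab.ntr_ne_zero {N : ℕ} {M : ℂ → Mat2 N} {G : Set ℂ} {K : ℝ}
    (h : ChainStab M G K) {w z : ℂ} (hw : w ∈ G) (hz : z ∈ G) (hs : K * sep w z < 1) :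
    ntr (M w * EOf N (sg w z) * M z * EOf N (sg w z)) ≠ 0 := by
  intro h0
  have h1 := h.unstable_le w hw z hz
  rw [stabFactor, h0, mul_zero, sub_zero, norm_one] at h1
  linarith

theorem ChainStab.reg {N : ℕ} (hN : N ≠ 0) {M : ℂ → Mat2 N} {G : Set ℂ} {K δ : ℝ}
    (h : ChainStab M G K) (hδ : K * δ ≤ 1) {φ : ℝ → ℝ} (hφ : IsBump δ φ)
    {w w' : ℂ} (hw : w ∈ G) (hw' : w' ∈ G) {A : Mat2 N} (hA : IsRegularObs N M φ w w' A) :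
    Reg M (δ / 2) w w' A := by
  have nw := h.im_ne w hw
  have nw' := h.im_ne w' hw'
  have hs := isSgn_sg nw nw'
  have hK := h.one_le
  have z1 : ((w'.re : ℂ) + ((1 * w'.im : ℝ) : ℂ) * Complex.I) = w' := by
    rw [one_mul, Complex.re_add_im]
  have z2 : ((w'.re : ℂ) + ((-1 * w'.im : ℝ) : ℂ) * Complex.I) = starRingEnd ℂ w' := by
    apply Complex.ext <;> simp
  have σ1 : (1 * (-rsgn (w.im * w'.im)) : ℝ) = sg w w' := by rw [one_mul, sg]
  have σ2 : (-1 * (-rsgn (w.im * w'.im)) : ℝ) = -sg w w' := by rw [neg_one_mul, sg]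
  have hA' : regTerm N M φ w w' A 1 + regTerm N M φ w w' A (-1) = 0 := by
    have h1 : A = A - regTerm N M φ w w' A 1 - regTerm N M φ w w' A (-1) := hA
    have h2 : A - (A - regTerm N M φ w w' A 1 - regTerm N M φ w w' A (-1)) = 0 :=
      sub_eq_zero.2 h1
    rw [← h2]
    abel
  rw [regTerm, regTerm, z1, z2, σ1, σ2, smul_smul, smul_smul] at hA'
  obtain ⟨c1, c2⟩ := eq_zero_of_EOf_combination hN hs hA'
  have small : ∀ z : ℂ, sep w z ≤ δ / 2 → K * sep w z < 1 := fun z hz => by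
    have : K * sep w z ≤ K * (δ / 2) := by gcongr
    linarith
  constructor
  · intro hz
    rw [cutoff_eq_one hφ nw rfl rfl hz, Complex.ofReal_one, one_mul, div_eq_zero_iff] at c1
    exact c1.resolve_right (h.ntr_ne_zero hw hw' (small _ hz))
  · intro hz
    rw [← sg_conj_right, cutoff_eq_one hφ nw (by simp) (by simp) hz, Complex.ofReal_one, one_mul,
      div_eq_zero_iff] at c2
    exact c2.resolve_right (h.ntr_ne_zero hw (h.conj_mem _ hw') (small _ hz))

end Regular

section Recursion

variable {N : ℕ} {M : ℂ → Mat2 N} {M2 : ℂ → Mat2 N → ℂ → Mat2 N}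
  {M3 : ℂ → Mat2 N → ℂ → Mat2 N → ℂ → Mat2 N}
  {M4 : ℂ → Mat2 N → ℂ → Mat2 N → ℂ → Mat2 N → ℂ → Mat2 N}
  {M5 : ℂ → Mat2 N → ℂ → Mat2 N → ℂ → Mat2 N → ℂ → Mat2 N → ℂ → Mat2 N}
  {w₁ w₂ w₃ w₄ w₅ : ℂ}

theorem mul_sop_mul (P Q R : Mat2 N) :
    P * Sop N Q * R = ntr Q • (P * R) - ntr (Q * Em N) • (P * Em N * R) := by
  simp only [Sop, mul_sub, sub_mul, mul_smul_comm, smul_mul_assoc, mul_one]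

theorem IsChain3.eq (hM3 : IsChain3 N M M2 M3) (h₁ : w₁.im ≠ 0) (h₂ : w₂.im ≠ 0)
    (h₃ : w₃.im ≠ 0) (A₁ A₂ : Mat2 N) :
    M3 w₁ A₁ w₂ A₂ w₃ - M w₁ * Sop N (M3 w₁ A₁ w₂ A₂ w₃) * M w₃ =
      M w₁ * (A₁ + Sop N (M2 w₁ A₁ w₂)) * M2 w₂ A₂ w₃ := by
  rw [hM3 w₁ w₂ w₃ h₁ h₂ h₃, mul_add, add_mul, mul_sop_mul]
  abel

theorem IsChain4.eq (hM4 : IsChain4 N M M2 M3 M4) (h₁ : w₁.im ≠ 0) (h₂ : w₂.im ≠ 0)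
    (h₃ : w₃.im ≠ 0) (h₄ : w₄.im ≠ 0) (A₁ A₂ A₃ : Mat2 N) :
    M4 w₁ A₁ w₂ A₂ w₃ A₃ w₄ - M w₁ * Sop N (M4 w₁ A₁ w₂ A₂ w₃ A₃ w₄) * M w₄ =
      M w₁ * (A₁ + Sop N (M2 w₁ A₁ w₂)) * M3 w₂ A₂ w₃ A₃ w₄ +
      M w₁ * Sop N (M3 w₁ A₁ w₂ A₂ w₃) * M2 w₃ A₃ w₄ := by
  rw [hM4 w₁ w₂ w₃ w₄ h₁ h₂ h₃ h₄, mul_add, add_mul, mul_sop_mul, mul_sop_mul]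
  abel

theorem IsChain5.eq (hM5 : IsChain5 N M M2 M3 M4 M5) (h₁ : w₁.im ≠ 0) (h₂ : w₂.im ≠ 0)
    (h₃ : w₃.im ≠ 0) (h₄ : w₄.im ≠ 0) (h₅ : w₅.im ≠ 0) (A₁ A₂ A₃ A₄ : Mat2 N) :
    M5 w₁ A₁ w₂ A₂ w₃ A₃ w₄ A₄ w₅ - M w₁ * Sop N (M5 w₁ A₁ w₂ A₂ w₃ A₃ w₄ A₄ w₅) * M w₅ =
      M w₁ * (A₁ + Sop N (M2 w₁ A₁ w₂)) * M4 w₂ A₂ w₃ A₃ w₄ A₄ w₅ +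
      M w₁ * Sop N (M3 w₁ A₁ w₂ A₂ w₃) * M3 w₃ A₃ w₄ A₄ w₅ +
      M w₁ * Sop N (M4 w₁ A₁ w₂ A₂ w₃ A₃ w₄) * M2 w₄ A₄ w₅ := by
  rw [hM5 w₁ w₂ w₃ w₄ w₅ h₁ h₂ h₃ h₄ h₅, mul_add, add_mul, mul_sop_mul, mul_sop_mul,
    mul_sop_mul]
  abel

end Recursion

namespace ChainCtx

variable {N : ℕ} {M : ℂ → Mat2 N} {G : Set ℂ} {B d : ℝ} (h : ChainCtx M G B d)
  {M2 : ℂ → Mat2 N → ℂ → Mat2 N}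
  {M3 : ℂ → Mat2 N → ℂ → Mat2 N → ℂ → Mat2 N}
  {M4 : ℂ → Mat2 N → ℂ → Mat2 N → ℂ → Mat2 N → ℂ → Mat2 N}
  {M5 : ℂ → Mat2 N → ℂ → Mat2 N → ℂ → Mat2 N → ℂ → Mat2 N → ℂ → Mat2 N}
  (hM2 : IsChain2 N M M2) (hM3 : IsChain3 N M M2 M3) (hM4 : IsChain4 N M M2 M3 M4)
  (hM5 : IsChain5 N M M2 M3 M4 M5)
  {w₁ w₂ w₃ w₄ w₅ : ℂ} (hw₁ : w₁ ∈ G) (hw₂ : w₂ ∈ G) (hw₃ : w₃ ∈ G) (hw₄ : w₄ ∈ G)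
  (hw₅ : w₅ ∈ G) {A₁ A₂ A₃ A₄ : Mat2 N} (hA₁ : ‖A₁‖ ≤ B) (hA₂ : ‖A₂‖ ≤ B) (hA₃ : ‖A₃‖ ≤ B)
  (hA₄ : ‖A₄‖ ≤ B)
include h

section Small

include hM2 hw₁ hw₂ hA₁ in
theorem dressed_chain2 (R₁ : Reg M d w₁ w₂ A₁) :
    Dressed M B d w₁ w₂ (A₁ + Sop N (M2 w₁ A₁ w₂)) ∧
      M2 w₁ A₁ w₂ = M w₁ * (A₁ + Sop N (M2 w₁ A₁ w₂)) * M w₂ :=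
  h.dressed hw₁ hw₂ hA₁ R₁ (hM2 w₁ w₂ (h.im_ne _ hw₁) (h.im_ne _ hw₂) A₁)

include hM2 hw₁ hw₂ hA₁ in
theorem norm_chain2_le (R₁ : Reg M d w₁ w₂ A₁) : ‖M2 w₁ A₁ w₂‖ ≤ B ^ 9 := by
  obtain ⟨P, e⟩ := h.dressed_chain2 hM2 hw₁ hw₂ hA₁ R₁
  rw [e]
  exact h.norm_dressed_le hw₁ hw₂ P

include hM2 hM3 hw₁ hw₂ hw₃ hA₂ in
theorem chain3_eq (R₂ : Reg M d w₂ w₃ A₂) :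
    M3 w₁ A₁ w₂ A₂ w₃ - M w₁ * Sop N (M3 w₁ A₁ w₂ A₂ w₃) * M w₃ =
      M w₁ * (A₁ + Sop N (M2 w₁ A₁ w₂)) * M w₂ * (A₂ + Sop N (M2 w₂ A₂ w₃)) * M w₃ := by
  obtain ⟨-, e⟩ := h.dressed_chain2 hM2 hw₂ hw₃ hA₂ R₂
  rw [hM3.eq (h.im_ne _ hw₁) (h.im_ne _ hw₂) (h.im_ne _ hw₃)]
  conv_lhs => rw [e]
  simp only [mul_assoc]

include hM2 hM3 hw₁ hw₂ hw₃ hA₁ hA₂ in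
theorem tripleBd_chain3 (R₁ : Reg M d w₁ w₂ A₁) (R₂ : Reg M d w₂ w₃ A₂) :
    TripleBd B w₁ w₃ (M3 w₁ A₁ w₂ A₂ w₃) :=
  h.tripleBd hw₁ hw₂ hw₃ (h.dressed_chain2 hM2 hw₁ hw₂ hA₁ R₁).1
    (h.dressed_chain2 hM2 hw₂ hw₃ hA₂ R₂).1 (h.chain3_eq hM2 hM3 hw₁ hw₂ hw₃ hA₂ R₂)

include hM2 hM3 hw₁ hw₂ hw₃ hA₂ in
theorem chain3_eq_mul (R₂ : Reg M d w₂ w₃ A₂) :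
    M3 w₁ A₁ w₂ A₂ w₃ = M w₁ * ((A₁ + Sop N (M2 w₁ A₁ w₂)) * M w₂ *
      (A₂ + Sop N (M2 w₂ A₂ w₃)) + Sop N (M3 w₁ A₁ w₂ A₂ w₃)) * M w₃ := by
  have e := sub_eq_iff_eq_add.1 (h.chain3_eq hM2 hM3 hw₁ hw₂ hw₃ (A₁ := A₁) hA₂ R₂)
  conv_lhs => rw [e]
  simp only [mul_assoc, mul_add, add_mul]

include hM2 hM3 hw₁ hw₂ hw₃ hA₁ hA₂ in
theorem norm_chain3_le (R₁ : Reg M d w₁ w₂ A₁) (R₂ : Reg M d w₂ w₃ A₂) :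
    ‖M3 w₁ A₁ w₂ A₂ w₃‖ ≤ B ^ 22 * iw w₁ w₃ :=
  h.norm_triple_le hw₁ hw₂ hw₃ (h.dressed_chain2 hM2 hw₁ hw₂ hA₁ R₁).1
    (h.dressed_chain2 hM2 hw₂ hw₃ hA₂ R₂).1 (h.chain3_eq hM2 hM3 hw₁ hw₂ hw₃ hA₂ R₂)

include hM2 hM3 hw₁ hw₂ hw₃ hA₁ hA₂ hA₃ in
theorem norm_ntr_chain3_le (R₁ : Reg M d w₁ w₂ A₁) (R₂ : Reg M d w₂ w₃ A₂)
    (R₃ : Reg M d w₃ w₁ A₃) : ‖ntr (M3 w₁ A₁ w₂ A₂ w₃ * A₃)‖ ≤ B ^ 24 :=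
  h.norm_ntr_triple_mul_le hw₁ hw₂ hw₃ (h.dressed_chain2 hM2 hw₁ hw₂ hA₁ R₁).1
    (h.dressed_chain2 hM2 hw₂ hw₃ hA₂ R₂).1 hA₃ R₃ (h.chain3_eq hM2 hM3 hw₁ hw₂ hw₃ hA₂ R₂)

include hM2 hM3 hM4 hw₁ hw₂ hw₃ hw₄ hA₃ in
theorem chain4_eq (R₃ : Reg M d w₃ w₄ A₃) :
    M4 w₁ A₁ w₂ A₂ w₃ A₃ w₄ - M w₁ * Sop N (M4 w₁ A₁ w₂ A₂ w₃ A₃ w₄) * M w₄ =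
      M w₁ * ((A₁ + Sop N (M2 w₁ A₁ w₂)) * M w₂ * (A₂ + Sop N (M2 w₂ A₂ w₃)) * M w₃ *
          (A₃ + Sop N (M2 w₃ A₃ w₄)) +
        (A₁ + Sop N (M2 w₁ A₁ w₂)) * M w₂ * Sop N (M3 w₂ A₂ w₃ A₃ w₄) +
        Sop N (M3 w₁ A₁ w₂ A₂ w₃) * M w₃ * (A₃ + Sop N (M2 w₃ A₃ w₄))) * M w₄ := by
  have e1 := h.chain3_eq_mul hM2 hM3 hw₂ hw₃ hw₄ (A₁ := A₂) hA₃ R₃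
  obtain ⟨-, e2⟩ := h.dressed_chain2 hM2 hw₃ hw₄ hA₃ R₃
  rw [hM4.eq (h.im_ne _ hw₁) (h.im_ne _ hw₂) (h.im_ne _ hw₃) (h.im_ne _ hw₄)]
  set D₁ := A₁ + Sop N (M2 w₁ A₁ w₂)
  set D₂ := A₂ + Sop N (M2 w₂ A₂ w₃)
  set D₃ := A₃ + Sop N (M2 w₃ A₃ w₄)
  set S₂ := Sop N (M3 w₂ A₂ w₃ A₃ w₄)
  rw [e1, e2]
  simp only [mul_assoc, mul_add, add_mul]

include hM2 hM3 hM4 hw₁ hw₂ hw₃ hw₄ hA₁ hA₂ hA₃ in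
theorem norm_chain4_le (R₁ : Reg M d w₁ w₂ A₁) (R₂ : Reg M d w₂ w₃ A₂)
    (R₃ : Reg M d w₃ w₄ A₃) {L : ℝ} (h₁₃ : iw w₁ w₃ ≤ L) (h₂₄ : iw w₂ w₄ ≤ L)
    (h₁₄ : iw w₁ w₄ ≤ L) :
    ‖Sop N (M4 w₁ A₁ w₂ A₂ w₃ A₃ w₄)‖ ≤ B ^ 35 * L ∧
      ‖M4 w₁ A₁ w₂ A₂ w₃ A₃ w₄‖ ≤ B ^ 38 * L :=
  h.norm_quadruple_le hw₁ hw₂ hw₃ hw₄ (h.dressed_chain2 hM2 hw₁ hw₂ hA₁ R₁).1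
    (h.dressed_chain2 hM2 hw₂ hw₃ hA₂ R₂).1 (h.dressed_chain2 hM2 hw₃ hw₄ hA₃ R₃).1
    (h.tripleBd_chain3 hM2 hM3 hw₁ hw₂ hw₃ hA₁ hA₂ R₁ R₂)
    (h.tripleBd_chain3 hM2 hM3 hw₂ hw₃ hw₄ hA₂ hA₃ R₂ R₃) h₁₃ h₂₄ h₁₄
    (h.chain4_eq hM2 hM3 hM4 hw₁ hw₂ hw₃ hw₄ hA₃ R₃)

include hM2 hM3 hM4 hM5 hw₁ hw₂ hw₃ hw₄ hw₅ hA₁ hA₂ hA₃ hA₄ in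
theorem norm_chain5_le (R₁ : Reg M d w₁ w₂ A₁) (R₂ : Reg M d w₂ w₃ A₂)
    (R₃ : Reg M d w₃ w₄ A₃) (R₄ : Reg M d w₄ w₅ A₄) {L : ℝ} (h₁₃ : iw w₁ w₃ ≤ L)
    (h₂₄ : iw w₂ w₄ ≤ L) (h₃₅ : iw w₃ w₅ ≤ L) (h₁₄ : iw w₁ w₄ ≤ L) (h₂₅ : iw w₂ w₅ ≤ L)
    (h₁₅ : iw w₁ w₅ ≤ L) :
    ‖M5 w₁ A₁ w₂ A₂ w₃ A₃ w₄ A₄ w₅‖ ≤ B ^ 55 * L ^ 2 := by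
  refine h.norm_quintuple_le hw₁ hw₂ hw₃ hw₄ hw₅ (h.dressed_chain2 hM2 hw₁ hw₂ hA₁ R₁).1
    (h.dressed_chain2 hM2 hw₂ hw₃ hA₂ R₂).1 (h.dressed_chain2 hM2 hw₃ hw₄ hA₃ R₃).1
    (h.dressed_chain2 hM2 hw₄ hw₅ hA₄ R₄).1
    (h.tripleBd_chain3 hM2 hM3 hw₁ hw₂ hw₃ hA₁ hA₂ R₁ R₂)
    (h.tripleBd_chain3 hM2 hM3 hw₂ hw₃ hw₄ hA₂ hA₃ R₂ R₃)
    (h.tripleBd_chain3 hM2 hM3 hw₃ hw₄ hw₅ hA₃ hA₄ R₃ R₄) h₁₃ h₂₄ h₃₅ h₁₅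
    (h.norm_chain4_le hM2 hM3 hM4 hw₁ hw₂ hw₃ hw₄ hA₁ hA₂ hA₃ R₁ R₂ R₃ h₁₃ h₂₄ h₁₄).1
    (h.norm_chain4_le hM2 hM3 hM4 hw₂ hw₃ hw₄ hw₅ hA₂ hA₃ hA₄ R₂ R₃ R₄ h₂₄ h₃₅ h₂₅).1 ?_
  have e1 := sub_eq_iff_eq_add.1
    (h.chain4_eq hM2 hM3 hM4 hw₂ hw₃ hw₄ hw₅ (A₁ := A₂) (A₂ := A₃) hA₄ R₄)
  have e2 := h.chain3_eq_mul hM2 hM3 hw₃ hw₄ hw₅ (A₁ := A₃) hA₄ R₄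
  obtain ⟨-, e3⟩ := h.dressed_chain2 hM2 hw₄ hw₅ hA₄ R₄
  rw [hM5.eq (h.im_ne _ hw₁) (h.im_ne _ hw₂) (h.im_ne _ hw₃) (h.im_ne _ hw₄) (h.im_ne _ hw₅)]
  rw [← add_mul, ← mul_add] at e1
  set D₁ := A₁ + Sop N (M2 w₁ A₁ w₂)
  set D₂ := A₂ + Sop N (M2 w₂ A₂ w₃)
  set D₃ := A₃ + Sop N (M2 w₃ A₃ w₄)
  set D₄ := A₄ + Sop N (M2 w₄ A₄ w₅)
  set S₂ := Sop N (M3 w₂ A₂ w₃ A₃ w₄)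
  set S₃ := Sop N (M3 w₃ A₃ w₄ A₄ w₅)
  set S := Sop N (M4 w₂ A₂ w₃ A₃ w₄ A₄ w₅)
  rw [e1, e2, e3]
  simp only [mul_assoc, mul_add, add_mul]

end Small

section Large

variable {l : ℝ} (hl : l ≤ 1)

theorem norm_chain_le_of_one_le {w w' : ℂ} (hw : w ∈ G) (hw' : w' ∈ G) (hη : 1 ≤ |w.im|)
    (hMw : ‖M w‖ ≤ 1) (hMw' : ‖M w'‖ ≤ 1) {X Y : Mat2 N}
    (hX : X - M w * Sop N X * M w' = Y) : ‖X‖ ≤ B ^ 3 * ‖Y‖ := by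
  have hB := h.pos
  have nw := h.im_ne w hw
  have hi : iw w w' ≤ 1 := (iw_le one_pos le_rfl hη).trans_eq inv_one
  have c1 := h.norm_cf_stable_le hw hw' hX
  have c2 : ‖cf X (sg w w')‖ ≤ B * ‖Y‖ := by
    refine (h.norm_cf_unstable_le hw hw' hX).trans ?_
    calc _ ≤ B * 1 * ‖Y‖ := by
          gcongr
          exact norm_cf_le _ _
      _ = _ := by ring
  have hS : ‖Sop N X‖ ≤ B ^ 2 * ‖Y‖ :=
    (norm_sop_le (isSgn_sg nw (h.im_ne w' hw')) X).trans
      (h.add_le (n := 1) (k := 1) (by rwa [pow_one]) (by rwa [pow_one]) le_rfl le_rfl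
        (norm_nonneg _))
  have e := sub_eq_iff_eq_add.1 hX
  have h1 : ‖M w * Sop N X * M w'‖ ≤ B ^ 2 * ‖Y‖ :=
    (norm_mul_le_of_le (norm_mul_le_of_le hMw hS) hMw').trans_eq (by ring)
  rw [e]
  refine (norm_add_le _ _).trans (h.add_le (n := 0) ?_ h1 (by norm_num) le_rfl (norm_nonneg _))
  rw [pow_zero, one_mul]

theorem norm_sop_le_mul (X : Mat2 N) : ‖Sop N X‖ ≤ B * ‖X‖ := by
  refine (norm_sop_le_two X).trans ?_
  have := h.two_le
  gcongr

include hM2 hw₁ hw₂ hA₁ hl in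
theorem norm_chain2_le_of_one_le (hη₁ : 1 ≤ |w₁.im|) (h₁ : ‖M w₁‖ ≤ l) (h₂ : ‖M w₂‖ ≤ l) :
    ‖M2 w₁ A₁ w₂‖ ≤ B ^ 5 * l ^ 2 := by
  have hB := h.pos
  have hX := hM2 w₁ w₂ (h.im_ne _ hw₁) (h.im_ne _ hw₂) A₁
  have h3 := h.norm_chain_le_of_one_le hw₁ hw₂ hη₁ (h₁.trans hl) (h₂.trans hl) hX
  have h4 := h.pow_mono (n := 4) (m := 5) (by norm_num)
  calc _ ≤ _ := h3
    _ ≤ B ^ 3 * (l * B * l) := by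
      gcongr
      exact norm_mul_le_of_le (norm_mul_le_of_le h₁ hA₁) h₂
    _ = B ^ 4 * l ^ 2 := by ring
    _ ≤ B ^ 5 * l ^ 2 := by gcongr

include hM2 hw₁ hw₂ hA₁ hl in
theorem norm_dressed_le_of_one_le (hη₁ : 1 ≤ |w₁.im|) (h₁ : ‖M w₁‖ ≤ l) (h₂ : ‖M w₂‖ ≤ l) :
    ‖A₁ + Sop N (M2 w₁ A₁ w₂)‖ ≤ B ^ 7 := by
  have hB := h.pos
  have hl0 : 0 ≤ l := (norm_nonneg _).trans h₁
  have h3 := h.norm_chain2_le_of_one_le hM2 hw₁ hw₂ hA₁ hl hη₁ h₁ h₂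
  have h4 : ‖Sop N (M2 w₁ A₁ w₂)‖ ≤ B ^ 6 * 1 := by
    calc _ ≤ _ := h.norm_sop_le_mul _
      _ ≤ B * (B ^ 5 * 1 ^ 2) := by
        gcongr
        exact h3.trans (by gcongr)
      _ = _ := by ring
  have h5 := (norm_add_le A₁ (Sop N (M2 w₁ A₁ w₂))).trans
    (h.add_le (n := 1) (m := 7) (z := 1) (by simpa using hA₁) h4 (by norm_num) le_rfl
      zero_le_one)
  linarith

include hM2 hM3 hw₁ hw₂ hw₃ hA₁ hA₂ hl in
theorem norm_chain3_le_of_one_le (hη₁ : 1 ≤ |w₁.im|) (hη₂ : 1 ≤ |w₂.im|) (h₁ : ‖M w₁‖ ≤ l)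
    (h₂ : ‖M w₂‖ ≤ l) (h₃ : ‖M w₃‖ ≤ l) : ‖M3 w₁ A₁ w₂ A₂ w₃‖ ≤ B ^ 15 * l ^ 3 := by
  have hB := h.pos
  have hX := hM3.eq (h.im_ne _ hw₁) (h.im_ne _ hw₂) (h.im_ne _ hw₃) A₁ A₂
  have b1 := h.norm_dressed_le_of_one_le hM2 hw₁ hw₂ hA₁ hl hη₁ h₁ h₂
  have b2 := h.norm_chain2_le_of_one_le hM2 hw₂ hw₃ hA₂ hl hη₂ h₂ h₃
  calc _ ≤ _ := h.norm_chain_le_of_one_le hw₁ hw₃ hη₁ (h₁.trans hl) (h₃.trans hl) hX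
    _ ≤ B ^ 3 * (l * B ^ 7 * (B ^ 5 * l ^ 2)) := by
      gcongr
      exact norm_mul_le_of_le (norm_mul_le_of_le h₁ b1) b2
    _ = _ := by ring

include hM2 hM3 hM4 hw₁ hw₂ hw₃ hw₄ hA₁ hA₂ hA₃ hl in
theorem norm_chain4_le_of_one_le (hη₁ : 1 ≤ |w₁.im|) (hη₂ : 1 ≤ |w₂.im|) (hη₃ : 1 ≤ |w₃.im|)
    (h₁ : ‖M w₁‖ ≤ l) (h₂ : ‖M w₂‖ ≤ l) (h₃ : ‖M w₃‖ ≤ l) (h₄ : ‖M w₄‖ ≤ l) :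
    ‖M4 w₁ A₁ w₂ A₂ w₃ A₃ w₄‖ ≤ B ^ 26 * l ^ 4 := by
  have hB := h.pos
  have hl0 : 0 ≤ l := (norm_nonneg _).trans h₁
  have hX := hM4.eq (h.im_ne _ hw₁) (h.im_ne _ hw₂) (h.im_ne _ hw₃) (h.im_ne _ hw₄) A₁ A₂ A₃
  have b1 := h.norm_dressed_le_of_one_le hM2 hw₁ hw₂ hA₁ hl hη₁ h₁ h₂
  have b2 := h.norm_chain3_le_of_one_le hM2 hM3 hw₂ hw₃ hw₄ hA₂ hA₃ hl hη₂ hη₃ h₂ h₃ h₄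
  have b3 := h.norm_chain2_le_of_one_le hM2 hw₃ hw₄ hA₃ hl hη₃ h₃ h₄
  have b4 := h.norm_chain3_le_of_one_le hM2 hM3 hw₁ hw₂ hw₃ hA₁ hA₂ hl hη₁ hη₂ h₁ h₂ h₃
  have b5 : ‖Sop N (M3 w₁ A₁ w₂ A₂ w₃)‖ ≤ B * (B ^ 15 * l ^ 3) :=
    (h.norm_sop_le_mul _).trans (by gcongr)
  have c1 := (norm_mul_le_of_le (norm_mul_le_of_le h₁ b1) b2).trans_eq
    (show _ = B ^ 22 * l ^ 4 by ring)
  have c2 := (norm_mul_le_of_le (norm_mul_le_of_le h₁ b5) b3).trans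
    (show _ ≤ B ^ 21 * l ^ 4 by
      calc _ = B ^ 21 * l ^ 4 * l ^ 2 := by ring
        _ ≤ B ^ 21 * l ^ 4 * 1 ^ 2 := by gcongr
        _ = _ := by ring)
  calc _ ≤ _ := h.norm_chain_le_of_one_le hw₁ hw₄ hη₁ (h₁.trans hl) (h₄.trans hl) hX
    _ ≤ B ^ 3 * (B ^ 23 * l ^ 4) := by
      gcongr
      exact (norm_add_le _ _).trans (h.add_le c1 c2 (by norm_num) (by norm_num) (by positivity))
    _ = _ := by ring

include hM2 hM3 hM4 hM5 hw₁ hw₂ hw₃ hw₄ hw₅ hA₁ hA₂ hA₃ hA₄ hl in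
theorem norm_chain5_le_of_one_le (hη₁ : 1 ≤ |w₁.im|) (hη₂ : 1 ≤ |w₂.im|) (hη₃ : 1 ≤ |w₃.im|)
    (hη₄ : 1 ≤ |w₄.im|) (h₁ : ‖M w₁‖ ≤ l) (h₂ : ‖M w₂‖ ≤ l) (h₃ : ‖M w₃‖ ≤ l)
    (h₄ : ‖M w₄‖ ≤ l) (h₅ : ‖M w₅‖ ≤ l) :
    ‖M5 w₁ A₁ w₂ A₂ w₃ A₃ w₄ A₄ w₅‖ ≤ B ^ 38 * l ^ 5 := by
  have hB := h.pos
  have hl0 : 0 ≤ l := (norm_nonneg _).trans h₁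
  have hX := hM5.eq (h.im_ne _ hw₁) (h.im_ne _ hw₂) (h.im_ne _ hw₃) (h.im_ne _ hw₄)
    (h.im_ne _ hw₅) A₁ A₂ A₃ A₄
  have b1 := h.norm_dressed_le_of_one_le hM2 hw₁ hw₂ hA₁ hl hη₁ h₁ h₂
  have b2 := h.norm_chain4_le_of_one_le hM2 hM3 hM4 hw₂ hw₃ hw₄ hw₅ hA₂ hA₃ hA₄ hl hη₂ hη₃ hη₄
    h₂ h₃ h₄ h₅
  have b3 := h.norm_chain3_le_of_one_le hM2 hM3 hw₃ hw₄ hw₅ hA₃ hA₄ hl hη₃ hη₄ h₃ h₄ h₅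
  have b4 := h.norm_chain2_le_of_one_le hM2 hw₄ hw₅ hA₄ hl hη₄ h₄ h₅
  have b5 : ‖Sop N (M3 w₁ A₁ w₂ A₂ w₃)‖ ≤ B * (B ^ 15 * l ^ 3) :=
    (h.norm_sop_le_mul _).trans (by
      gcongr
      exact h.norm_chain3_le_of_one_le hM2 hM3 hw₁ hw₂ hw₃ hA₁ hA₂ hl hη₁ hη₂ h₁ h₂ h₃)
  have b6 : ‖Sop N (M4 w₁ A₁ w₂ A₂ w₃ A₃ w₄)‖ ≤ B * (B ^ 26 * l ^ 4) :=
    (h.norm_sop_le_mul _).trans (by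
      gcongr
      exact h.norm_chain4_le_of_one_le hM2 hM3 hM4 hw₁ hw₂ hw₃ hw₄ hA₁ hA₂ hA₃ hl hη₁ hη₂ hη₃
        h₁ h₂ h₃ h₄)
  have c1 := (norm_mul_le_of_le (norm_mul_le_of_le h₁ b1) b2).trans_eq
    (show _ = B ^ 33 * l ^ 5 by ring)
  have hp : l ^ 2 ≤ 1 := pow_le_one₀ hl0 hl
  have c2 := (norm_mul_le_of_le (norm_mul_le_of_le h₁ b5) b3).trans
    (show _ ≤ B ^ 33 * l ^ 5 by
      calc _ = B ^ 31 * l ^ 5 * l ^ 2 := by ring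
        _ ≤ B ^ 33 * l ^ 5 * 1 := by
          have := h.pow_mono (n := 31) (m := 33) (by norm_num)
          gcongr
        _ = _ := by ring)
  have c3 := (norm_mul_le_of_le (norm_mul_le_of_le h₁ b6) b4).trans
    (show _ ≤ B ^ 33 * l ^ 5 by
      calc _ = B ^ 32 * l ^ 5 * l ^ 2 := by ring
        _ ≤ B ^ 33 * l ^ 5 * 1 := by
          have := h.pow_mono (n := 32) (m := 33) (by norm_num)
          gcongr
        _ = _ := by ring)
  calc _ ≤ _ := h.norm_chain_le_of_one_le hw₁ hw₅ hη₁ (h₁.trans hl) (h₅.trans hl) hX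
    _ ≤ B ^ 3 * (B ^ 35 * l ^ 5) := by
      gcongr
      exact norm_add₃_le.trans (h.add_le_add_three c1 c2 c3 le_rfl (by positivity))
    _ = _ := by ring

end Large

end ChainCtx

theorem norm_ntr_mul_le_of_le {N : ℕ} {B : ℝ} {X A : Mat2 N} {c : ℝ} {n : ℕ} (hX : ‖X‖ ≤ B ^ n * c)
    (hA : ‖A‖ ≤ B) : ‖ntr (X * A)‖ ≤ B ^ (n + 1) * c :=
  ((norm_ntr_le _).trans (norm_mul_le_of_le hX hA)).trans_eq (by ring)

namespace ChainCtx

variable {N : ℕ} {M : ℂ → Mat2 N} {G : Set ℂ} {B d : ℝ} (h : ChainCtx M G B d)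
  {M2 : ℂ → Mat2 N → ℂ → Mat2 N}
  {M3 : ℂ → Mat2 N → ℂ → Mat2 N → ℂ → Mat2 N}
  {M4 : ℂ → Mat2 N → ℂ → Mat2 N → ℂ → Mat2 N → ℂ → Mat2 N}
  {M5 : ℂ → Mat2 N → ℂ → Mat2 N → ℂ → Mat2 N → ℂ → Mat2 N → ℂ → Mat2 N}
  (hM2 : IsChain2 N M M2) (hM3 : IsChain3 N M M2 M3) (hM4 : IsChain4 N M M2 M3 M4)
  (hM5 : IsChain5 N M M2 M3 M4 M5)
  {w₁ w₂ w₃ w₄ w₅ : ℂ} (hw₁ : w₁ ∈ G) (hw₂ : w₂ ∈ G) (hw₃ : w₃ ∈ G) (hw₄ : w₄ ∈ G)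
  (hw₅ : w₅ ∈ G) {A₁ A₂ A₃ A₄ : Mat2 N} (hA₁ : ‖A₁‖ ≤ B) (hA₂ : ‖A₂‖ ≤ B) (hA₃ : ‖A₃‖ ≤ B)
  (hA₄ : ‖A₄‖ ≤ B)
include h

theorem norm_le_inv_of_le {w : ℂ} {η : ℝ} (hw : w ∈ G) (h0 : 0 < η) (hη : η ≤ |w.im|) :
    ‖M w‖ ≤ η⁻¹ :=
  (h.norm_le_inv w hw).trans (by gcongr)

theorem le_mul_ite {x η X Y : ℝ} {n m : ℕ} (hn : n ≤ 60) (hm : m ≤ 60) (hX0 : 0 ≤ X)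
    (hY0 : 0 ≤ Y) (hX : η ≤ 1 → x ≤ B ^ n * X) (hY : 1 ≤ η → x ≤ B ^ m * Y) :
    x ≤ B ^ 60 * (if η ≤ 1 then X else Y) := by
  have h1 := h.pow_mono hn
  have h2 := h.pow_mono hm
  split_ifs with hη
  · exact (hX hη).trans (by gcongr)
  · exact (hY (not_le.1 hη).le).trans (by gcongr)

variable {η : ℝ} (h0 : 0 < η) (h₁ : η ≤ |w₁.im|) (h₂ : η ≤ |w₂.im|) (h₃ : η ≤ |w₃.im|)
  (h₄ : η ≤ |w₄.im|) (h₅ : η ≤ |w₅.im|)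

include hw₁ hA₁ h0 h₁ in
theorem chain1_trace_bound :
    ‖ntr (M w₁ * A₁)‖ ≤ B ^ 60 * (if η ≤ 1 then 1 else η ^ (-(1 : ℝ))) := by
  rw [Real.rpow_neg_one]
  refine h.le_mul_ite (n := 2) (m := 1) (by norm_num) (by norm_num) zero_le_one
    (inv_nonneg.2 h0.le) (fun _ => ?_) (fun _ => ?_)
  · exact norm_ntr_mul_le_of_le (n := 1) (by simpa using h.norm_le w₁ hw₁) hA₁
  · exact norm_ntr_mul_le_of_le (n := 0)
      (by simpa using h.norm_le_inv_of_le hw₁ h0 h₁) hA₁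

include hM2 hw₁ hw₂ hA₁ h0 h₁ h₂ in
theorem chain2_bound (R₁ : Reg M d w₁ w₂ A₁) :
    ‖M2 w₁ A₁ w₂‖ ≤ B ^ 60 * (if η ≤ 1 then 1 else η ^ (-(2 : ℝ))) := by
  rw [Real.rpow_neg h0.le, Real.rpow_ofNat, ← inv_pow]
  refine h.le_mul_ite (n := 9) (m := 5) (by norm_num) (by norm_num) zero_le_one
    (by positivity) (fun _ => ?_) (fun hη => ?_)
  · rw [mul_one]
    exact h.norm_chain2_le hM2 hw₁ hw₂ hA₁ R₁
  · exact h.norm_chain2_le_of_one_le hM2 hw₁ hw₂ hA₁ (inv_le_one_of_one_le₀ hη) (hη.trans h₁)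
      (h.norm_le_inv_of_le hw₁ h0 h₁) (h.norm_le_inv_of_le hw₂ h0 h₂)

include hM2 hw₁ hw₂ hA₁ hA₂ h0 h₁ h₂ in
theorem chain2_trace_bound (R₁ : Reg M d w₁ w₂ A₁) :
    ‖ntr (M2 w₁ A₁ w₂ * A₂)‖ ≤ B ^ 60 * (if η ≤ 1 then 1 else η ^ (-(2 : ℝ))) := by
  rw [Real.rpow_neg h0.le, Real.rpow_ofNat, ← inv_pow]
  refine h.le_mul_ite (n := 10) (m := 6) (by norm_num) (by norm_num) zero_le_one
    (by positivity) (fun _ => ?_) (fun hη => ?_)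
  · exact norm_ntr_mul_le_of_le (by simpa using h.norm_chain2_le hM2 hw₁ hw₂ hA₁ R₁) hA₂
  · exact norm_ntr_mul_le_of_le (h.norm_chain2_le_of_one_le hM2 hw₁ hw₂ hA₁
      (inv_le_one_of_one_le₀ hη) (hη.trans h₁) (h.norm_le_inv_of_le hw₁ h0 h₁)
      (h.norm_le_inv_of_le hw₂ h0 h₂)) hA₂

include hM2 hM3 hw₁ hw₂ hw₃ hA₁ hA₂ h0 h₁ h₂ h₃ in
theorem chain3_bound (R₁ : Reg M d w₁ w₂ A₁) (R₂ : Reg M d w₂ w₃ A₂) :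
    ‖M3 w₁ A₁ w₂ A₂ w₃‖ ≤
      B ^ 60 * (if η ≤ 1 then η ^ (-(1 : ℝ)) else η ^ (-(3 : ℝ))) := by
  have hB := h.pos
  rw [Real.rpow_neg_one, Real.rpow_neg h0.le, Real.rpow_ofNat, ← inv_pow]
  refine h.le_mul_ite (n := 22) (m := 15) (by norm_num) (by norm_num)
    (by positivity) (by positivity) (fun hη => ?_) (fun hη => ?_)
  · refine (h.norm_chain3_le hM2 hM3 hw₁ hw₂ hw₃ hA₁ hA₂ R₁ R₂).trans ?_
    gcongr
    exact iw_le h0 hη h₁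
  · exact h.norm_chain3_le_of_one_le hM2 hM3 hw₁ hw₂ hw₃ hA₁ hA₂ (inv_le_one_of_one_le₀ hη)
      (hη.trans h₁) (hη.trans h₂) (h.norm_le_inv_of_le hw₁ h0 h₁)
      (h.norm_le_inv_of_le hw₂ h0 h₂) (h.norm_le_inv_of_le hw₃ h0 h₃)

include hM2 hM3 hw₁ hw₂ hw₃ hA₁ hA₂ hA₃ h0 h₁ h₂ h₃ in
theorem chain3_trace_bound (R₁ : Reg M d w₁ w₂ A₁) (R₂ : Reg M d w₂ w₃ A₂)
    (R₃ : Reg M d w₃ w₁ A₃) :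
    ‖ntr (M3 w₁ A₁ w₂ A₂ w₃ * A₃)‖ ≤ B ^ 60 * (if η ≤ 1 then 1 else η ^ (-(3 : ℝ))) := by
  rw [Real.rpow_neg h0.le, Real.rpow_ofNat, ← inv_pow]
  refine h.le_mul_ite (n := 24) (m := 16) (by norm_num) (by norm_num) zero_le_one
    (by positivity) (fun _ => ?_) (fun hη => ?_)
  · rw [mul_one]
    exact h.norm_ntr_chain3_le hM2 hM3 hw₁ hw₂ hw₃ hA₁ hA₂ hA₃ R₁ R₂ R₃
  · exact norm_ntr_mul_le_of_le (h.norm_chain3_le_of_one_le hM2 hM3 hw₁ hw₂ hw₃ hA₁ hA₂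
      (inv_le_one_of_one_le₀ hη) (hη.trans h₁) (hη.trans h₂) (h.norm_le_inv_of_le hw₁ h0 h₁)
      (h.norm_le_inv_of_le hw₂ h0 h₂) (h.norm_le_inv_of_le hw₃ h0 h₃)) hA₃

section Four

variable (R₁ : Reg M d w₁ w₂ A₁) (R₂ : Reg M d w₂ w₃ A₂) (R₃ : Reg M d w₃ w₄ A₃)
include hM2 hM3 hM4 hw₁ hw₂ hw₃ hw₄ hA₁ hA₂ hA₃ h0 h₁ h₂

include R₁ R₂ R₃ in
theorem norm_chain4_le_inv (hη : η ≤ 1) : ‖M4 w₁ A₁ w₂ A₂ w₃ A₃ w₄‖ ≤ B ^ 38 * η⁻¹ :=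
  (h.norm_chain4_le hM2 hM3 hM4 hw₁ hw₂ hw₃ hw₄ hA₁ hA₂ hA₃ R₁ R₂ R₃ (iw_le h0 hη h₁)
    (iw_le h0 hη h₂) (iw_le h0 hη h₁)).2

include h₃ h₄ in
theorem norm_chain4_le_inv_pow (hη : 1 ≤ η) :
    ‖M4 w₁ A₁ w₂ A₂ w₃ A₃ w₄‖ ≤ B ^ 26 * η⁻¹ ^ 4 :=
  h.norm_chain4_le_of_one_le hM2 hM3 hM4 hw₁ hw₂ hw₃ hw₄ hA₁ hA₂ hA₃
    (inv_le_one_of_one_le₀ hη) (hη.trans h₁) (hη.trans h₂) (hη.trans h₃)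
    (h.norm_le_inv_of_le hw₁ h0 h₁) (h.norm_le_inv_of_le hw₂ h0 h₂)
    (h.norm_le_inv_of_le hw₃ h0 h₃) (h.norm_le_inv_of_le hw₄ h0 h₄)

include R₁ R₂ R₃ h₃ h₄ in
theorem chain4_bound :
    ‖M4 w₁ A₁ w₂ A₂ w₃ A₃ w₄‖ ≤
      B ^ 60 * (if η ≤ 1 then η ^ (-(1 : ℝ)) else η ^ (-(4 : ℝ))) := by
  rw [Real.rpow_neg_one, Real.rpow_neg h0.le, Real.rpow_ofNat, ← inv_pow]
  exact h.le_mul_ite (by norm_num) (by norm_num) (by positivity) (by positivity)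
    (h.norm_chain4_le_inv hM2 hM3 hM4 hw₁ hw₂ hw₃ hw₄ hA₁ hA₂ hA₃ h0 h₁ h₂ R₁ R₂ R₃)
    (h.norm_chain4_le_inv_pow hM2 hM3 hM4 hw₁ hw₂ hw₃ hw₄ hA₁ hA₂ hA₃ h0 h₁ h₂ h₃ h₄)

include R₁ R₂ R₃ h₃ h₄ hA₄ in
theorem chain4_trace_bound :
    ‖ntr (M4 w₁ A₁ w₂ A₂ w₃ A₃ w₄ * A₄)‖ ≤
      B ^ 60 * (if η ≤ 1 then η ^ (-(1 : ℝ)) else η ^ (-(4 : ℝ))) := by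
  rw [Real.rpow_neg_one, Real.rpow_neg h0.le, Real.rpow_ofNat, ← inv_pow]
  exact h.le_mul_ite (n := 39) (m := 27) (by norm_num) (by norm_num) (by positivity)
    (by positivity)
    (fun hη => norm_ntr_mul_le_of_le (h.norm_chain4_le_inv hM2 hM3 hM4 hw₁ hw₂ hw₃ hw₄ hA₁ hA₂
      hA₃ h0 h₁ h₂ R₁ R₂ R₃ hη) hA₄)
    (fun hη => norm_ntr_mul_le_of_le (h.norm_chain4_le_inv_pow hM2 hM3 hM4 hw₁ hw₂ hw₃ hw₄ hA₁
      hA₂ hA₃ h0 h₁ h₂ h₃ h₄ hη) hA₄)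

end Four

include hM2 hM3 hM4 hM5 hw₁ hw₂ hw₃ hw₄ hw₅ hA₁ hA₂ hA₃ hA₄ h0 h₁ h₂ h₃ h₄ h₅ in
theorem chain5_bound (R₁ : Reg M d w₁ w₂ A₁) (R₂ : Reg M d w₂ w₃ A₂)
    (R₃ : Reg M d w₃ w₄ A₃) (R₄ : Reg M d w₄ w₅ A₄) :
    ‖M5 w₁ A₁ w₂ A₂ w₃ A₃ w₄ A₄ w₅‖ ≤
      B ^ 60 * (if η ≤ 1 then η ^ (-(2 : ℝ)) else η ^ (-(5 : ℝ))) := by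
  rw [Real.rpow_neg h0.le, Real.rpow_neg h0.le, Real.rpow_ofNat, Real.rpow_ofNat, ← inv_pow,
    ← inv_pow]
  refine h.le_mul_ite (n := 55) (m := 38) (by norm_num) (by norm_num)
    (by positivity) (by positivity) (fun hη => ?_) (fun hη => ?_)
  · exact h.norm_chain5_le hM2 hM3 hM4 hM5 hw₁ hw₂ hw₃ hw₄ hw₅ hA₁ hA₂ hA₃ hA₄ R₁ R₂ R₃ R₄
      (iw_le h0 hη h₁) (iw_le h0 hη h₂) (iw_le h0 hη h₃) (iw_le h0 hη h₁) (iw_le h0 hη h₂)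
      (iw_le h0 hη h₁)
  · exact h.norm_chain5_le_of_one_le hM2 hM3 hM4 hM5 hw₁ hw₂ hw₃ hw₄ hw₅ hA₁ hA₂ hA₃ hA₄
      (inv_le_one_of_one_le₀ hη) (hη.trans h₁) (hη.trans h₂) (hη.trans h₃) (hη.trans h₄)
      (h.norm_le_inv_of_le hw₁ h0 h₁) (h.norm_le_inv_of_le hw₂ h0 h₂)
      (h.norm_le_inv_of_le hw₃ h0 h₃) (h.norm_le_inv_of_le hw₄ h0 h₄)
      (h.norm_le_inv_of_le hw₅ h0 h₅)

end ChainCtx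

/-- The spectral parameters off the real axis whose density is at least `r`. -/
def bulkSet (ρ : ℝ → ℝ) (r : ℝ) : Set ℂ := {w | w.im ≠ 0 ∧ r ≤ ρ w.re}

theorem isBulk_of_tendsto {N : ℕ} (hN : N ≠ 0) {Λ : Matrix (Fin N) (Fin N) ℂ} {M : ℂ → Mat2 N}
    (hM : IsMDESolution N Λ M) {e c : ℝ} {m : ℂ}
    (hm : Tendsto (fun η : ℝ => ntr (M ((e : ℂ) + (η : ℂ) * Complex.I)))
      (𝓝[>] 0) (𝓝 m)) (hc : c < m.im) : IsBulk (herm Λ) c e := by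
  intro ε₀ hε₀
  have h1 : ∀ᶠ η : ℝ in 𝓝[>] 0, c < (ntr (M ((e : ℂ) + (η : ℂ) * Complex.I))).im :=
    ((Complex.continuous_im.tendsto m).comp hm).eventually (lt_mem_nhds hc)
  have h2 : ∀ᶠ η : ℝ in 𝓝[>] 0, η ∈ Set.Ioo 0 ε₀ := Ioo_mem_nhdsGT hε₀
  obtain ⟨ε, hε, h3, h4⟩ := (h1.and h2).exists
  have him : ((e : ℂ) + (ε : ℂ) * Complex.I).im ≠ 0 := by simpa using h3.ne'
  refine ⟨ε, h3, h4, _, hM.isSol hN him, ?_⟩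
  rw [← hM.eq_resv him]
  exact hε.le

theorem density_eq_zero {M : ℂ → Mat2 0} {e : ℝ} {m : ℂ}
    (hm : Tendsto (fun η : ℝ => ntr (M ((e : ℂ) + (η : ℂ) * Complex.I)))
      (𝓝[>] 0) (𝓝 m)) : m = 0 := by
  refine tendsto_nhds_unique hm ?_
  simp [ntr]

theorem exists_chainStab (CΛ κ : ℝ) (hκ : 0 < κ) : ∃ K : ℝ, 1 ≤ K ∧
    ∀ N : ℕ, N ≠ 0 → ∀ (Λ : Matrix (Fin N) (Fin N) ℂ), opNorm Λ ≤ CΛ →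
    ∀ M : ℂ → Mat2 N, IsMDESolution N Λ M → ∀ (mB : ℝ → ℂ) (ρ : ℝ → ℝ),
    (∀ e : ℝ, Tendsto (fun η : ℝ => ntr (M ((e : ℂ) + (η : ℂ) * Complex.I)))
      (𝓝[>] 0) (𝓝 (mB e))) →
    (∀ e, ρ e = (mB e).im / Real.pi) →
    ChainStab M (bulkSet ρ (κ ^ ((1 : ℝ) / 3))) K := by
  set L := |CΛ|
  set c := Real.pi * κ ^ ((1 : ℝ) / 3) / 2 with hc_def
  have hr : 0 < κ ^ ((1 : ℝ) / 3) := Real.rpow_pos_of_pos hκ _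
  have hc : 0 < c := by positivity
  have hL : 0 ≤ L := abs_nonneg _
  have ha := bulkIm_pos hL hc
  have hR := bulkRadius_pos hL hc
  have hK₀ : 0 < L + bulkRadius L c + 2 := by positivity
  refine ⟨1 + (bulkIm L c)⁻¹ + 4 * (L + bulkRadius L c + 2) ^ 4 / bulkIm L c ^ 2 +
    8 * (L + bulkRadius L c + 2) ^ 4 / bulkIm L c ^ 4, ?_, ?_⟩
  · have : 0 < (bulkIm L c)⁻¹ := by positivity
    have : 0 < 4 * (L + bulkRadius L c + 2) ^ 4 / bulkIm L c ^ 2 := by positivity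
    have : 0 < 8 * (L + bulkRadius L c + 2) ^ 4 / bulkIm L c ^ 4 := by positivity
    linarith
  intro N hN Λ hΛ M hM mB ρ hm hρ
  have : Nonempty (Fin N) := ⟨⟨0, Nat.pos_of_ne_zero hN⟩⟩
  have hH := herm_conjTranspose Λ
  have hHL : ‖herm Λ‖ ≤ L := (norm_herm_le Λ).trans (hΛ.trans (le_abs_self _))
  have hb : ∀ w ∈ bulkSet ρ (κ ^ ((1 : ℝ) / 3)), IsBulk (herm Λ) c w.re := by
    rintro w ⟨-, hw⟩
    refine isBulk_of_tendsto hN hM (hm w.re) ?_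
    rw [hρ, le_div_iff₀ Real.pi_pos] at hw
    have : 0 < Real.pi * κ ^ ((1 : ℝ) / 3) := by positivity
    rw [hc_def]
    linarith
  refine chainStab_of_isGood hN ha (min_le_left _ _) hK₀ (fun w hw => ?_)
    (U := fun w => w + ntr (M w)) (fun w hw => hM.eq_resv hw.1) (fun w hw => ?_)
  · exact ⟨by simpa using hw.1, by simpa using hw.2⟩
  · have hs := hM.isSol hN hw.1
    refine ⟨hs, (hb w hw).im_ge hH hHL hc hs, ?_⟩
    have := (hb w hw).abs_le hH hHL hc
    linarith

end ChainBounds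

/-- **Bounds on the deterministic approximations with regular observables**
(Lemma 4.3), for chain length `k ∈ [4]`: operator-norm bounds on
`M(w₁,A₁,…,A_k,w_{k+1})` and bounds on the traces `⟨M(w₁,A₁,…,A_{k−1},w_k)A_k⟩`,
where each `A_i` is `(w_i,w_{i+1})`-regular (cyclically for the traces). -/
theorem deterministic_chain_bounds
    -- the bounded deterministic deformations Λ
    (Λ : (N : ℕ) → Matrix (Fin N) (Fin N) ℂ)
    (CΛ : ℝ) (hΛ : ∀ N, opNorm (Λ N) ≤ CΛ)
    -- the N-independent bulk parameter κ
    (κ : ℝ) (hκ : 0 < κ)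
    -- the solution M of the Matrix Dyson Equation and the scDos ρ
    (M : (N : ℕ) → ℂ → Mat2 N) (hM : ∀ N, IsMDESolution N (Λ N) (M N))
    (mB : (N : ℕ) → ℝ → ℂ)
    (hmB : ∀ (N : ℕ) (e : ℝ),
      Tendsto (fun η : ℝ => ntr (M N ((e : ℂ) + (η : ℂ) * Complex.I)))
        (nhdsWithin 0 (Set.Ioi 0)) (nhds (mB N e)))
    (ρ : (N : ℕ) → ℝ → ℝ) (hρ : ∀ N e, ρ N e = (mB N e).im / Real.pi)
    -- the deterministic approximations to chains of 2,…,5 resolvents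
    (M2 : (N : ℕ) → ℂ → Mat2 N → ℂ → Mat2 N)
    (hM2 : ∀ N, IsChain2 N (M N) (M2 N))
    (M3 : (N : ℕ) → ℂ → Mat2 N → ℂ → Mat2 N → ℂ → Mat2 N)
    (hM3 : ∀ N, IsChain3 N (M N) (M2 N) (M3 N))
    (M4 : (N : ℕ) → ℂ → Mat2 N → ℂ → Mat2 N → ℂ → Mat2 N → ℂ → Mat2 N)
    (hM4 : ∀ N, IsChain4 N (M N) (M2 N) (M3 N) (M4 N))
    (M5 : (N : ℕ) → ℂ → Mat2 N → ℂ → Mat2 N → ℂ → Mat2 N → ℂ → Mat2 N → ℂ → Mat2 N)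
    (hM5 : ∀ N, IsChain5 N (M N) (M2 N) (M3 N) (M4 N) (M5 N))
    -- the uniform bound on the observables
    (CA : ℝ) :
    ∃ δ₀ : ℝ, 0 < δ₀ ∧ ∀ δ : ℝ, 0 < δ → δ ≤ δ₀ → ∀ φ : ℝ → ℝ, IsBump δ φ →
    ∃ C : ℝ, 0 < C ∧ ∀ N : ℕ,
      -- k = 1
      (∀ w₁ w₂ : ℂ, w₁.im ≠ 0 → w₂.im ≠ 0 →
        κ ^ ((1 : ℝ)/3) ≤ ρ N w₁.re → κ ^ ((1 : ℝ)/3) ≤ ρ N w₂.re →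
        ∀ A₁ : Mat2 N, opNorm A₁ ≤ CA →
          (IsRegularObs N (M N) φ w₁ w₂ A₁ →
            opNorm (M2 N w₁ A₁ w₂) ≤
              C * (if min |w₁.im| |w₂.im| ≤ 1 then 1
                else (min |w₁.im| |w₂.im|) ^ (-(2 : ℝ)))) ∧
          (IsRegularObs N (M N) φ w₁ w₁ A₁ →
            ‖ntr (M N w₁ * A₁)‖ ≤
              C * (if |w₁.im| ≤ 1 then 1 else |w₁.im| ^ (-(1 : ℝ))))) ∧
      -- k = 2
      (∀ w₁ w₂ w₃ : ℂ, w₁.im ≠ 0 → w₂.im ≠ 0 → w₃.im ≠ 0 →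
        κ ^ ((1 : ℝ)/3) ≤ ρ N w₁.re → κ ^ ((1 : ℝ)/3) ≤ ρ N w₂.re →
        κ ^ ((1 : ℝ)/3) ≤ ρ N w₃.re →
        ∀ A₁ A₂ : Mat2 N, opNorm A₁ ≤ CA → opNorm A₂ ≤ CA →
          (IsRegularObs N (M N) φ w₁ w₂ A₁ → IsRegularObs N (M N) φ w₂ w₃ A₂ →
            opNorm (M3 N w₁ A₁ w₂ A₂ w₃) ≤
              C * (if min |w₁.im| (min |w₂.im| |w₃.im|) ≤ 1 then
                  (min |w₁.im| (min |w₂.im| |w₃.im|)) ^ (-(1 : ℝ))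
                else (min |w₁.im| (min |w₂.im| |w₃.im|)) ^ (-(3 : ℝ)))) ∧
          (IsRegularObs N (M N) φ w₁ w₂ A₁ → IsRegularObs N (M N) φ w₂ w₁ A₂ →
            ‖ntr (M2 N w₁ A₁ w₂ * A₂)‖ ≤
              C * (if min |w₁.im| |w₂.im| ≤ 1 then 1
                else (min |w₁.im| |w₂.im|) ^ (-(2 : ℝ))))) ∧
      -- k = 3
      (∀ w₁ w₂ w₃ w₄ : ℂ, w₁.im ≠ 0 → w₂.im ≠ 0 → w₃.im ≠ 0 → w₄.im ≠ 0 →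
        κ ^ ((1 : ℝ)/3) ≤ ρ N w₁.re → κ ^ ((1 : ℝ)/3) ≤ ρ N w₂.re →
        κ ^ ((1 : ℝ)/3) ≤ ρ N w₃.re → κ ^ ((1 : ℝ)/3) ≤ ρ N w₄.re →
        ∀ A₁ A₂ A₃ : Mat2 N, opNorm A₁ ≤ CA → opNorm A₂ ≤ CA → opNorm A₃ ≤ CA →
          (IsRegularObs N (M N) φ w₁ w₂ A₁ → IsRegularObs N (M N) φ w₂ w₃ A₂ →
            IsRegularObs N (M N) φ w₃ w₄ A₃ →
            opNorm (M4 N w₁ A₁ w₂ A₂ w₃ A₃ w₄) ≤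
              C * (if min |w₁.im| (min |w₂.im| (min |w₃.im| |w₄.im|)) ≤ 1 then
                  (min |w₁.im| (min |w₂.im| (min |w₃.im| |w₄.im|))) ^ (-(1 : ℝ))
                else (min |w₁.im| (min |w₂.im| (min |w₃.im| |w₄.im|))) ^ (-(4 : ℝ)))) ∧
          (IsRegularObs N (M N) φ w₁ w₂ A₁ → IsRegularObs N (M N) φ w₂ w₃ A₂ →
            IsRegularObs N (M N) φ w₃ w₁ A₃ →
            ‖ntr (M3 N w₁ A₁ w₂ A₂ w₃ * A₃)‖ ≤
              C * (if min |w₁.im| (min |w₂.im| |w₃.im|) ≤ 1 then 1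
                else (min |w₁.im| (min |w₂.im| |w₃.im|)) ^ (-(3 : ℝ))))) ∧
      -- k = 4
      (∀ w₁ w₂ w₃ w₄ w₅ : ℂ,
        w₁.im ≠ 0 → w₂.im ≠ 0 → w₃.im ≠ 0 → w₄.im ≠ 0 → w₅.im ≠ 0 →
        κ ^ ((1 : ℝ)/3) ≤ ρ N w₁.re → κ ^ ((1 : ℝ)/3) ≤ ρ N w₂.re →
        κ ^ ((1 : ℝ)/3) ≤ ρ N w₃.re → κ ^ ((1 : ℝ)/3) ≤ ρ N w₄.re →
        κ ^ ((1 : ℝ)/3) ≤ ρ N w₅.re →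
        ∀ A₁ A₂ A₃ A₄ : Mat2 N,
          opNorm A₁ ≤ CA → opNorm A₂ ≤ CA → opNorm A₃ ≤ CA → opNorm A₄ ≤ CA →
          (IsRegularObs N (M N) φ w₁ w₂ A₁ → IsRegularObs N (M N) φ w₂ w₃ A₂ →
            IsRegularObs N (M N) φ w₃ w₄ A₃ → IsRegularObs N (M N) φ w₄ w₅ A₄ →
            opNorm (M5 N w₁ A₁ w₂ A₂ w₃ A₃ w₄ A₄ w₅) ≤
              C * (if min |w₁.im| (min |w₂.im| (min |w₃.im| (min |w₄.im| |w₅.im|))) ≤ 1 then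
                  (min |w₁.im| (min |w₂.im| (min |w₃.im| (min |w₄.im| |w₅.im|)))) ^ (-(2 : ℝ))
                else
                  (min |w₁.im| (min |w₂.im| (min |w₃.im| (min |w₄.im| |w₅.im|)))) ^ (-(5 : ℝ)))) ∧
          (IsRegularObs N (M N) φ w₁ w₂ A₁ → IsRegularObs N (M N) φ w₂ w₃ A₂ →
            IsRegularObs N (M N) φ w₃ w₄ A₃ → IsRegularObs N (M N) φ w₄ w₁ A₄ →
            ‖ntr (M4 N w₁ A₁ w₂ A₂ w₃ A₃ w₄ * A₄)‖ ≤
              C * (if min |w₁.im| (min |w₂.im| (min |w₃.im| |w₄.im|)) ≤ 1 then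
                  (min |w₁.im| (min |w₂.im| (min |w₃.im| |w₄.im|))) ^ (-(1 : ℝ))
                else (min |w₁.im| (min |w₂.im| (min |w₃.im| |w₄.im|))) ^ (-(4 : ℝ))))) := by
  obtain ⟨K, hK1, hK⟩ := exists_chainStab CΛ κ hκ
  have hK0 : 0 < K := one_pos.trans_le hK1
  refine ⟨K⁻¹, inv_pos.2 hK0, fun δ hδ hδK φ hφ => ?_⟩
  have hKδ : K * δ ≤ 1 := by
    rw [← mul_inv_cancel₀ hK0.ne']
    gcongr
  have hδ1 : δ ≤ 1 := hδK.trans (inv_le_one_of_one_le₀ hK1)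
  have h6 : 0 < 6 / δ := by positivity
  have hCA := abs_nonneg CA
  obtain ⟨B, hB⟩ : ∃ B, B = K + 2 + |CA| + 6 / δ := ⟨_, rfl⟩
  have hB0 : 0 < B := by linarith
  have hBA : CA ≤ B := by linarith [le_abs_self CA]
  refine ⟨B ^ 60, by positivity, fun N => ?_⟩
  have hr : 0 < κ ^ ((1 : ℝ) / 3) := Real.rpow_pos_of_pos hκ _
  rcases eq_or_ne N 0 with rfl | hN
  · have hρ0 : ∀ e, ¬ κ ^ ((1 : ℝ) / 3) ≤ ρ 0 e := fun e he => by
      rw [hρ, density_eq_zero (hmB 0 e), Complex.zero_im, zero_div] at he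
      exact he.not_gt hr
    refine ⟨?_, ?_, ?_, ?_⟩
    · intro _ _ _ _ h1
      exact absurd h1 (hρ0 _)
    · intro _ _ _ _ _ _ h1
      exact absurd h1 (hρ0 _)
    · intro _ _ _ _ _ _ _ _ h1
      exact absurd h1 (hρ0 _)
    · intro _ _ _ _ _ _ _ _ _ _ h1
      exact absurd h1 (hρ0 _)
  have hs := hK N hN (Λ N) (hΛ N) (M N) (hM N) (mB N) (ρ N) (hmB N) (hρ N)
  have h : ChainCtx (M N) (bulkSet (ρ N) (κ ^ ((1 : ℝ) / 3))) B (δ / 2) :=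
    { toChainStab := hs.mono (by linarith)
      two_le := by linarith
      d_le := by linarith
      le_mul_d := by
        have : 6 / δ * (δ / 2) = 3 := by field_simp; norm_num
        rw [← this]
        gcongr
        linarith }
  have reg : ∀ {w w' : ℂ}, w ∈ bulkSet (ρ N) (κ ^ ((1 : ℝ) / 3)) →
      w' ∈ bulkSet (ρ N) (κ ^ ((1 : ℝ) / 3)) → ∀ {A : Mat2 N},
      IsRegularObs N (M N) φ w w' A → Reg (M N) (δ / 2) w w' A :=
    fun hw hw' _ hA => hs.reg hN hKδ hφ hw hw' hA
  have i2 := hM2 N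
  have i3 := hM3 N
  have i4 := hM4 N
  have i5 := hM5 N
  refine ⟨?_, ?_, ?_, ?_⟩
  · intro w₁ w₂ n₁ n₂ r₁ r₂ A₁ a₁
    have m₁ : w₁ ∈ bulkSet (ρ N) _ := ⟨n₁, r₁⟩
    have m₂ : w₂ ∈ bulkSet (ρ N) _ := ⟨n₂, r₂⟩
    have p₁ := abs_pos.2 n₁
    have p₂ := abs_pos.2 n₂
    exact ⟨fun R₁ => h.chain2_bound i2 m₁ m₂ (a₁.trans hBA) (lt_min p₁ p₂) (by simp) (by simp)
        (reg m₁ m₂ R₁),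
      fun _ => h.chain1_trace_bound m₁ (a₁.trans hBA) p₁ le_rfl⟩
  · intro w₁ w₂ w₃ n₁ n₂ n₃ r₁ r₂ r₃ A₁ A₂ a₁ a₂
    have m₁ : w₁ ∈ bulkSet (ρ N) _ := ⟨n₁, r₁⟩
    have m₂ : w₂ ∈ bulkSet (ρ N) _ := ⟨n₂, r₂⟩
    have m₃ : w₃ ∈ bulkSet (ρ N) _ := ⟨n₃, r₃⟩
    have p₁ := abs_pos.2 n₁
    have p₂ := abs_pos.2 n₂
    have p₃ := abs_pos.2 n₃
    exact ⟨fun R₁ R₂ => h.chain3_bound i2 i3 m₁ m₂ m₃ (a₁.trans hBA) (a₂.trans hBA)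
        (lt_min p₁ (lt_min p₂ p₃)) (by simp) (by simp) (by simp) (reg m₁ m₂ R₁) (reg m₂ m₃ R₂),
      fun R₁ _ => h.chain2_trace_bound i2 m₁ m₂ (a₁.trans hBA) (a₂.trans hBA) (lt_min p₁ p₂)
        (by simp) (by simp) (reg m₁ m₂ R₁)⟩
  · intro w₁ w₂ w₃ w₄ n₁ n₂ n₃ n₄ r₁ r₂ r₃ r₄ A₁ A₂ A₃ a₁ a₂ a₃
    have m₁ : w₁ ∈ bulkSet (ρ N) _ := ⟨n₁, r₁⟩
    have m₂ : w₂ ∈ bulkSet (ρ N) _ := ⟨n₂, r₂⟩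
    have m₃ : w₃ ∈ bulkSet (ρ N) _ := ⟨n₃, r₃⟩
    have m₄ : w₄ ∈ bulkSet (ρ N) _ := ⟨n₄, r₄⟩
    have p₁ := abs_pos.2 n₁
    have p₂ := abs_pos.2 n₂
    have p₃ := abs_pos.2 n₃
    have p₄ := abs_pos.2 n₄
    exact ⟨fun R₁ R₂ R₃ => h.chain4_bound i2 i3 i4 m₁ m₂ m₃ m₄ (a₁.trans hBA) (a₂.trans hBA)
        (a₃.trans hBA) (lt_min p₁ (lt_min p₂ (lt_min p₃ p₄))) (by simp) (by simp) (by simp)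
        (by simp) (reg m₁ m₂ R₁) (reg m₂ m₃ R₂) (reg m₃ m₄ R₃),
      fun R₁ R₂ R₃ => h.chain3_trace_bound i2 i3 m₁ m₂ m₃ (a₁.trans hBA) (a₂.trans hBA)
        (a₃.trans hBA) (lt_min p₁ (lt_min p₂ p₃)) (by simp) (by simp) (by simp)
        (reg m₁ m₂ R₁) (reg m₂ m₃ R₂) (reg m₃ m₁ R₃)⟩
  · intro w₁ w₂ w₃ w₄ w₅ n₁ n₂ n₃ n₄ n₅ r₁ r₂ r₃ r₄ r₅ A₁ A₂ A₃ A₄ a₁ a₂ a₃ a₄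
    have m₁ : w₁ ∈ bulkSet (ρ N) _ := ⟨n₁, r₁⟩
    have m₂ : w₂ ∈ bulkSet (ρ N) _ := ⟨n₂, r₂⟩
    have m₃ : w₃ ∈ bulkSet (ρ N) _ := ⟨n₃, r₃⟩
    have m₄ : w₄ ∈ bulkSet (ρ N) _ := ⟨n₄, r₄⟩
    have m₅ : w₅ ∈ bulkSet (ρ N) _ := ⟨n₅, r₅⟩
    have p₁ := abs_pos.2 n₁
    have p₂ := abs_pos.2 n₂
    have p₃ := abs_pos.2 n₃
    have p₄ := abs_pos.2 n₄
    have p₅ := abs_pos.2 n₅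
    exact ⟨fun R₁ R₂ R₃ R₄ => h.chain5_bound i2 i3 i4 i5 m₁ m₂ m₃ m₄ m₅ (a₁.trans hBA)
        (a₂.trans hBA) (a₃.trans hBA) (a₄.trans hBA)
        (lt_min p₁ (lt_min p₂ (lt_min p₃ (lt_min p₄ p₅)))) (by simp) (by simp) (by simp)
        (by simp) (by simp) (reg m₁ m₂ R₁) (reg m₂ m₃ R₂) (reg m₃ m₄ R₃) (reg m₄ m₅ R₄),
      fun R₁ R₂ R₃ _ => h.chain4_trace_bound i2 i3 i4 m₁ m₂ m₃ m₄ (a₁.trans hBA)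
        (a₂.trans hBA) (a₃.trans hBA) (a₄.trans hBA)
        (lt_min p₁ (lt_min p₂ (lt_min p₃ p₄))) (by simp) (by simp) (by simp)
        (by simp) (reg m₁ m₂ R₁) (reg m₂ m₃ R₂) (reg m₃ m₄ R₃)⟩
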